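/- For every prime p, the set of pairs (u,v) ∈ ℝ × ℚ_p that do not satisfy condition (1.2) is a countable union of sets each of which has upper box dimension zero; in particular, it has Hausdorff dimension zero (with respect to the product metric on ℝ × ℚ_p, the maximum of the Euclidean metric on ℝ and the p-adic metric on ℚ_p). -/

import Mathlib

/-- Condition (1.2): `liminf_{|q|,|q₀| → ∞} |q|·|qu − q₀|·|qv − q₀|_p = 0`. -/
def Cond12 (p : ℕ) [Fact p.Prime] (u : ℝ) (v : ℚ_[p]) : Prop :=
  ∀ ε : ℝ, 0 < ε → ∀ N : ℕ, ∃ q q₀ : ℤ,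
    (N : ℤ) ≤ |q| ∧ (N : ℤ) ≤ |q₀| ∧
    (|q| : ℝ) * |(q : ℝ) * u - (q₀ : ℝ)| * ‖(q : ℚ_[p]) * v - (q₀ : ℚ_[p])‖ < ε

/-- `F` is a `δ`-separated finite set for the distance function `d`. -/
def IsSepIn {Z : Type*} (d : Z → Z → ℝ) (δ : ℝ) (F : Finset Z) : Prop :=
  ∀ x ∈ F, ∀ y ∈ F, x ≠ y → δ < d x y

/-- `sepNum d δ E` is the maximal cardinality of a `δ`-separated subset of `E`. -/
noncomputable def sepNum {Z : Type*} (d : Z → Z → ℝ) (δ : ℝ) (E : Set Z) : ℕ :=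
  sSup {n : ℕ | ∃ F : Finset Z, ↑F ⊆ E ∧ IsSepIn d δ F ∧ F.card = n}

/-- The upper box dimension of `E`: `limsup_{δ → 0⁺} log s_δ(E) / |log δ|`. -/
noncomputable def upperBoxDim {Z : Type*} (d : Z → Z → ℝ) (E : Set Z) : ℝ :=
  Filter.limsup (fun δ : ℝ => Real.log (sepNum d δ E) / |Real.log δ|)
    (nhdsWithin 0 (Set.Ioi 0))

open Set Filter Topology MeasureTheory
open scoped ENNReal NNReal MatrixGroups Pointwise


open Classical in
/-- Hardy–Littlewood maximal inequality for subsets of an initial segment of `ℕ`. -/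
lemma card_maximal_le (β : ℕ → Prop) {ζ : ℝ} (hζ : 0 ≤ ζ) (N : ℕ) :
    ζ * ((Finset.range N).filter (fun n => ∃ J : ℕ, 1 ≤ J ∧ J ≤ n + 1 ∧
      ζ * J < ((Finset.Ico (n + 1 - J) (n + 1)).filter β).card)).card ≤
      ((Finset.range N).filter β).card := by
  induction N using Nat.strong_induction_on with
  | _ N ih =>
  rcases N with _ | N
  · simp
  set bad : ℕ → Prop := fun n => ∃ J : ℕ, 1 ≤ J ∧ J ≤ n + 1 ∧
      ζ * J < ((Finset.Ico (n + 1 - J) (n + 1)).filter β).card with hbad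
  by_cases h : bad N
  · obtain ⟨J, hJ1, hJ2, hJ⟩ := h
    have h1 := ih (N + 1 - J) (by omega)
    have split : ∀ γ : ℕ → Prop, ((Finset.range (N + 1)).filter γ).card =
        ((Finset.range (N + 1 - J)).filter γ).card +
        ((Finset.Ico (N + 1 - J) (N + 1)).filter γ).card := by
      intro γ
      rw [← Finset.card_union_of_disjoint, ← Finset.filter_union]
      · congr 2
        ext x; simp; omega
      · apply Finset.disjoint_filter_filter
        rw [Finset.disjoint_left]; intro x; simp; omega
    rw [split bad, split β]
    have h2 : ((Finset.Ico (N + 1 - J) (N + 1)).filter bad).card ≤ J := by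
      refine (Finset.card_filter_le _ _).trans ?_
      simp; omega
    have h3 : ζ * (((Finset.Ico (N + 1 - J) (N + 1)).filter bad).card : ℝ) ≤ ζ * J := by
      gcongr
    push_cast
    have h4 : ζ * (((Finset.range (N + 1 - J)).filter bad).card : ℝ) ≤
      ((Finset.range (N + 1 - J)).filter β).card := h1
    linarith
  · have h1 := ih N (by omega)
    rw [Finset.range_add_one, Finset.filter_insert, if_neg h]
    refine h1.trans ?_
    exact_mod_cast Finset.card_le_card (Finset.filter_subset_filter _ (Finset.subset_insert _ _))

/-- A Markov chain driven by words: from `ω` one moves to `Z d ω` with probability `p d ω`,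
and `b` is a symmetry. -/
structure WordChain (Ω D : Type*) [MeasurableSpace Ω] [Fintype D] where
  p : D → Ω → ℝ≥0∞
  Z : D → Ω → Ω
  b : Ω → Ω
  sum_p : ∀ ω, ∑ d, p d ω = 1
  meas_p : ∀ d, Measurable (p d)
  meas_Z : ∀ d, Measurable (Z d)
  meas_b : Measurable b
  p_b : ∀ d ω, p d (b ω) = p d ω
  Z_b : ∀ d ω, Z d (b ω) = b (Z d ω)

namespace WordChain

variable {Ω D : Type*} [MeasurableSpace Ω] [Fintype D] (c : WordChain Ω D)

/-- Expectation of a function of the first `n` letters, starting from `ω`. -/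
noncomputable def expect : ℕ → Ω → (List D → ℝ≥0∞) → ℝ≥0∞
  | 0, _, F => F []
  | n + 1, ω, F => ∑ d, c.p d ω * expect n (c.Z d ω) (fun w => F (d :: w))

/-- The state reached from `ω` after reading a word. -/
def run : Ω → List D → Ω
  | ω, [] => ω
  | ω, d :: w => run (c.Z d ω) w

/-- The probability of a word. -/
noncomputable def wt : Ω → List D → ℝ≥0∞
  | _, [] => 1
  | ω, d :: w => c.p d ω * wt (c.Z d ω) w

lemma run_append (ω : Ω) (v w : List D) : c.run ω (v ++ w) = c.run (c.run ω v) w := by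
  induction v generalizing ω with
  | nil => rfl
  | cons d v ih => exact ih _

lemma wt_append (ω : Ω) (v w : List D) :
    c.wt ω (v ++ w) = c.wt ω v * c.wt (c.run ω v) w := by
  induction v generalizing ω with
  | nil => simp [wt, run]
  | cons d v ih => simp [wt, run, ih, mul_assoc]

lemma run_b (ω : Ω) (w : List D) : c.run (c.b ω) w = c.b (c.run ω w) := by
  induction w generalizing ω with
  | nil => rfl
  | cons d w ih => simp [run, c.Z_b, ih]

lemma wt_b (ω : Ω) (w : List D) : c.wt (c.b ω) w = c.wt ω w := by
  induction w generalizing ω with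
  | nil => rfl
  | cons d w ih => simp [wt, c.Z_b, c.p_b, ih]

lemma expect_b (n : ℕ) (ω : Ω) (F : List D → ℝ≥0∞) :
    c.expect n (c.b ω) F = c.expect n ω F := by
  induction n generalizing ω F with
  | zero => rfl
  | succ n ih => simp [expect, c.Z_b, c.p_b, ih]

lemma run_b_iter (m : ℕ) (ω : Ω) (w : List D) :
    c.run (c.b^[m] ω) w = c.b^[m] (c.run ω w) := by
  induction m generalizing ω with
  | zero => rfl
  | succ m ih => rw [Function.iterate_succ_apply, ih, run_b, ← Function.iterate_succ_apply]

lemma wt_b_iter (m : ℕ) (ω : Ω) (w : List D) : c.wt (c.b^[m] ω) w = c.wt ω w := by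
  induction m generalizing ω with
  | zero => rfl
  | succ m ih => rw [Function.iterate_succ_apply, ih, wt_b]

lemma expect_b_iter (m n : ℕ) (ω : Ω) (F : List D → ℝ≥0∞) :
    c.expect n (c.b^[m] ω) F = c.expect n ω F := by
  induction m generalizing ω with
  | zero => rfl
  | succ m ih => rw [Function.iterate_succ_apply, ih, expect_b]

lemma expect_mono {n : ℕ} {ω : Ω} {F G : List D → ℝ≥0∞}
    (h : ∀ w, w.length = n → c.wt ω w ≠ 0 → F w ≤ G w) : c.expect n ω F ≤ c.expect n ω G := by
  induction n generalizing ω F G with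
  | zero => exact h [] rfl (by simp [wt])
  | succ n ih =>
    refine Finset.sum_le_sum fun d _ => ?_
    by_cases hd : c.p d ω = 0
    · simp [hd]
    · gcongr
      exact ih fun w hw hw0 => h (d :: w) (by simp [hw]) (mul_ne_zero hd hw0)

lemma expect_const (n : ℕ) (ω : Ω) (r : ℝ≥0∞) : c.expect n ω (fun _ => r) = r := by
  induction n generalizing ω with
  | zero => rfl
  | succ n ih => simp [expect, ih, ← Finset.sum_mul, c.sum_p]

lemma expect_add (n : ℕ) (ω : Ω) (F G : List D → ℝ≥0∞) :
    c.expect n ω (fun w => F w + G w) = c.expect n ω F + c.expect n ω G := by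
  induction n generalizing ω F G with
  | zero => rfl
  | succ n ih => simp [expect, ih, mul_add, Finset.sum_add_distrib]

lemma expect_sum {ι : Type*} (s : Finset ι) (n : ℕ) (ω : Ω) (F : ι → List D → ℝ≥0∞) :
    c.expect n ω (fun w => ∑ i ∈ s, F i w) = ∑ i ∈ s, c.expect n ω (F i) := by
  classical
  induction s using Finset.induction_on with
  | empty => simpa using c.expect_const n ω 0
  | insert i s hi ih => simp only [Finset.sum_insert hi, expect_add, ih]

lemma expect_const_mul (n : ℕ) (ω : Ω) (r : ℝ≥0∞) (F : List D → ℝ≥0∞) :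
    c.expect n ω (fun w => r * F w) = r * c.expect n ω F := by
  induction n generalizing ω F with
  | zero => rfl
  | succ n ih =>
    simp only [expect, ih, Finset.mul_sum]
    exact Finset.sum_congr rfl fun d _ => by ring

lemma expect_take {t N : ℕ} (h : t ≤ N) (ω : Ω) (F : List D → ℝ≥0∞) :
    c.expect N ω (fun w => F (w.take t)) = c.expect t ω F := by
  induction t generalizing N ω F with
  | zero => exact c.expect_const N ω (F [])
  | succ t ih =>
    obtain ⟨N, rfl⟩ : ∃ M, N = M + 1 := ⟨N - 1, by omega⟩
    simp only [expect, List.take_succ_cons]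
    exact Finset.sum_congr rfl fun d _ => by
      rw [ih (by omega) (c.Z d ω) (fun w => F (d :: w))]

lemma expect_eq_sum_wt [DecidableEq D] (n : ℕ) (ω : Ω) (s : Finset (List D))
    (hs : ∀ w ∈ s, w.length = n) :
    c.expect n ω (fun w => if w ∈ s then 1 else 0) = ∑ w ∈ s, c.wt ω w := by
  have key : ∀ (v : List D) (n : ℕ) (ω : Ω), v.length = n →
      c.expect n ω (fun w => if w = v then 1 else 0) = c.wt ω v := by
    intro v
    induction v with
    | nil => rintro n ω rfl; simp [expect, wt]
    | cons d v ih =>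
      rintro n ω rfl
      simp only [List.length_cons, expect, wt, List.cons.injEq]
      rw [Finset.sum_eq_single d]
      · simp [ih]
      · intro e _ he
        simp [he, expect_const]
      · simp
  have h1 : (fun w : List D => if w ∈ s then (1 : ℝ≥0∞) else 0) =
      fun w => ∑ v ∈ s, if w = v then 1 else 0 := by
    ext w; simp
  rw [h1, expect_sum]
  exact Finset.sum_congr rfl fun v hv => key v n ω (hs v hv)

lemma measurable_expect (n : ℕ) {F : Ω → List D → ℝ≥0∞} (hF : ∀ w, Measurable fun ω => F ω w) :
    Measurable fun ω => c.expect n ω (F ω) := by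
  suffices ∀ (n : ℕ) (g : Ω → Ω) (_ : Measurable g) (F : Ω → List D → ℝ≥0∞),
      (∀ w, Measurable fun ω => F ω w) → Measurable fun ω => c.expect n (g ω) (F ω) from
    this n id measurable_id F hF
  intro n
  induction n with
  | zero => intro g _ F hF; exact hF []
  | succ n ih =>
    intro g hg F hF
    refine Finset.measurable_sum _ fun d _ => ((c.meas_p d).comp hg).mul ?_
    exact ih (fun ω => c.Z d (g ω)) ((c.meas_Z d).comp hg) (fun ω w => F ω (d :: w))
      fun w => hF (d :: w)

lemma measurable_run (w : List D) : Measurable fun ω => c.run ω w := by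
  induction w with
  | nil => exact measurable_id
  | cons d w ih => exact ih.comp (c.meas_Z d)

/-- A measure decreasing under the transition operator and under the symmetry. -/
structure Substationary (P : Measure Ω) : Prop where
  step : ∀ f : Ω → ℝ≥0∞, Measurable f → ∫⁻ ω, ∑ d, c.p d ω * f (c.Z d ω) ∂P ≤ ∫⁻ ω, f ω ∂P
  symm : ∀ f : Ω → ℝ≥0∞, Measurable f → ∫⁻ ω, f (c.b ω) ∂P ≤ ∫⁻ ω, f ω ∂P

variable {c} {P : Measure Ω}

lemma Substationary.lintegral_expect_le (hP : c.Substationary P) (n : ℕ) {f : Ω → ℝ≥0∞}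
    (hf : Measurable f) : ∫⁻ ω, c.expect n ω (fun w => f (c.run ω w)) ∂P ≤ ∫⁻ ω, f ω ∂P := by
  induction n with
  | zero => simp [expect, run]
  | succ n ih =>
    exact (hP.step _ (c.measurable_expect n fun w => hf.comp (c.measurable_run w))).trans ih

lemma Substationary.lintegral_b_iter_le (hP : c.Substationary P) (m : ℕ) {f : Ω → ℝ≥0∞}
    (hf : Measurable f) : ∫⁻ ω, f (c.b^[m] ω) ∂P ≤ ∫⁻ ω, f ω ∂P := by
  induction m with
  | zero => simp
  | succ m ih =>
    have := hP.symm (fun ω => f (c.b^[m] ω)) (hf.comp (c.meas_b.iterate m))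
    exact this.trans ih

end WordChain

namespace WordChain

variable {Ω D : Type*} [MeasurableSpace Ω] [Fintype D] (c : WordChain Ω D)

/-- Along the word, some conditional expectation of `h` at time `T` exceeds `ε`. -/
def Peak (h : Ω → ℝ≥0∞) (ε : ℝ≥0∞) : ℕ → Ω → List D → Prop
  | 0, ω, _ => ε < h ω
  | _ + 1, _, [] => False
  | T + 1, ω, d :: w =>
    ε < c.expect (T + 1) ω (fun v => h (c.run ω v)) ∨ Peak h ε T (c.Z d ω) w

variable {h : Ω → ℝ≥0∞} {ε : ℝ≥0∞}

lemma expect_le_of_not_peak {T : ℕ} {ω : Ω} {w : List D} (hw : T ≤ w.length)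
    (hn : ¬ c.Peak h ε T ω w) {t : ℕ} (ht : t ≤ T) :
    c.expect (T - t) (c.run ω (w.take t)) (fun v => h (c.run (c.run ω (w.take t)) v)) ≤ ε := by
  induction T generalizing ω w t with
  | zero =>
    obtain rfl : t = 0 := by omega
    simpa [expect, run, Peak] using hn
  | succ T ih =>
    rcases w with _ | ⟨d, w⟩
    · simp at hw
    simp only [Peak, not_or, not_lt] at hn
    rcases t with _ | t
    · simpa [run] using hn.1
    · have := ih (by simpa using hw) hn.2 (t := t) (by omega)
      simpa [run] using this

lemma peak_take {T N : ℕ} (hTN : T ≤ N) (ω : Ω) (w : List D) :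
    c.Peak h ε T ω (w.take N) ↔ c.Peak h ε T ω w := by
  induction T generalizing N ω w with
  | zero => rfl
  | succ T ih =>
    obtain ⟨N, rfl⟩ : ∃ M, N = M + 1 := ⟨N - 1, by omega⟩
    rcases w with _ | ⟨d, w⟩
    · rfl
    · simp [Peak, ih (show T ≤ N by omega)]

open Classical in
lemma expect_peak_le (hε : ε ≠ 0) (hε' : ε ≠ ∞) (T : ℕ) (ω : Ω) :
    c.expect T ω (fun w => if c.Peak h ε T ω w then 1 else 0) ≤
      ε⁻¹ * c.expect T ω (fun w => h (c.run ω w)) := by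
  have key : ∀ x : ℝ≥0∞, ε < x → 1 ≤ ε⁻¹ * x := fun x hx => by
    calc (1 : ℝ≥0∞) = ε⁻¹ * ε := (ENNReal.inv_mul_cancel hε hε').symm
      _ ≤ _ := by gcongr
  induction T generalizing ω with
  | zero =>
    change (if c.Peak h ε 0 ω [] then (1 : ℝ≥0∞) else 0) ≤ ε⁻¹ * h ω
    split_ifs with hx
    · exact key _ hx
    · exact zero_le
  | succ T ih =>
    by_cases hx : ε < c.expect (T + 1) ω (fun v => h (c.run ω v))
    · refine le_trans ?_ (key _ hx)
      refine (c.expect_mono (G := fun _ => 1) fun w _ _ => ?_).trans_eq (c.expect_const _ _ _)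
      split_ifs <;> simp
    · have h1 : ∀ d w, (if c.Peak h ε (T + 1) ω (d :: w) then (1 : ℝ≥0∞) else 0) =
          if c.Peak h ε T (c.Z d ω) w then 1 else 0 := fun d w =>
        if_congr (or_iff_right hx) rfl rfl
      simp only [expect, run, Finset.mul_sum, h1]
      refine Finset.sum_le_sum fun d _ => ?_
      calc _ ≤ c.p d ω * (ε⁻¹ * c.expect T (c.Z d ω) (fun w => h (c.run (c.Z d ω) w))) := by
            gcongr; exact ih _
        _ = _ := by ring

lemma measurableSet_peak (hh : Measurable h) (T : ℕ) (w : List D) :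
    MeasurableSet {ω | c.Peak h ε T ω w} := by
  induction T generalizing w with
  | zero => exact measurableSet_lt measurable_const hh
  | succ T ih =>
    rcases w with _ | ⟨d, w⟩
    · exact MeasurableSet.empty
    · exact (measurableSet_lt measurable_const (c.measurable_expect (T + 1)
        fun v => hh.comp (c.measurable_run v))).union (c.meas_Z d (ih w))

/-- The time `t` is bad along the word: the state lies in `S`, or there is a peak at time `t`. -/
def BadTime (S : Set Ω) (h : Ω → ℝ≥0∞) (ε : ℝ≥0∞) (ω : Ω) (w : List D) (t : ℕ) : Prop :=
  c.run ω (w.take t) ∈ S ∨ c.Peak h ε t ω w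

open Classical in
/-- Every window of length at most `H` ending at `n` has at most a proportion `ζ` of bad times. -/
def GoodEnd (S : Set Ω) (h : Ω → ℝ≥0∞) (ε : ℝ≥0∞) (ζ : ℝ) (H : ℕ) (ω : Ω) (w : List D)
    (n : ℕ) : Prop :=
  ∀ J : ℕ, 1 ≤ J → J ≤ H →
    (((Finset.Ico (n + 1 - J) (n + 1)).filter (c.BadTime S h ε ω w)).card : ℝ) ≤ ζ * J

variable {S : Set Ω} {P : Measure Ω}

open Classical in
lemma Substationary.lintegral_badTime_le {c : WordChain Ω D} (hP : c.Substationary P)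
    (hS : MeasurableSet S) (hh : Measurable h) (hε : ε ≠ 0) (hε' : ε ≠ ∞) {t N : ℕ}
    (htN : t ≤ N) :
    ∫⁻ ω, c.expect N ω (fun w => if c.BadTime S h ε ω w t then 1 else 0) ∂P ≤
      P S + ε⁻¹ * ∫⁻ ω, h ω ∂P := by
  have h1 : ∀ ω, c.expect N ω (fun w => if c.BadTime S h ε ω w t then 1 else 0) ≤
      c.expect t ω (fun w => S.indicator 1 (c.run ω w)) +
        ε⁻¹ * c.expect t ω (fun w => h (c.run ω w)) := by
    intro ω
    have h2 := c.expect_take htN ω (fun w => S.indicator 1 (c.run ω w) +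
      if c.Peak h ε t ω w then (1 : ℝ≥0∞) else 0)
    refine le_trans (c.expect_mono ?_) (h2.le.trans ((c.expect_add _ _ _ _).trans_le
      (add_le_add_right (c.expect_peak_le hε hε' t ω) _)))
    intro w _ _
    rw [c.peak_take le_rfl]
    by_cases h3 : c.run ω (w.take t) ∈ S
    · simp only [BadTime, h3, true_or, if_true, indicator_of_mem, Pi.one_apply]
      exact le_self_add
    · simp [BadTime, h3]
  have m1 : Measurable (S.indicator (1 : Ω → ℝ≥0∞)) := measurable_one.indicator hS
  calc _ ≤ ∫⁻ ω, (c.expect t ω (fun w => S.indicator 1 (c.run ω w)) +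
        ε⁻¹ * c.expect t ω (fun w => h (c.run ω w))) ∂P := lintegral_mono h1
    _ = ∫⁻ ω, c.expect t ω (fun w => S.indicator 1 (c.run ω w)) ∂P +
        ε⁻¹ * ∫⁻ ω, c.expect t ω (fun w => h (c.run ω w)) ∂P := by
      rw [lintegral_add_left, lintegral_const_mul]
      · exact c.measurable_expect t fun w => hh.comp (c.measurable_run w)
      · exact c.measurable_expect t fun w => m1.comp (c.measurable_run w)
    _ ≤ ∫⁻ ω, S.indicator 1 ω ∂P + ε⁻¹ * ∫⁻ ω, h ω ∂P := by
      exact add_le_add (hP.lintegral_expect_le t m1)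
        (mul_le_mul_right (hP.lintegral_expect_le t hh) _)
    _ = _ := by rw [lintegral_indicator_one hS]

open Classical in
lemma sum_not_goodEnd_le {ζ : ℝ} (hζ : 0 ≤ ζ) (H : ℕ) (ω : Ω) (w : List D) :
    ENNReal.ofReal ζ * ((Finset.Ico H (2 * H)).filter
        fun n => ¬ c.GoodEnd S h ε ζ H ω w n).card ≤
      ∑ t ∈ Finset.range (2 * H), if c.BadTime S h ε ω w t then (1 : ℝ≥0∞) else 0 := by
  have h1 := card_maximal_le (c.BadTime S h ε ω w) hζ (2 * H)
  have h2 : ζ * ((Finset.Ico H (2 * H)).filter fun n => ¬ c.GoodEnd S h ε ζ H ω w n).card ≤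
      ((Finset.range (2 * H)).filter (c.BadTime S h ε ω w)).card := by
    refine le_trans ?_ h1
    gcongr
    intro n hn
    simp only [Finset.mem_filter, Finset.mem_Ico, GoodEnd, not_forall, not_le] at hn
    obtain ⟨⟨h3, h4⟩, J, hJ1, hJ2, hJ⟩ := hn
    simp only [Finset.mem_filter, Finset.mem_range]
    exact ⟨h4, J, hJ1, by omega, by convert hJ⟩
  have h3 := ENNReal.ofReal_le_ofReal h2
  rw [ENNReal.ofReal_mul hζ, ENNReal.ofReal_natCast, ENNReal.ofReal_natCast] at h3
  refine h3.trans_eq ?_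
  rw [Finset.sum_boole]

open Classical in
/-- Selection: there are a state, a word and a time which is a good end for
more than half of the first `M` translates under the symmetry. -/
theorem Substationary.exists_goodEnd {c : WordChain Ω D} [IsProbabilityMeasure P]
    (hP : c.Substationary P)
    (hS : MeasurableSet S) (hh : Measurable h) (hε : ε ≠ 0) (hε' : ε ≠ ∞) {ζ : ℝ} (hζ : 0 ≤ ζ)
    (hsmall : 4 * (P S + ε⁻¹ * ∫⁻ ω, h ω ∂P) < ENNReal.ofReal ζ) {H M : ℕ} (hH : 1 ≤ H)
    (hM : 1 ≤ M) :
    ∃ ω w n, w.length = 2 * H ∧ c.wt ω w ≠ 0 ∧ H ≤ n ∧ n < 2 * H ∧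
      M < 2 * ((Finset.range M).filter
        fun m => c.GoodEnd S h ε ζ H (c.b^[m] ω) w n).card := by
  by_contra! hcon
  set κ := P S + ε⁻¹ * ∫⁻ ω, h ω ∂P with hκ
  let f : Ω → ℝ≥0∞ := fun ω => c.expect (2 * H) ω
    (fun w => ∑ t ∈ Finset.range (2 * H), if c.BadTime S h ε ω w t then (1 : ℝ≥0∞) else 0)
  have mBad : ∀ t w, MeasurableSet {ω | c.BadTime S h ε ω w t} := fun t w =>
    (c.measurable_run (w.take t) hS).union (c.measurableSet_peak hh t w)
  have mf : Measurable f := c.measurable_expect _ fun w => Finset.measurable_sum _ fun t _ =>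
    Measurable.ite (mBad t w) measurable_const measurable_const
  have hf : ∫⁻ ω, f ω ∂P ≤ (2 * H : ℕ) * κ := by
    simp only [f, expect_sum]
    rw [lintegral_finsetSum]
    · calc _ ≤ ∑ t ∈ Finset.range (2 * H), κ := Finset.sum_le_sum fun t ht =>
            hP.lintegral_badTime_le hS hh hε hε' (by simp at ht; omega)
        _ = _ := by simp
    · exact fun t _ => c.measurable_expect _ fun w =>
        Measurable.ite (mBad t w) measurable_const measurable_const
  have h1 : ∀ ω, ENNReal.ofReal ζ * (H * M) ≤ 2 * ∑ m ∈ Finset.range M, f (c.b^[m] ω) := by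
    intro ω
    simp only [f, expect_b_iter]
    rw [← expect_sum, ← expect_const_mul]
    rw [← c.expect_const (2 * H) ω (ENNReal.ofReal ζ * (H * M))]
    refine c.expect_mono fun w hw hw0 => ?_
    calc ENNReal.ofReal ζ * (H * M)
        ≤ ENNReal.ofReal ζ * (2 * ∑ m ∈ Finset.range M,
          (((Finset.Ico H (2 * H)).filter
            fun n => ¬ c.GoodEnd S h ε ζ H (c.b^[m] ω) w n).card : ℝ≥0∞)) := by
          refine mul_le_mul_right ?_ _
          have h2 : ∀ n ∈ Finset.Ico H (2 * H), M ≤ 2 * ∑ m ∈ Finset.range M,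
              if ¬ c.GoodEnd S h ε ζ H (c.b^[m] ω) w n then 1 else 0 := by
            intro n hn
            rw [Finset.mem_Ico] at hn
            have h3 := hcon ω w n hw hw0 hn.1 hn.2
            have h4 := Finset.card_filter_add_card_filter_not (s := Finset.range M)
              (fun m => c.GoodEnd S h ε ζ H (c.b^[m] ω) w n)
            rw [Finset.card_range] at h4
            rw [← Finset.card_filter]
            omega
          have h5 := Finset.sum_le_sum h2
          rw [← Finset.mul_sum, Finset.sum_comm] at h5
          simp only [← Finset.card_filter] at h5
          simp only [Finset.sum_const, Nat.card_Ico, smul_eq_mul] at h5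
          rw [show 2 * H - H = H by omega] at h5
          exact_mod_cast h5
      _ = 2 * ∑ m ∈ Finset.range M, ENNReal.ofReal ζ *
          (((Finset.Ico H (2 * H)).filter
            fun n => ¬ c.GoodEnd S h ε ζ H (c.b^[m] ω) w n).card : ℝ≥0∞) := by
          rw [← Finset.mul_sum]; ring
      _ ≤ _ := by
          gcongr with m hm
          exact c.sum_not_goodEnd_le hζ H _ w
  have h2 : ENNReal.ofReal ζ * (H * M) ≤ 2 * (M * ((2 * H : ℕ) * κ)) := by
    calc ENNReal.ofReal ζ * (H * M) = ∫⁻ _, ENNReal.ofReal ζ * (H * M) ∂P := by simp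
      _ ≤ ∫⁻ ω, 2 * ∑ m ∈ Finset.range M, f (c.b^[m] ω) ∂P := lintegral_mono h1
      _ = 2 * ∑ m ∈ Finset.range M, ∫⁻ ω, f (c.b^[m] ω) ∂P := by
        rw [lintegral_const_mul, lintegral_finsetSum]
        · exact fun m _ => mf.comp (c.meas_b.iterate m)
        · exact Finset.measurable_sum _ fun m _ => mf.comp (c.meas_b.iterate m)
      _ ≤ 2 * ∑ m ∈ Finset.range M, (2 * H : ℕ) * κ := by
        gcongr with m hm
        exact (hP.lintegral_b_iter_le m mf).trans hf
      _ = _ := by simp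
  have h3 : (2 : ℝ≥0∞) * (M * ((2 * H : ℕ) * κ)) = (4 * κ) * (H * M) := by push_cast; ring
  rw [h3] at h2
  have hne : ((H : ℝ≥0∞) * M) ≠ 0 := by
    have : H * M ≠ 0 := by positivity
    exact_mod_cast this
  have hnt : ((H : ℝ≥0∞) * M) ≠ ∞ := ENNReal.mul_ne_top (by simp) (by simp)
  exact absurd (lt_of_lt_of_le (ENNReal.mul_lt_mul_left hne hnt hsmall) h2) (lt_irrefl _)

end WordChain

namespace WordChain

variable {Ω D : Type*} [MeasurableSpace Ω] [Fintype D] (c : WordChain Ω D)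

/-- The probability that two independent words of length `n` coincide. -/
noncomputable def coll : ℕ → Ω → ℝ≥0∞
  | 0, _ => 1
  | n + 1, ω => ∑ d, c.p d ω ^ 2 * coll n (c.Z d ω)

lemma p_le_one (d : D) (ω : Ω) : c.p d ω ≤ 1 := by
  rw [← c.sum_p ω]
  exact Finset.single_le_sum (f := fun d => c.p d ω) (fun _ _ => zero_le) (Finset.mem_univ d)

lemma p_sq_le (d : D) (ω : Ω) : c.p d ω ^ 2 ≤ c.p d ω := by
  rw [sq]; exact mul_le_of_le_one_right' (c.p_le_one d ω)

lemma coll_succ_le (n : ℕ) (ω : Ω) : c.coll (n + 1) ω ≤ c.coll n ω := by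
  induction n generalizing ω with
  | zero =>
    simp only [coll, mul_one]
    exact (Finset.sum_le_sum fun d _ => c.p_sq_le d ω).trans_eq (c.sum_p ω)
  | succ n ih =>
    exact Finset.sum_le_sum fun d _ => mul_le_mul_right (ih _) _

lemma coll_antitone (ω : Ω) : Antitone fun n => c.coll n ω :=
  antitone_nat_of_succ_le fun n => c.coll_succ_le n ω

lemma wt_sq_le_coll (ω : Ω) (w : List D) : c.wt ω w ^ 2 ≤ c.coll w.length ω := by
  induction w generalizing ω with
  | nil => simp [wt, coll]
  | cons d w ih =>
    simp only [wt, List.length_cons, coll, mul_pow]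
    exact (mul_le_mul_right (ih _) _).trans (Finset.single_le_sum
      (f := fun d => c.p d ω ^ 2 * c.coll w.length (c.Z d ω)) (fun _ _ => zero_le)
      (Finset.mem_univ d))

lemma measurable_coll (n : ℕ) : Measurable (c.coll n) := by
  induction n with
  | zero => exact measurable_const
  | succ n ih => exact Finset.measurable_sum _ fun d _ =>
      ((c.meas_p d).pow_const 2).mul (ih.comp (c.meas_Z d))

lemma coll_b (n : ℕ) (ω : Ω) : c.coll n (c.b ω) = c.coll n ω := by
  induction n generalizing ω with
  | zero => rfl
  | succ n ih => simp [coll, c.p_b, c.Z_b, ih]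

/-- The probability that two independent infinite words coincide. -/
noncomputable def collInf (ω : Ω) : ℝ≥0∞ := ⨅ n, c.coll n ω

lemma tendsto_coll (ω : Ω) : Tendsto (fun n => c.coll n ω) atTop (𝓝 (c.collInf ω)) :=
  tendsto_atTop_iInf (c.coll_antitone ω)

lemma measurable_collInf : Measurable c.collInf := Measurable.iInf c.measurable_coll

lemma collInf_le_one (ω : Ω) : c.collInf ω ≤ 1 := iInf_le (fun n => c.coll n ω) 0

lemma collInf_eq (ω : Ω) : c.collInf ω = ∑ d, c.p d ω ^ 2 * c.collInf (c.Z d ω) := by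
  refine tendsto_nhds_unique ((tendsto_add_atTop_iff_nat 1).2 (c.tendsto_coll ω)) ?_
  refine tendsto_finsetSum _ fun d _ => ?_
  exact ENNReal.Tendsto.const_mul (c.tendsto_coll _)
    (Or.inr (ENNReal.pow_ne_top ((c.p_le_one d ω).trans_lt ENNReal.one_lt_top).ne))

variable {c} {P : Measure Ω}

lemma Substationary.ae_collInf_eq_zero [IsProbabilityMeasure P] (hP : c.Substationary P) :
    ∀ᵐ ω ∂P, (∀ d, c.p d ω = 0 ∨ c.p d ω = 1) ∨ c.collInf ω = 0 := by
  have m1 : Measurable fun ω => ∑ d, c.p d ω * c.collInf (c.Z d ω) :=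
    Finset.measurable_sum _ fun d _ =>
      (c.meas_p d).mul (c.measurable_collInf.comp (c.meas_Z d))
  have h1 : ∀ᵐ ω ∂P, c.collInf ω = ∑ d, c.p d ω * c.collInf (c.Z d ω) := by
    refine ae_eq_of_ae_le_of_lintegral_le (Eventually.of_forall fun ω => ?_) ?_
      m1.aemeasurable (hP.step _ c.measurable_collInf)
    · rw [c.collInf_eq ω]
      exact Finset.sum_le_sum fun d _ => mul_le_mul_left (c.p_sq_le d ω) _
    · refine ((lintegral_mono (g := fun _ => 1) c.collInf_le_one).trans_lt ?_).ne
      simp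
  filter_upwards [h1] with ω hω
  by_cases htriv : ∀ d, c.p d ω = 0 ∨ c.p d ω = 1
  · exact Or.inl htriv
  right
  rw [c.collInf_eq ω] at hω
  have fin : ∀ d, c.p d ω * c.collInf (c.Z d ω) ≠ ∞ := fun d =>
    ENNReal.mul_ne_top ((c.p_le_one d ω).trans_lt ENNReal.one_lt_top).ne
      ((c.collInf_le_one _).trans_lt ENNReal.one_lt_top).ne
  have heq : ∀ d, c.p d ω ^ 2 * c.collInf (c.Z d ω) = c.p d ω * c.collInf (c.Z d ω) := by
    have hle : ∀ d, c.p d ω ^ 2 * c.collInf (c.Z d ω) ≤ c.p d ω * c.collInf (c.Z d ω) :=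
      fun d => mul_le_mul_left (c.p_sq_le d ω) _
    by_contra! hne
    obtain ⟨d, hd⟩ := hne
    refine absurd hω (ne_of_lt ?_)
    classical
    rw [← Finset.add_sum_erase _ _ (Finset.mem_univ d),
      ← Finset.add_sum_erase _ (fun d => c.p d ω * c.collInf (c.Z d ω)) (Finset.mem_univ d)]
    have hlt := lt_of_le_of_ne (hle d) hd
    refine ENNReal.add_lt_add_of_lt_of_le ?_ hlt (Finset.sum_le_sum fun e _ => hle e)
    exact (ENNReal.sum_lt_top.2 fun e _ => (hle e).trans_lt (fin e).lt_top).ne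
  have hone : ∀ d, c.p d ω ≠ 1 := by
    intro d hd
    refine htriv fun e => ?_
    by_cases hed : e = d
    · exact Or.inr (hed ▸ hd)
    left
    classical
    have h2 := c.sum_p ω
    rw [← Finset.add_sum_erase _ _ (Finset.mem_univ d), hd] at h2
    have h3 : ∑ x ∈ Finset.univ.erase d, c.p x ω = 0 := by
      have : (1 : ℝ≥0∞) + ∑ x ∈ Finset.univ.erase d, c.p x ω = 1 + 0 := by rw [h2, add_zero]
      exact (ENNReal.add_right_inj ENNReal.one_ne_top).1 this
    exact Finset.sum_eq_zero_iff.1 h3 e (by simp [hed])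
  rw [c.collInf_eq ω]
  refine Finset.sum_eq_zero fun d _ => ?_
  by_contra hd
  have hp : c.p d ω ≠ 0 := fun h => hd (by simp [h])
  have hpt : c.p d ω ≠ ∞ := ((c.p_le_one d ω).trans_lt ENNReal.one_lt_top).ne
  have hc : c.collInf (c.Z d ω) ≠ 0 := fun h => hd (by simp [h])
  have hct : c.collInf (c.Z d ω) ≠ ∞ := ((c.collInf_le_one _).trans_lt ENNReal.one_lt_top).ne
  have h4 := (ENNReal.mul_left_inj hc hct).1 (heq d)
  rw [sq] at h4
  exact hone d ((ENNReal.mul_right_inj hp hpt).1 (by rw [h4, mul_one]))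

open ProbabilityTheory in
/-- A substationary probability with a nontrivial first step can be restricted to a
substationary probability for which words have no atoms. -/
theorem Substationary.exists_nonconcentrated [IsProbabilityMeasure P] (hP : c.Substationary P)
    (hnt : ¬ ∀ᵐ ω ∂P, ∀ d, c.p d ω = 0 ∨ c.p d ω = 1) :
    ∃ P' : Measure Ω, IsProbabilityMeasure P' ∧ c.Substationary P' ∧
      ∀ η : ℝ≥0∞, η ≠ 0 → ∀ ε : ℝ≥0∞, ε ≠ 0 → ∃ n₀, ∀ n ≥ n₀,
        P' {ω | ∃ w : List D, w.length = n ∧ η < c.wt ω w} < ε := by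
  set E : Set Ω := {ω | c.collInf ω = 0} with hE
  have mE : MeasurableSet E := c.measurable_collInf (measurableSet_singleton 0)
  have hPE : P E ≠ 0 := by
    intro h0
    apply hnt
    have h1 : ∀ᵐ ω ∂P, ω ∉ E := measure_eq_zero_iff_ae_notMem.1 h0
    filter_upwards [h1, hP.ae_collInf_eq_zero] with ω h2 h3
    exact h3.resolve_right h2
  refine ⟨cond P E, cond_isProbabilityMeasure hPE, ⟨?_, ?_⟩, ?_⟩
  · intro f hf
    simp only [ProbabilityTheory.cond, lintegral_smul_measure]
    refine mul_le_mul_right ?_ _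
    rw [← lintegral_indicator mE, ← lintegral_indicator mE]
    refine le_trans (lintegral_mono fun ω => ?_) (hP.step _ (hf.indicator mE))
    by_cases hω : ω ∈ E
    · rw [indicator_of_mem hω]
      refine Finset.sum_le_sum fun d _ => ?_
      by_cases hp : c.p d ω = 0
      · simp [hp]
      · refine mul_le_mul_right ?_ _
        have h1 : c.Z d ω ∈ E := by
          have h2 : c.collInf ω = 0 := hω
          rw [c.collInf_eq ω] at h2
          have h3 := Finset.sum_eq_zero_iff.1 h2 d (Finset.mem_univ d)
          exact (mul_eq_zero.1 h3).resolve_left (pow_ne_zero 2 hp)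
        rw [indicator_of_mem h1]
    · rw [indicator_of_notMem hω]; exact zero_le
  · intro f hf
    simp only [ProbabilityTheory.cond, lintegral_smul_measure]
    refine mul_le_mul_right ?_ _
    rw [← lintegral_indicator mE, ← lintegral_indicator mE]
    refine le_trans (lintegral_mono fun ω => ?_) (hP.symm _ (hf.indicator mE))
    have h1 : c.b ω ∈ E ↔ ω ∈ E := by
      simp only [hE, mem_setOf_eq, collInf, c.coll_b]
    by_cases hω : ω ∈ E
    · rw [indicator_of_mem hω, indicator_of_mem (h1.2 hω)]
    · rw [indicator_of_notMem hω]; exact zero_le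
  · intro η hη ε hε
    have := cond_isProbabilityMeasure hPE
    have hη2 : η ^ 2 ≠ 0 := pow_ne_zero 2 hη
    have h1 : Tendsto (fun n => P[|E] {ω | η ^ 2 ≤ c.coll n ω}) atTop (𝓝 0) := by
      have h2 := tendsto_measure_iInter_atTop (μ := P[|E]) (s := fun n => {ω | η ^ 2 ≤ c.coll n ω})
        (fun n => (measurableSet_le measurable_const (c.measurable_coll n)).nullMeasurableSet)
        (fun m n hmn ω hω => le_trans hω (c.coll_antitone ω hmn)) ⟨0, measure_ne_top _ _⟩
      have h3 : P[|E] (⋂ n, {ω | η ^ 2 ≤ c.coll n ω}) = 0 := by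
        refine measure_mono_null (t := Eᶜ) ?_ ?_
        · intro ω hω hωE
          rw [mem_iInter] at hω
          have h4 : η ^ 2 ≤ c.collInf ω := le_iInf hω
          rw [show c.collInf ω = 0 from hωE] at h4
          exact hη2 (le_antisymm h4 zero_le)
        · rw [cond_apply mE]; simp
      rwa [h3] at h2
    obtain ⟨n₀, hn₀⟩ := (h1.eventually (gt_mem_nhds (pos_iff_ne_zero.2 hε))).exists_forall_of_atTop
    refine ⟨n₀, fun n hn => lt_of_le_of_lt (measure_mono ?_) (hn₀ n hn)⟩
    rintro ω ⟨w, rfl, hw⟩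
    exact (pow_le_pow_left₀ zero_le hw.le 2).trans (c.wt_sq_le_coll ω w)

end WordChain


/-- A sequence of normalized positive functionals on a compact space has a probability measure as
an ultrafilter limit. -/
lemma exists_measure_of_means {Ω : Type*} [TopologicalSpace Ω] [T2Space Ω]
    [CompactSpace Ω] [MeasurableSpace Ω] [BorelSpace Ω] (Λ : ℕ → C(Ω, ℝ) →ₗ[ℝ] ℝ)
    (pos : ∀ j g, (∀ x, 0 ≤ g x) → 0 ≤ Λ j g) (one : ∀ j, Λ j 1 = 1) :
    ∃ P : Measure Ω, IsProbabilityMeasure P ∧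
      ∀ g : C(Ω, ℝ), Tendsto (fun j => Λ j g) (hyperfilter ℕ) (𝓝 (∫ x, g x ∂P)) := by
  have bdd : ∀ j g, Λ j g ∈ Icc (-‖g‖) ‖g‖ := by
    intro j g
    have h1 : ∀ r : ℝ, Λ j (r • (1 : C(Ω, ℝ))) = r := fun r => by rw [map_smul, one]; simp
    have h2 := pos j (‖g‖ • 1 - g) (fun x => by
      simpa using (le_abs_self _).trans (g.norm_coe_le_norm x))
    have h3 := pos j (‖g‖ • 1 + g) (fun x => by
      have := (neg_abs_le _).trans' (neg_le_neg (g.norm_coe_le_norm x))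
      simp only [ContinuousMap.add_apply, ContinuousMap.smul_apply, ContinuousMap.one_apply,
        smul_eq_mul, mul_one]
      linarith)
    rw [map_sub, h1] at h2
    rw [map_add, h1] at h3
    constructor <;> linarith
  have lim : ∀ g, ∃ l, Tendsto (fun j => Λ j g) (hyperfilter ℕ) (𝓝 l) := by
    intro g
    obtain ⟨l, -, hl⟩ := isCompact_Icc.ultrafilter_le_nhds ((hyperfilter ℕ).map (fun j => Λ j g))
      (le_principal_iff.2 (Ultrafilter.mem_map.2 (univ_mem' fun j => bdd j g)))
    exact ⟨l, hl⟩
  choose L hL using lim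
  let Φ : CompactlySupportedContinuousMap Ω ℝ →ₗ[ℝ] ℝ :=
    { toFun := fun g => L g.toContinuousMap
      map_add' := fun f g => tendsto_nhds_unique (hL _) <| by
        have := (hL f.toContinuousMap).add (hL g.toContinuousMap)
        simp only [← map_add] at this
        exact this
      map_smul' := fun r f => tendsto_nhds_unique (hL _) <| by
        have := (hL f.toContinuousMap).const_mul r
        simp only [← smul_eq_mul, ← map_smul] at this
        exact this }
  let Ψ : CompactlySupportedContinuousMap Ω ℝ →ₚ[ℝ] ℝ := PositiveLinearMap.mk₀ Φ fun f hf =>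
    ge_of_tendsto (hL _) (Eventually.of_forall fun j => pos j _ fun x => hf x)
  have h_integral : ∀ g : C(Ω, ℝ), ∫ x, g x ∂(RealRMK.rieszMeasure Ψ) = L g := fun g =>
    RealRMK.integral_rieszMeasure Ψ (CompactlySupportedContinuousMap.continuousMapEquiv g)
  refine ⟨RealRMK.rieszMeasure Ψ, ⟨?_⟩, fun g => by rw [h_integral]; exact hL g⟩
  have h1 := h_integral 1
  have h2 : L 1 = 1 := tendsto_nhds_unique (hL 1) (by simp only [one]; exact tendsto_const_nhds)
  rw [h2] at h1
  simp only [ContinuousMap.one_apply, integral_const, smul_eq_mul, mul_one] at h1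
  have h3 : (RealRMK.rieszMeasure Ψ).real univ = 1 := h1
  rw [Measure.real] at h3
  rw [← ENNReal.ofReal_toReal (a := RealRMK.rieszMeasure Ψ univ) (fun h => by simp [h] at h3), h3]
  simp


/-- Finitely many commuting-with-`b` continuous maps, together with a compact set. -/
structure TreeSystem (X D : Type) [TopologicalSpace X] where
  f : D → X → X
  b : X → X
  K : Set X
  cont_f : ∀ d, Continuous (f d)
  cont_b : Continuous b
  comm : ∀ d x, f d (b x) = b (f d x)
  compact : IsCompact K
  map_b : ∀ x ∈ K, b x ∈ K

namespace TreeSystem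

variable {X D : Type} [TopologicalSpace X] (s : TreeSystem X D)

/-- Apply the maps of a word successively. -/
def follow : X → List D → X
  | x, [] => x
  | x, d :: w => follow (s.f d x) w

lemma follow_b (x : X) (w : List D) : s.follow (s.b x) w = s.b (s.follow x w) := by
  induction w generalizing x with
  | nil => rfl
  | cons d w ih => simp [follow, s.comm, ih]

lemma continuous_follow (w : List D) : Continuous fun x => s.follow x w := by
  induction w with
  | nil => exact continuous_id
  | cons d w ih => exact ih.comp (s.cont_f d)

variable [Fintype D]

/-- A point with a probability measure on infinite words all of whose prefixes lead into `K`. -/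
structure IsState (z : X × (List D → ℝ)) : Prop where
  nonneg : ∀ w, 0 ≤ z.2 w
  nil : z.2 [] = 1
  sum : ∀ w, z.2 w = ∑ d, z.2 (w ++ [d])
  mem : ∀ w, z.2 w = 0 ∨ s.follow z.1 w ∈ s.K

/-- The space of states. -/
abbrev State : Type := {z : X × (List D → ℝ) // s.IsState z}

instance : MeasurableSpace s.State := borel _
instance : BorelSpace s.State := ⟨rfl⟩
instance [SecondCountableTopology X] : SecondCountableTopology s.State := by
  have : Countable (List D) := inferInstance
  have : SecondCountableTopology (X × (List D → ℝ)) := inferInstance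
  exact TopologicalSpace.Subtype.secondCountableTopology {z | s.IsState z}

variable {s}

lemma IsState.sum_single {z : X × (List D → ℝ)} (h : s.IsState z) : ∑ d, z.2 [d] = 1 := by
  have := h.sum []
  rw [h.nil] at this
  simpa using this.symm

lemma IsState.le_one {z : X × (List D → ℝ)} (h : s.IsState z) (w : List D) : z.2 w ≤ 1 := by
  induction w using List.reverseRecOn with
  | nil => exact h.nil.le
  | append_singleton w d ih =>
    refine le_trans ?_ ih
    rw [h.sum w]
    exact Finset.single_le_sum (f := fun d => z.2 (w ++ [d])) (fun _ _ => h.nonneg _)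
      (Finset.mem_univ d)

lemma isClosed_isState [T2Space X] : IsClosed {z : X × (List D → ℝ) | s.IsState z} := by
  have h1 : {z : X × (List D → ℝ) | s.IsState z} =
      (⋂ w, {z | 0 ≤ z.2 w}) ∩ {z | z.2 [] = 1} ∩ (⋂ w, {z | z.2 w = ∑ d, z.2 (w ++ [d])}) ∩
      ⋂ w, ({z | z.2 w = 0} ∪ {z | s.follow z.1 w ∈ s.K}) := by
    ext z
    simp only [mem_inter_iff, mem_iInter, mem_union, mem_ofPred_eq]
    exact ⟨fun h => ⟨⟨⟨h.1, h.2⟩, h.3⟩, h.4⟩, fun h => ⟨h.1.1.1, h.1.1.2, h.1.2, h.2⟩⟩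
  rw [h1]
  have c : ∀ w : List D, Continuous fun z : X × (List D → ℝ) => z.2 w :=
    fun w => (continuous_apply w).comp continuous_snd
  refine ((IsClosed.inter (isClosed_iInter fun w => ?_) ?_).inter (isClosed_iInter fun w => ?_)).inter
    (isClosed_iInter fun w => IsClosed.union ?_ ?_)
  · exact isClosed_le continuous_const (c w)
  · exact isClosed_eq (c []) continuous_const
  · exact isClosed_eq (c w) (continuous_finsetSum _ fun d _ => c _)
  · exact isClosed_eq (c w) continuous_const
  · exact s.compact.isClosed.preimage ((s.continuous_follow w).comp continuous_fst)

instance [T2Space X] : CompactSpace s.State := by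
  refine isCompact_iff_compactSpace.1 ?_
  refine (s.compact.prod (isCompact_univ_pi fun _ : List D =>
    isCompact_Icc (a := (0 : ℝ)) (b := 1))).of_isClosed_subset isClosed_isState ?_
  intro z hz
  have hz : s.IsState z := hz
  refine ⟨?_, fun w _ => ⟨hz.nonneg w, hz.le_one w⟩⟩
  have := hz.mem []
  rw [hz.nil] at this
  exact this.resolve_left one_ne_zero

lemma continuous_weight (w : List D) : Continuous fun ω : s.State => ω.1.2 w :=
  (continuous_apply w).comp (continuous_snd.comp continuous_subtype_val)

lemma continuous_point : Continuous fun ω : s.State => ω.1.1 :=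
  continuous_fst.comp continuous_subtype_val

lemma isState_step {z : X × (List D → ℝ)} (h : s.IsState z) {d : D} (hd : z.2 [d] ≠ 0) :
    s.IsState (s.f d z.1, fun w => z.2 (d :: w) / z.2 [d]) where
  nonneg w := div_nonneg (h.nonneg _) (h.nonneg _)
  nil := div_self hd
  sum w := by
    dsimp only
    rw [← Finset.sum_div, h.sum (d :: w)]
    rfl
  mem w := by
    rcases h.mem (d :: w) with h1 | h1
    · left; simp [h1]
    · exact Or.inr h1

open Classical in
/-- Conditioning on the first letter. -/
noncomputable def step (d : D) (ω : s.State) : s.State :=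
  if h : ω.1.2 [d] ≠ 0 then ⟨_, isState_step ω.2 h⟩ else ω

lemma step_val {d : D} {ω : s.State} (h : ω.1.2 [d] ≠ 0) :
    (step d ω).1 = (s.f d ω.1.1, fun w => ω.1.2 (d :: w) / ω.1.2 [d]) := by
  simp [step, h]

lemma step_of_eq_zero {d : D} {ω : s.State} (h : ω.1.2 [d] = 0) : step d ω = ω := by
  simp [step, h]

lemma isState_symm {z : X × (List D → ℝ)} (h : s.IsState z) : s.IsState (s.b z.1, z.2) where
  nonneg := h.nonneg
  nil := h.nil
  sum := h.sum
  mem w := by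
    rcases h.mem w with h1 | h1
    · exact Or.inl h1
    · right; rw [s.follow_b]; exact s.map_b _ h1

/-- The symmetry `b` on states. -/
def symm (ω : s.State) : s.State := ⟨(s.b ω.1.1, ω.1.2), isState_symm ω.2⟩

lemma continuous_symm : Continuous (symm (s := s)) :=
  Continuous.subtype_mk ((s.cont_b.comp continuous_point).prodMk
    (continuous_snd.comp continuous_subtype_val)) _

lemma step_symm (d : D) (ω : s.State) : step d (symm ω) = symm (step d ω) := by
  by_cases h : ω.1.2 [d] = 0
  · rw [step_of_eq_zero h, step_of_eq_zero (ω := symm ω) h]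
  · apply Subtype.ext
    have h1 := step_val h
    have h2 : (symm (step d ω)).1 = (s.b (step d ω).1.1, (step d ω).1.2) := rfl
    rw [step_val (ω := symm ω) h, h2, h1]
    simp [symm, s.comm]

lemma continuousAt_step {d : D} {ω : s.State} (h : ω.1.2 [d] ≠ 0) : ContinuousAt (step d) ω := by
  refine (Topology.IsInducing.mk rfl : IsInducing
    (Subtype.val : s.State → X × (List D → ℝ))).continuousAt_iff.2 ?_
  have h1 : ContinuousAt (fun ω : s.State =>
      (s.f d ω.1.1, fun w : List D => ω.1.2 (d :: w) / ω.1.2 [d])) ω := by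
    refine ((s.cont_f d).comp continuous_point).continuousAt.prodMk ?_
    exact continuousAt_pi.2 fun w =>
      (continuous_weight (d :: w)).continuousAt.div (continuous_weight [d]).continuousAt h
  refine h1.congr ?_
  filter_upwards [(continuous_weight (s := s) [d]).continuousAt.eventually_ne h] with ω' h'
  exact (step_val h').symm

lemma measurable_step (d : D) : Measurable (step (s := s) d) := by
  classical
  have ho : IsOpen {ω : s.State | ω.1.2 [d] ≠ 0} :=
    isOpen_ne_fun (continuous_weight [d]) continuous_const
  have h1 := ContinuousOn.measurable_piecewise (s := {ω : s.State | ω.1.2 [d] ≠ 0})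
    (f := step d) (g := id) (fun ω hω => (continuousAt_step hω).continuousWithinAt)
    continuous_id.continuousOn ho.measurableSet
  convert h1 using 1
  ext1 ω
  by_cases h : ω.1.2 [d] = 0
  · rw [piecewise_eq_of_notMem _ _ _ (by simpa using h), step_of_eq_zero h]; rfl
  · rw [piecewise_eq_of_mem _ _ _ (by simpa using h)]

variable (s) in
/-- The chain of states of a tree system. -/
noncomputable def chain : WordChain s.State D where
  p d ω := ENNReal.ofReal (ω.1.2 [d])
  Z := step
  b := symm
  sum_p ω := by
    rw [← ENNReal.ofReal_sum_of_nonneg fun d _ => ω.2.nonneg _, ω.2.sum_single]; simp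
  meas_p d := (continuous_weight [d]).measurable.ennreal_ofReal
  meas_Z := measurable_step
  meas_b := continuous_symm.measurable
  p_b _ _ := rfl
  Z_b := step_symm

/-- The transition operator on continuous functions. -/
noncomputable def transfer [T2Space X] (g : C(s.State, ℝ)) : C(s.State, ℝ) where
  toFun ω := ∑ d, ω.1.2 [d] * g (step d ω)
  continuous_toFun := by
    refine continuous_finsetSum _ fun d _ => continuous_iff_continuousAt.2 fun ω => ?_
    by_cases h : ω.1.2 [d] = 0
    · rw [ContinuousAt, h, zero_mul]
      refine squeeze_zero_norm (a := fun ω : s.State => ω.1.2 [d] * ‖g‖) (fun ω' => ?_) ?_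
      · rw [norm_mul, Real.norm_of_nonneg (ω'.2.nonneg _)]
        gcongr
        · exact ω'.2.nonneg _
        · exact g.norm_coe_le_norm _
      · have := ((continuous_weight (s := s) [d]).mul (continuous_const (y := ‖g‖))).tendsto ω
        simpa [h, Pi.mul_def] using this
    · exact (continuous_weight [d]).continuousAt.mul
        (g.continuous.continuousAt.comp (continuousAt_step h))

end TreeSystem


namespace TreeSystem

variable {X D : Type} [TopologicalSpace X] {s : TreeSystem X D}

/-- The prefix of length `t` of an infinite word. -/
def pre (ξ : ℕ → D) (t : ℕ) : List D := (List.range t).map ξ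

lemma pre_length (ξ : ℕ → D) (t : ℕ) : (pre ξ t).length = t := by simp [pre]

lemma pre_succ (ξ : ℕ → D) (t : ℕ) : pre ξ (t + 1) = pre ξ t ++ [ξ t] := by
  simp [pre, List.range_succ]

variable [Fintype D]

open Classical in
lemma isState_uniform {x : X} {Ξ : Finset (ℕ → D)} (hΞ : Ξ.Nonempty)
    (hK : ∀ ξ ∈ Ξ, ∀ t, s.follow x (pre ξ t) ∈ s.K) :
    s.IsState (x, fun w => ((Ξ.filter fun ξ => pre ξ w.length = w).card : ℝ) / Ξ.card) where
  nonneg w := by positivity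
  nil := by
    have : (Ξ.card : ℝ) ≠ 0 := by exact_mod_cast hΞ.card_pos.ne'
    simp [pre, this]
  sum w := by
    dsimp only
    rw [← Finset.sum_div, ← Nat.cast_sum]
    congr 2
    rw [Finset.card_eq_sum_card_fiberwise (t := Finset.univ) (f := fun ξ => ξ w.length)
      (fun _ _ => Finset.mem_coe.2 (Finset.mem_univ _))]
    refine Finset.sum_congr rfl fun d _ => ?_
    rw [Finset.filter_filter]
    congr 1
    ext ξ
    simp only [Finset.mem_filter, List.length_append, List.length_cons, List.length_nil, zero_add,
      pre_succ]
    refine and_congr_right fun _ => ⟨fun h => by rw [h.1, h.2], fun h => ?_⟩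
    simpa using List.append_inj h (pre_length ξ w.length)
  mem w := by
    by_cases h : (Ξ.filter fun ξ => pre ξ w.length = w) = ∅
    · left; simp [h]
    · right
      obtain ⟨ξ, hξ⟩ := Finset.nonempty_iff_ne_empty.2 h
      rw [Finset.mem_filter] at hξ
      have := hK ξ hξ.1 w.length
      rwa [hξ.2] at this

variable [T2Space X]

/-- The entropy of the first letter. -/
noncomputable def entropy : C(s.State, ℝ) where
  toFun ω := ∑ d, Real.negMulLog (ω.1.2 [d])
  continuous_toFun := continuous_finsetSum _ fun _ _ =>
    Real.continuous_negMulLog.comp (continuous_weight _)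

lemma transfer_apply (g : C(s.State, ℝ)) (ω : s.State) :
    transfer g ω = ∑ d, ω.1.2 [d] * g (step d ω) := rfl

lemma neg_log_le_sum_entropy (n : ℕ) (ω : s.State) {M : ℝ} (hM : 0 < M)
    (h : ∀ w : List D, w.length = n → ω.1.2 w ≤ M) :
    -Real.log M ≤ ∑ t ∈ Finset.range n, (transfer^[t] entropy) ω := by
  induction n generalizing ω M with
  | zero =>
    have := h [] rfl
    rw [ω.2.nil] at this
    simpa using Real.log_nonneg this
  | succ n ih =>
    rw [Finset.sum_range_succ']
    simp only [Function.iterate_succ_apply', transfer_apply, Function.iterate_zero, id]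
    rw [Finset.sum_comm]
    have key : ∀ d, -ω.1.2 [d] * Real.log M ≤
        ∑ t ∈ Finset.range n, ω.1.2 [d] * (transfer^[t] entropy) (step d ω) +
          Real.negMulLog (ω.1.2 [d]) := by
      intro d
      rw [← Finset.mul_sum]
      rcases (ω.2.nonneg [d]).eq_or_lt with h0 | h0
      · rw [← h0]; simp
      · have h1 := ih (step d ω) (M := M / ω.1.2 [d]) (by positivity) (fun w hw => by
          rw [step_val h0.ne']
          dsimp only
          gcongr
          exact h (d :: w) (by simp [hw]))
        rw [Real.log_div hM.ne' h0.ne'] at h1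
        have h2 := mul_le_mul_of_nonneg_left h1 h0.le
        rw [Real.negMulLog]
        linarith
    have h3 := Finset.sum_le_sum fun d (_ : d ∈ Finset.univ) => key d
    rw [Finset.sum_add_distrib, ← Finset.sum_mul, Finset.sum_neg_distrib, ω.2.sum_single] at h3
    simpa [entropy] using h3

lemma abs_transfer_le (g : C(s.State, ℝ)) (t : ℕ) (ω : s.State) :
    |(transfer^[t] g) ω| ≤ ‖g‖ := by
  induction t generalizing ω with
  | zero => exact g.norm_coe_le_norm ω
  | succ t ih =>
    rw [Function.iterate_succ_apply', transfer_apply]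
    calc _ ≤ ∑ d, |ω.1.2 [d] * (transfer^[t] g) (step d ω)| := Finset.abs_sum_le_sum_abs _ _
      _ ≤ ∑ d, ω.1.2 [d] * ‖g‖ := Finset.sum_le_sum fun d _ => by
        rw [abs_mul, abs_of_nonneg (ω.2.nonneg _)]
        exact mul_le_mul_of_nonneg_left (ih _) (ω.2.nonneg _)
      _ = ‖g‖ := by rw [← Finset.sum_mul, ω.2.sum_single, one_mul]

lemma transfer_nonneg {g : C(s.State, ℝ)} (hg : ∀ ω, 0 ≤ g ω) (t : ℕ) (ω : s.State) :
    0 ≤ (transfer^[t] g) ω := by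
  induction t generalizing ω with
  | zero => exact hg ω
  | succ t ih =>
    rw [Function.iterate_succ_apply', transfer_apply]
    exact Finset.sum_nonneg fun d _ => mul_nonneg (ω.2.nonneg _) (ih _)

lemma transfer_add (g h : C(s.State, ℝ)) (t : ℕ) (ω : s.State) :
    (transfer^[t] (g + h)) ω = (transfer^[t] g) ω + (transfer^[t] h) ω := by
  induction t generalizing ω with
  | zero => rfl
  | succ t ih =>
    simp only [Function.iterate_succ_apply', transfer_apply, ih, mul_add, Finset.sum_add_distrib]

lemma transfer_smul (r : ℝ) (g : C(s.State, ℝ)) (t : ℕ) (ω : s.State) :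
    (transfer^[t] (r • g)) ω = r * (transfer^[t] g) ω := by
  induction t generalizing ω with
  | zero => rfl
  | succ t ih =>
    simp only [Function.iterate_succ_apply', transfer_apply, ih, Finset.mul_sum]
    exact Finset.sum_congr rfl fun d _ => by ring

lemma transfer_one (t : ℕ) (ω : s.State) : (transfer^[t] (1 : C(s.State, ℝ))) ω = 1 := by
  induction t generalizing ω with
  | zero => rfl
  | succ t ih =>
    simp only [Function.iterate_succ_apply', transfer_apply, ih, mul_one, ω.2.sum_single]

lemma transfer_symm (g : C(s.State, ℝ)) (t : ℕ) (ω : s.State) :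
    (transfer^[t] (g.comp ⟨symm, continuous_symm⟩)) ω = (transfer^[t] g) (symm ω) := by
  induction t generalizing ω with
  | zero => rfl
  | succ t ih =>
    simp only [Function.iterate_succ_apply', transfer_apply, ih, step_symm]
    rfl

/-- The average of the first `n` transfers over the first `n` translates. -/
noncomputable def mean (n : ℕ) (ω : s.State) : C(s.State, ℝ) →ₗ[ℝ] ℝ where
  toFun g := ((n : ℝ) ^ 2)⁻¹ *
    ∑ k ∈ Finset.range n, ∑ t ∈ Finset.range n, (transfer^[t] g) (symm^[k] ω)
  map_add' g h := by simp only [transfer_add, Finset.sum_add_distrib, mul_add]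
  map_smul' r g := by
    simp only [transfer_smul, ← Finset.mul_sum, RingHom.id_apply, smul_eq_mul]; ring

lemma mean_apply (n : ℕ) (ω : s.State) (g : C(s.State, ℝ)) : mean n ω g = ((n : ℝ) ^ 2)⁻¹ *
    ∑ k ∈ Finset.range n, ∑ t ∈ Finset.range n, (transfer^[t] g) (symm^[k] ω) := rfl

lemma abs_mean_transfer_sub_le {n : ℕ} (hn : 1 ≤ n) (ω : s.State) (g : C(s.State, ℝ)) :
    |mean n ω (transfer g) - mean n ω g| ≤ 2 * ‖g‖ / n := by
  have h0 : (0 : ℝ) < n := by exact_mod_cast hn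
  rw [mean_apply, mean_apply, ← mul_sub, ← Finset.sum_sub_distrib]
  have h1 : ∀ k, |∑ t ∈ Finset.range n, (transfer^[t] (transfer g)) (symm^[k] ω) -
      ∑ t ∈ Finset.range n, (transfer^[t] g) (symm^[k] ω)| ≤ 2 * ‖g‖ := by
    intro k
    simp only [← Function.iterate_succ_apply]
    rw [← Finset.sum_sub_distrib,
      Finset.sum_range_sub (fun t => (transfer^[t] g) (symm^[k] ω))]
    have h2 := abs_transfer_le g n (symm^[k] ω)
    have h3 := abs_transfer_le g 0 (symm^[k] ω)
    refine (abs_sub _ _).trans ?_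
    linarith
  calc _ ≤ ((n : ℝ) ^ 2)⁻¹ * ∑ k ∈ Finset.range n, 2 * ‖g‖ := by
        rw [abs_mul, abs_of_pos (by positivity)]
        gcongr
        exact (Finset.abs_sum_le_sum_abs _ _).trans (Finset.sum_le_sum fun k _ => h1 k)
    _ = _ := by simp; field_simp

lemma abs_mean_symm_sub_le {n : ℕ} (hn : 1 ≤ n) (ω : s.State) (g : C(s.State, ℝ)) :
    |mean n ω (g.comp ⟨symm, continuous_symm⟩) - mean n ω g| ≤ 2 * ‖g‖ / n := by
  have h0 : (0 : ℝ) < n := by exact_mod_cast hn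
  rw [mean_apply, mean_apply, ← mul_sub]
  simp only [transfer_symm]
  rw [Finset.sum_comm, Finset.sum_comm (s := Finset.range n) (t := Finset.range n)
    (f := fun k t => (transfer^[t] g) (symm^[k] ω)), ← Finset.sum_sub_distrib]
  have h1 : ∀ t, |∑ k ∈ Finset.range n, (transfer^[t] g) (symm (symm^[k] ω)) -
      ∑ k ∈ Finset.range n, (transfer^[t] g) (symm^[k] ω)| ≤ 2 * ‖g‖ := by
    intro t
    simp only [← Function.iterate_succ_apply']
    rw [← Finset.sum_sub_distrib,
      Finset.sum_range_sub (fun k => (transfer^[t] g) (symm^[k] ω))]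
    have h2 := abs_transfer_le g t (symm^[n] ω)
    have h3 := abs_transfer_le g t (symm^[0] ω)
    refine (abs_sub _ _).trans ?_
    linarith
  calc _ ≤ ((n : ℝ) ^ 2)⁻¹ * ∑ t ∈ Finset.range n, 2 * ‖g‖ := by
        rw [abs_mul, abs_of_pos (by positivity)]
        gcongr
        exact (Finset.abs_sum_le_sum_abs _ _).trans (Finset.sum_le_sum fun k _ => h1 k)
    _ = _ := by simp; field_simp

/-- Exponentially many words staying in `K` yield a substationary nonatomic measure. -/
theorem exists_substationary [SecondCountableTopology X] {δ : ℝ} (hδ : 0 < δ)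
    (rich : ∀ N : ℕ, ∃ n ≥ N, ∃ x, ∃ Ξ : Finset (ℕ → D), Real.exp (δ * n) ≤ Ξ.card ∧
      (∀ ξ ∈ Ξ, ∀ t, s.follow x (pre ξ t) ∈ s.K) ∧ InjOn (fun ξ => pre ξ n) (Ξ : Set (ℕ → D))) :
    ∃ P : Measure s.State, IsProbabilityMeasure P ∧ s.chain.Substationary P ∧
      ∀ η : ℝ≥0∞, η ≠ 0 → ∀ ε : ℝ≥0∞, ε ≠ 0 → ∃ n₀, ∀ n ≥ n₀,
        P {ω | ∃ w : List D, w.length = n ∧ η < s.chain.wt ω w} < ε := by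
  classical
  have init : ∀ j : ℕ, ∃ n ≥ j + 1, ∃ ω : s.State, δ ≤ mean n ω entropy := by
    intro j
    obtain ⟨n, hn, x, Ξ, hcard, hK, hinj⟩ := rich (j + 1)
    have hpos : (0 : ℝ) < Ξ.card := (Real.exp_pos _).trans_le hcard
    have hne : Ξ.Nonempty := Finset.card_pos.1 (by exact_mod_cast hpos)
    have hn0 : (0 : ℝ) < n := by exact_mod_cast (by omega : 0 < n)
    let ω : s.State := ⟨_, isState_uniform hne hK⟩
    have hb : ∀ k, (symm^[k] ω).1.2 = ω.1.2 := by
      intro k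
      induction k with
      | zero => rfl
      | succ k ih => rw [Function.iterate_succ_apply']; exact ih
    refine ⟨n, hn, ω, ?_⟩
    have key : ∀ k, δ * n ≤ ∑ t ∈ Finset.range n, (transfer^[t] entropy) (symm^[k] ω) := by
      intro k
      refine le_trans ?_ (neg_log_le_sum_entropy n (symm^[k] ω) (M := (Ξ.card : ℝ)⁻¹)
        (by positivity) ?_)
      · rw [Real.log_inv, neg_neg]
        exact (Real.le_log_iff_exp_le hpos).2 hcard
      · rintro w rfl
        rw [hb, ← one_div]
        change ((Ξ.filter fun ξ => pre ξ w.length = w).card : ℝ) / Ξ.card ≤ _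
        gcongr
        norm_cast
        refine Finset.card_le_one.2 fun ξ h1 ξ' h2 => ?_
        rw [Finset.mem_filter] at h1 h2
        exact hinj h1.1 h2.1 (h1.2.trans h2.2.symm)
    have h1 := Finset.sum_le_sum fun k (_ : k ∈ Finset.range n) => key k
    rw [Finset.sum_const, Finset.card_range, nsmul_eq_mul] at h1
    rw [mean_apply, le_inv_mul_iff₀ (by positivity)]
    linarith
  choose n hn ω hω using init
  obtain ⟨P, hP, hlim⟩ := exists_measure_of_means (fun j => mean (n j) (ω j))
    (fun j g hg => by
      rw [mean_apply]
      exact mul_nonneg (by positivity) (Finset.sum_nonneg fun k _ =>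
        Finset.sum_nonneg fun t _ => transfer_nonneg hg t _))
    (fun j => by
      have : (n j : ℝ) ≠ 0 := by exact_mod_cast (by have := hn j; omega : n j ≠ 0)
      simp only [mean_apply, transfer_one, Finset.sum_const, Finset.card_range, nsmul_eq_mul,
        mul_one]
      field_simp)
  have hzero : ∀ g : C(s.State, ℝ), Tendsto (fun j => 2 * ‖g‖ / (n j : ℝ)) (hyperfilter ℕ)
      (𝓝 0) := by
    intro g
    refine Tendsto.mono_left ?_ Nat.hyperfilter_le_atTop
    refine Tendsto.const_div_atTop ?_ _
    refine tendsto_natCast_atTop_atTop.comp (tendsto_atTop_mono (fun j => ?_) tendsto_id)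
    have := hn j
    simp only [id]; omega
  have stat : ∀ g h : C(s.State, ℝ), (∀ j, |mean (n j) (ω j) h - mean (n j) (ω j) g| ≤
      2 * ‖g‖ / n j) → ∫ x, h x ∂P = ∫ x, g x ∂P := by
    intro g h hgh
    refine sub_eq_zero.1 (tendsto_nhds_unique ((hlim h).sub (hlim g)) ?_)
    exact squeeze_zero_norm hgh (hzero g)
  have stat1 : ∀ g : C(s.State, ℝ), ∫ x, transfer g x ∂P = ∫ x, g x ∂P := fun g =>
    stat g _ fun j => abs_mean_transfer_sub_le (by have := hn j; omega) _ g
  have stat2 : ∀ g : C(s.State, ℝ), ∫ x, g (symm x) ∂P = ∫ x, g x ∂P := fun g =>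
    stat g (g.comp ⟨symm, continuous_symm⟩)
      fun j => abs_mean_symm_sub_le (by have := hn j; omega) _ g
  have h_integral : ∀ g : C(s.State, ℝ), Integrable g P := fun g =>
    (BoundedContinuousFunction.mkOfCompact g).integrable P
  have : TopologicalSpace.MetrizableSpace s.State :=
    TopologicalSpace.metrizableSpace_of_t3_secondCountable _
  let P₁ : Measure s.State :=
    ∑ d, (P.withDensity (s.chain.p d)).map (s.chain.Z d)
  have hlint : ∀ f : s.State → ℝ≥0∞, Measurable f →
      ∫⁻ ω, f ω ∂P₁ = ∫⁻ ω, ∑ d, s.chain.p d ω * f (s.chain.Z d ω) ∂P := by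
    intro f hf
    have hm : ∀ d, Measurable fun ω => s.chain.p d ω * f (s.chain.Z d ω) :=
      fun d => (s.chain.meas_p d).mul (hf.comp (s.chain.meas_Z d))
    rw [lintegral_finsetSum_measure, lintegral_finsetSum _ fun d _ => hm d]
    refine Finset.sum_congr rfl fun d _ => ?_
    rw [lintegral_map hf (s.chain.meas_Z d)]
    exact lintegral_withDensity_eq_lintegral_mul _
      (s.chain.meas_p d) (hf.comp (s.chain.meas_Z d))
  have hfin : IsFiniteMeasure P₁ := ⟨by
    have := hlint 1 measurable_one
    simp only [Pi.one_apply, lintegral_one, mul_one, s.chain.sum_p] at this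
    rw [this]; exact measure_lt_top P univ⟩
  have hP₁ : P₁ = P := by
    refine ext_of_forall_integral_eq_of_IsFiniteMeasure fun g => ?_
    have h1 := stat1 g.toContinuousMap
    have hc : Continuous g := g.continuous
    rw [show ∫ x, g x ∂P = ∫ x, g.toContinuousMap x ∂P from rfl, ← h1]
    have hi : ∀ d, Integrable (fun ω => g (s.chain.Z d ω)) (P.withDensity (s.chain.p d)) := by
      intro d
      have : IsFiniteMeasure (P.withDensity (s.chain.p d)) := by
        refine isFiniteMeasure_withDensity ((lintegral_mono (g := fun _ => 1)
          fun ω => s.chain.p_le_one d ω).trans_lt ?_).ne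
        simp
      exact Integrable.of_bound ((hc.measurable.comp (s.chain.meas_Z d)).aestronglyMeasurable)
        ‖g‖ (Eventually.of_forall fun ω => g.norm_coe_le_norm _)
    rw [integral_finsetSum_measure fun d _ =>
      (integrable_map_measure hc.aestronglyMeasurable (s.chain.meas_Z d).aemeasurable).2 (hi d)]
    simp only [transfer_apply]
    rw [integral_finsetSum]
    · refine Finset.sum_congr rfl fun d _ => ?_
      rw [integral_map (s.chain.meas_Z d).aemeasurable hc.aestronglyMeasurable]
      rw [integral_withDensity_eq_integral_toReal_smul (s.chain.meas_p d)
        (Eventually.of_forall fun ω => ENNReal.ofReal_lt_top)]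
      refine integral_congr_ae (Eventually.of_forall fun ω => ?_)
      simp only [chain, ENNReal.toReal_ofReal (ω.2.nonneg _), smul_eq_mul]
      rfl
    · intro d _
      refine Integrable.of_bound (C := ‖g‖) ?_ (Eventually.of_forall fun ω => ?_)
      · exact ((continuous_weight [d]).measurable.mul
          (hc.measurable.comp (s.chain.meas_Z d))).aestronglyMeasurable
      · rw [norm_mul, Real.norm_of_nonneg (ω.2.nonneg _)]
        exact (mul_le_mul (ω.2.le_one _) (g.norm_coe_le_norm _) (norm_nonneg _)
          zero_le_one).trans_eq (one_mul _)
  have hP₂ : P.map symm = P := by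
    have : IsFiniteMeasure (P.map symm) :=
      Measure.isFiniteMeasure_map P symm
    refine ext_of_forall_integral_eq_of_IsFiniteMeasure fun g => ?_
    rw [integral_map continuous_symm.measurable.aemeasurable
      g.continuous.aestronglyMeasurable]
    exact stat2 g.toContinuousMap
  have hsub : s.chain.Substationary P :=
    ⟨fun f hf => by rw [← hlint f hf, hP₁], fun f hf => by
      have := lintegral_map (μ := P) hf (continuous_symm (s := s)).measurable
      rw [hP₂] at this
      exact this.ge⟩
  refine hsub.exists_nonconcentrated fun htriv => ?_
  have h1 : δ ≤ ∫ x, entropy x ∂P :=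
    ge_of_tendsto (hlim entropy) (Eventually.of_forall hω)
  have h2 : ∫ x, entropy x ∂P = 0 := by
    refine integral_eq_zero_of_ae ?_
    filter_upwards [htriv] with ω hω
    refine Finset.sum_eq_zero fun d _ => ?_
    rcases hω d with h3 | h3
    · have : ω.1.2 [d] = 0 := le_antisymm (ENNReal.ofReal_eq_zero.1 h3) (ω.2.nonneg _)
      simp [this]
    · have : ω.1.2 [d] = 1 := ENNReal.ofReal_eq_one.1 h3
      simp [this]
  linarith

end TreeSystem


section Transfer

variable {G X k : Type*} [Group G] [TopologicalSpace G] [IsTopologicalGroup G]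
  [TopologicalSpace X] [MulAction G X] [ContinuousSMul G X]
  [MeasurableSpace X] [BorelSpace X]

/-- Outside a set of small measure, visits to `Y` along `J` of a slightly perturbed point force
visits of the point itself. -/
lemma exists_transfer_of_isCompact [FirstCountableTopology G] [TopologicalSpace k]
    (orb : ∀ x : X, ∀ N ∈ 𝓝 (1 : G), (fun g : G => g • x) '' N ∈ 𝓝 x)
    {u : k → G} (hu : Continuous u) {Y : Set X} (hY : IsClosed Y) {J : Set k} (hJ : IsCompact J)
    (μ : Measure X) [IsFiniteMeasure μ] {ε : ℝ≥0∞} (hε : ε ≠ 0) :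
    ∃ V : Set X, MeasurableSet V ∧ μ V < ε ∧ ∃ N ∈ 𝓝 (1 : G), ∀ y, y ∉ V → ∀ g ∈ N,
      (∃ s ∈ J, u s • g • y ∈ Y) → ∃ s ∈ J, u s • y ∈ Y := by
  obtain ⟨N, hN⟩ := (𝓝 (1 : G)).exists_antitone_basis
  set A : Set X := {y | ∃ s ∈ J, u s • y ∈ Y} with hA
  let B : ℕ → Set X := fun n => {y | ∃ g ∈ interior (N n), ∃ s ∈ J, u s • g • y ∈ Y}
  have hAc : IsClosed A := by
    rw [← isOpen_compl_iff, isOpen_iff_mem_nhds]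
    intro y hy
    have h1 : ∀ᶠ z in 𝓝 y, ∀ s ∈ J, u s • z ∉ Y := by
      refine hJ.eventually_forall_of_forall_eventually fun s hs => ?_
      have hc : Continuous fun z : X × k => u z.2 • z.1 := by fun_prop
      exact hc.continuousAt.eventually_mem
        (hY.isOpen_compl.mem_nhds fun h => hy ⟨s, hs, h⟩)
    filter_upwards [h1] with z hz
    rintro ⟨s, hs, h⟩
    exact hz s hs h
  have hBo : ∀ n, IsOpen (B n) := by
    intro n
    rw [isOpen_iff_mem_nhds]
    rintro y ⟨g, hg, s, hs, h⟩
    have h1 : (fun x : G => g * x⁻¹) ⁻¹' interior (N n) ∈ 𝓝 (1 : G) :=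
      (by fun_prop : Continuous fun x : G => g * x⁻¹).continuousAt.preimage_mem_nhds
        (by simpa using isOpen_interior.mem_nhds hg)
    filter_upwards [orb y _ h1]
    rintro _ ⟨x, hx, rfl⟩
    exact ⟨g * x⁻¹, hx, s, hs, by simpa [mul_smul] using h⟩
  have hmeas : ∀ n, MeasurableSet (B n \ A) := fun n => (hBo n).measurableSet.diff hAc.measurableSet
  have hanti : Antitone fun n => B n \ A := by
    intro i j hij y ⟨⟨g, hg, hy⟩, hyA⟩
    exact ⟨⟨g, interior_mono (hN.antitone hij) hg, hy⟩, hyA⟩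
  have hempty : ⋂ n, (B n \ A) = ∅ := by
    refine eq_empty_of_forall_notMem fun y hy => ?_
    have hyA : y ∉ A := (mem_iInter.1 hy 0).2
    have h1 : ∀ᶠ g in 𝓝 (1 : G), ∀ s ∈ J, u s • g • y ∉ Y := by
      refine hJ.eventually_forall_of_forall_eventually fun s hs => ?_
      have hc : Continuous fun z : G × k => u z.2 • z.1 • y := by fun_prop
      refine hc.continuousAt.eventually_mem (hY.isOpen_compl.mem_nhds fun h => hyA ⟨s, hs, ?_⟩)
      simpa using h
    obtain ⟨n, -, hn⟩ := hN.1.mem_iff.1 h1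
    obtain ⟨g, hg, s, hs, h⟩ := (mem_iInter.1 hy n).1
    exact hn (interior_subset hg) s hs h
  have hlim := tendsto_measure_iInter_atTop (μ := μ)
    (fun n => (hmeas n).nullMeasurableSet) hanti ⟨0, measure_ne_top _ _⟩
  rw [hempty, measure_empty] at hlim
  obtain ⟨n, hn⟩ := (hlim.eventually_lt_const (pos_iff_ne_zero.2 hε)).exists
  refine ⟨_, hmeas n, hn, interior (N n), interior_mem_nhds.2 (hN.1.mem_of_mem trivial), ?_⟩
  intro y hy g hg hs
  by_contra hcon
  exact hy ⟨⟨g, hg, hs⟩, hcon⟩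

/-- Outside a set of small measure, visits of a slightly perturbed point to `Y` at bounded times
are close to visits of the point itself. -/
lemma exists_transfer [FirstCountableTopology G] [NormedField k] [ProperSpace k]
    (orb : ∀ x : X, ∀ N ∈ 𝓝 (1 : G), (fun g : G => g • x) '' N ∈ 𝓝 x)
    {u : k → G} (hu : Continuous u) {Y : Set X} (hY : IsClosed Y) (R : ℝ) {ρ : ℝ} (hρ : 0 < ρ)
    (μ : Measure X) [IsFiniteMeasure μ] {ε : ℝ≥0∞} (hε : ε ≠ 0) :
    ∃ V : Set X, MeasurableSet V ∧ μ V < ε ∧ ∃ N ∈ 𝓝 (1 : G), ∀ y, y ∉ V → ∀ g ∈ N, ∀ s : k,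
      ‖s‖ ≤ R → u s • g • y ∈ Y → ∃ s', ‖s' - s‖ ≤ ρ ∧ u s' • y ∈ Y := by
  obtain ⟨T, -, hTf, hT⟩ := (isCompact_closedBall (0 : k) R).finite_cover_balls (half_pos hρ)
  have hpos : ε / (hTf.toFinset.card + 1) ≠ 0 := by
    rw [ne_eq, ENNReal.div_eq_zero_iff]; push Not
    exact ⟨hε, by finiteness⟩
  choose V hV hVμ N hN hVN using fun c : k => exists_transfer_of_isCompact orb hu hY
    (isCompact_closedBall c (ρ / 2)) μ hpos
  refine ⟨⋃ c ∈ hTf.toFinset, V c, Finset.measurableSet_biUnion _ fun c _ => hV c, ?_,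
    ⋂ c ∈ hTf.toFinset, N c, (biInter_finset_mem _).2 fun c _ => hN c, ?_⟩
  · rcases eq_or_ne ε ∞ with rfl | hε'
    · exact measure_lt_top _ _
    calc μ (⋃ c ∈ hTf.toFinset, V c) ≤ ∑ c ∈ hTf.toFinset, μ (V c) := measure_biUnion_finset_le _ _
      _ ≤ ∑ c ∈ hTf.toFinset, ε / (hTf.toFinset.card + 1) := Finset.sum_le_sum fun c _ => (hVμ c).le
      _ = hTf.toFinset.card * (ε / (hTf.toFinset.card + 1)) := by simp
      _ < (hTf.toFinset.card + 1 : ℝ≥0∞) * (ε / (hTf.toFinset.card + 1)) := by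
        refine (ENNReal.mul_lt_mul_iff_left hpos ?_).2 (by
          exact_mod_cast Nat.lt_succ_self _)
        exact ENNReal.div_ne_top hε' (by simp)
      _ = ε := ENNReal.mul_div_cancel (by simp) (by finiteness)
  · intro y hy g hg s hs h
    obtain ⟨c, hcT, hc⟩ : ∃ c ∈ T, s ∈ Metric.ball c (ρ / 2) := by
      simpa using hT (mem_closedBall_zero_iff.2 hs)
    simp only [mem_iUnion, not_exists] at hy
    simp only [mem_iInter] at hg
    obtain ⟨s', hs', h'⟩ := hVN c y (hy c (by simpa using hcT)) g (hg c (by simpa using hcT))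
      ⟨s, Metric.ball_subset_closedBall hc, h⟩
    refine ⟨s', ?_, h'⟩
    rw [← dist_eq_norm]
    have h1 := Metric.mem_closedBall.1 hs'
    have h2 := Metric.mem_ball'.1 hc
    linarith [dist_triangle s' c s]

end Transfer

/-- Walking by steps approximately `r` inside a set. -/
lemma exists_mem_near_add_mul {k : Type*} [NormedField k] {S : Set k} {s₀ r : k} {R ρ : ℝ}
    (hs₀ : s₀ ∈ S) (step : ∀ s ∈ S, ‖s + r‖ ≤ R → ∃ s' ∈ S, ‖s' - (s + r)‖ ≤ ρ) (n : ℕ)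
    (hR : ‖s₀‖ + n * (‖r‖ + ρ) ≤ R) (hρ : 0 ≤ ρ) :
    ∃ s ∈ S, ‖s - (s₀ + n * r)‖ ≤ n * ρ := by
  induction n with
  | zero => exact ⟨s₀, hs₀, by simp⟩
  | succ n ih =>
    push_cast at hR
    obtain ⟨s, hs, h⟩ := ih (by nlinarith [norm_nonneg r])
    have hn : ‖(n : k)‖ * ‖r‖ ≤ n * ‖r‖ := by
      gcongr; simpa using Nat.norm_cast_le (α := k) n
    obtain ⟨s', hs', h'⟩ := step s hs (by
      calc ‖s + r‖ = ‖(s - (s₀ + n * r)) + s₀ + n * r + r‖ := by congr 1; ring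
        _ ≤ n * ρ + ‖s₀‖ + n * ‖r‖ + ‖r‖ := by
          refine (norm_add_le _ _).trans (add_le_add ((norm_add_le _ _).trans (add_le_add
            ((norm_add_le _ _).trans (add_le_add h le_rfl)) ?_)) le_rfl)
          rw [norm_mul]; exact hn
        _ ≤ R := by linarith)
    refine ⟨s', hs', ?_⟩
    calc ‖s' - (s₀ + (n + 1 : ℕ) * r)‖ = ‖(s' - (s + r)) + (s - (s₀ + n * r))‖ := by
          congr 1; push_cast; ring
      _ ≤ ρ + n * ρ := (norm_add_le _ _).trans (add_le_add h' h)
      _ = _ := by push_cast; ring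

/-- A set invariant under approximate translation by `±r` comes close to all points which are
approximated by multiples of `r`. -/
lemma exists_mem_near_of_steps {k : Type*} [NormedField k] {S : Set k} {s₀ r σ : k} {R ρ η : ℝ}
    {N : ℕ} (hs₀ : s₀ ∈ S)
    (step : ∀ s ∈ S, ‖s + r‖ ≤ R → ∃ s' ∈ S, ‖s' - (s + r)‖ ≤ η)
    (step' : ∀ s ∈ S, ‖s - r‖ ≤ R → ∃ s' ∈ S, ‖s' - (s - r)‖ ≤ η)
    {j : ℤ} (hj : |j| ≤ N) (hjr : ‖j * r - σ‖ < ρ)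
    (hR : ‖s₀‖ + N * (‖r‖ + η) ≤ R) (hη : 0 ≤ η) :
    ∃ s ∈ S, ‖s - s₀ - σ‖ < N * η + ρ := by
  have key : ∀ r' : k, ‖r'‖ = ‖r‖ →
      (∀ s ∈ S, ‖s + r'‖ ≤ R → ∃ s' ∈ S, ‖s' - (s + r')‖ ≤ η) → ∀ n : ℕ, n ≤ N →
      ‖n * r' - σ‖ < ρ → ∃ s ∈ S, ‖s - s₀ - σ‖ < N * η + ρ := by
    intro r' hr' hstep n hn h
    have hn' : (n : ℝ) ≤ N := by exact_mod_cast hn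
    obtain ⟨s, hs, h1⟩ := exists_mem_near_add_mul hs₀ hstep n (by
      rw [hr']; nlinarith [norm_nonneg r]) hη
    refine ⟨s, hs, ?_⟩
    calc ‖s - s₀ - σ‖ = ‖(s - (s₀ + n * r')) + (n * r' - σ)‖ := by congr 1; ring
      _ ≤ n * η + ‖n * r' - σ‖ := (norm_add_le _ _).trans (by gcongr)
      _ < _ := by nlinarith
  obtain ⟨n, rfl | rfl⟩ := j.eq_nat_or_neg
  · exact key r rfl step n (by simpa using hj) (by simpa using hjr)
  · exact key (-r) (norm_neg r) (by simpa [← sub_eq_add_neg] using step') n (by simpa using hj)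
      (by simpa using hjr)


section Numerics

/-- A quadratic polynomial whose linear and quadratic coefficients are not both small is not small
at three separated points. -/
lemma exists_quadratic_gap {k : Type*} [NormedField k] {S κ' : ℝ} (hS : 0 ≤ S) (hκ' : 0 < κ') :
    ∃ κ : ℝ, 0 < κ ∧ ∀ (B e C : k) (E : ℝ), 0 < E → (E ≤ ‖e‖ ∨ E ≤ ‖C‖) → ∀ x y z : k,
      ‖x‖ ≤ S → ‖y‖ ≤ S → ‖z‖ ≤ S → κ' ≤ ‖x - y‖ → κ' ≤ ‖x - z‖ → κ' ≤ ‖y - z‖ →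
      ‖B + x * e - x ^ 2 * C‖ ≤ κ * E → ‖B + y * e - y ^ 2 * C‖ ≤ κ * E →
      ‖B + z * e - z ^ 2 * C‖ ≤ κ * E → False := by
  set T : ℝ := 2 / κ' + 2 * S * (4 / κ' ^ 2) + 4 / κ' ^ 2 with hT
  have hTpos : 0 < T := by positivity
  refine ⟨1 / (2 * T), by positivity, ?_⟩
  intro B e C E hE hor x y z hx hy hz hxy hxz hyz h1 h2 h3
  set κ : ℝ := 1 / (2 * T) with hκ
  have hκT : κ * T = 1 / 2 := by rw [hκ]; field_simp
  have hκ0 : 0 < κ := by positivity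
  have d : ∀ a b : k, κ' ≤ ‖a - b‖ → ‖B + a * e - a ^ 2 * C‖ ≤ κ * E →
      ‖B + b * e - b ^ 2 * C‖ ≤ κ * E → ‖e - C * (a + b)‖ ≤ 2 / κ' * (κ * E) := by
    intro a b hab ha hb
    have : ‖a - b‖ * ‖e - C * (a + b)‖ ≤ 2 * (κ * E) := by
      rw [← norm_mul]
      calc ‖(a - b) * (e - C * (a + b))‖ =
          ‖(B + a * e - a ^ 2 * C) - (B + b * e - b ^ 2 * C)‖ := by congr 1; ring
        _ ≤ κ * E + κ * E := (norm_sub_le _ _).trans (add_le_add ha hb)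
        _ = _ := by ring
    rw [div_mul_eq_mul_div, le_div_iff₀ hκ', mul_comm]
    exact (mul_le_mul_of_nonneg_right hab (norm_nonneg _)).trans this
  have hC : ‖C‖ ≤ 4 / κ' ^ 2 * (κ * E) := by
    have : ‖y - z‖ * ‖C‖ ≤ 4 / κ' * (κ * E) := by
      rw [← norm_mul]
      calc ‖(y - z) * C‖ = ‖(e - C * (x + z)) - (e - C * (x + y))‖ := by congr 1; ring
        _ ≤ 2 / κ' * (κ * E) + 2 / κ' * (κ * E) :=
          (norm_sub_le _ _).trans (add_le_add (d x z hxz h1 h3) (d x y hxy h1 h2))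
        _ = _ := by ring
    have h4 := (mul_le_mul_of_nonneg_right hyz (norm_nonneg C)).trans this
    rw [show 4 / κ' ^ 2 * (κ * E) = (4 / κ' * (κ * E)) / κ' by field_simp, le_div_iff₀ hκ',
      mul_comm]
    exact h4
  have he : ‖e‖ ≤ (2 / κ' + 2 * S * (4 / κ' ^ 2)) * (κ * E) := by
    calc ‖e‖ = ‖(e - C * (x + y)) + C * (x + y)‖ := by congr 1; ring
      _ ≤ 2 / κ' * (κ * E) + ‖C‖ * (S + S) := by
        refine (norm_add_le _ _).trans (add_le_add (d x y hxy h1 h2) ?_)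
        rw [norm_mul]
        exact mul_le_mul_of_nonneg_left ((norm_add_le _ _).trans (add_le_add hx hy))
          (norm_nonneg _)
      _ ≤ 2 / κ' * (κ * E) + (4 / κ' ^ 2 * (κ * E)) * (S + S) := by gcongr
      _ = _ := by ring
  have p1 : 0 < 4 / κ' ^ 2 := by positivity
  have p2 : 0 ≤ 2 / κ' + 2 * S * (4 / κ' ^ 2) := by positivity
  have hfin : T * (κ * E) = E / 2 := by linear_combination E * hκT
  have hκE : 0 < κ * E := by positivity
  rcases hor with h | h
  · have : T * (κ * E) = (2 / κ' + 2 * S * (4 / κ' ^ 2)) * (κ * E) + 4 / κ' ^ 2 * (κ * E) := by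
      rw [hT]; ring
    nlinarith [mul_pos p1 hκE]
  · have : T * (κ * E) = (2 / κ' + 2 * S * (4 / κ' ^ 2)) * (κ * E) + 4 / κ' ^ 2 * (κ * E) := by
      rw [hT]; ring
    nlinarith [mul_nonneg p2 hκE.le]

/-- The stopping level: the largest `τ` with `q ^ τ * E ≤ R`. -/
noncomputable def level (q R E : ℝ) : ℕ := ⌊Real.logb q (R / E)⌋₊

lemma pow_level_mul_le {q R E : ℝ} (hq : 1 < q) (hE : 0 < E) (hER : E ≤ R) :
    q ^ level q R E * E ≤ R := by
  have h0 : 0 ≤ Real.logb q (R / E) := Real.logb_nonneg hq ((one_le_div hE).2 hER)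
  have h1 := Nat.floor_le h0
  rw [← le_div_iff₀ hE, ← Real.rpow_natCast, ← Real.le_logb_iff_rpow_le hq (by
    exact div_pos (hE.trans_le hER) hE)]
  exact h1

lemma lt_pow_level_succ_mul {q R E : ℝ} (hq : 1 < q) (hE : 0 < E) (hER : E ≤ R) :
    R < q ^ (level q R E + 1) * E := by
  have h1 := Nat.lt_floor_add_one (Real.logb q (R / E))
  rw [← div_lt_iff₀ hE, ← Real.rpow_natCast, ← Real.logb_lt_iff_lt_rpow hq (by
    exact div_pos (hE.trans_le hER) hE)]
  exact_mod_cast h1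

lemma level_anti {q R E E' : ℝ} (hq : 1 < q) (hE : 0 < E) (hEE : E ≤ E') (hER : E' ≤ R) :
    level q R E' ≤ level q R E := by
  have h1 := pow_level_mul_le hq (hE.trans_le hEE) hER
  have h2 := lt_pow_level_succ_mul hq hE (hEE.trans hER)
  have h3 : q ^ level q R E' * E < q ^ (level q R E + 1) * E := by
    refine (mul_le_mul_of_nonneg_left hEE (by positivity)).trans_lt (h1.trans_lt h2)
  have := (pow_lt_pow_iff_right₀ hq).1 (lt_of_mul_lt_mul_right h3 hE.le)
  omega

lemma level_le {q R E : ℝ} (hq : 1 < q) (hE : 0 < E) (hER : E ≤ R) {j : ℕ} (h : R ≤ E * q ^ j) :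
    level q R E ≤ j := by
  have h1 := pow_level_mul_le hq hE hER
  refine (pow_le_pow_iff_right₀ hq).1 (le_of_mul_le_mul_right (h1.trans ?_) hE)
  rwa [mul_comm]

lemma le_level {q R E : ℝ} (hq : 1 < q) (hE : 0 < E) (hER : E ≤ R) {j : ℕ} (h : q ^ j * E ≤ R) :
    j ≤ level q R E := by
  have h1 := lt_pow_level_succ_mul hq hE hER
  have := (pow_lt_pow_iff_right₀ hq).1 (lt_of_mul_lt_mul_right (h.trans_lt h1) hE.le)
  omega

/-- Selection of a window of scales on which a growing quantity is in control. -/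
lemma exists_window {q η R : ℝ} (hq : 1 < q) (hη : 0 < η) (hR : 0 < R) :
    ∃ k₀ : ℕ, ∀ ℓ₀ : ℕ, ∃ θ : ℝ, 0 < θ ∧ ∀ δ : ℝ, 0 < δ → ∃ J₁ : ℕ, ∀ (E : ℕ → ℝ) (B : ℝ),
      Monotone E → (∀ j, E (j + 1) ≤ q * E j) → δ ≤ E 0 → E 0 ≤ θ → 0 ≤ B → B ≤ θ →
      ∃ j₂, ℓ₀ ≤ j₂ ∧ j₂ ≤ J₁ ∧ ∀ j, j₂ + k₀ ≤ 2 * j → j ≤ j₂ →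
        E j ≤ η ∧ B ≤ E j * q ^ j ∧ R ≤ E j * q ^ j := by
  have hq0 : 0 < q := by linarith
  obtain ⟨k₀, hk₀⟩ := pow_unbounded_of_one_lt (R * q / η) hq
  refine ⟨k₀, fun ℓ₀ => ?_⟩
  refine ⟨min (η / q ^ (ℓ₀ + 1)) (η / q), by positivity, fun δ hδ => ?_⟩
  set θ := min (η / q ^ (ℓ₀ + 1)) (η / q) with hθ
  have hθ1 : θ ≤ η / q ^ (ℓ₀ + 1) := min_le_left _ _
  have hθ2 : θ ≤ η / q := min_le_right _ _
  obtain ⟨k₁, hk₁⟩ := pow_unbounded_of_one_lt ((R + θ) / δ) hq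
  refine ⟨2 * k₁ + ℓ₀, fun E B hmono hstep hδE hEθ hB0 hB => ?_⟩
  have hgrow : ∀ i j, E (i + j) ≤ q ^ j * E i := by
    intro i j
    induction j with
    | zero => simp
    | succ j ih =>
      calc E (i + (j + 1)) ≤ q * E (i + j) := hstep (i + j)
        _ ≤ q * (q ^ j * E i) := by gcongr
        _ = _ := by ring
  by_cases hcase : E (2 * k₁ + ℓ₀) ≤ η
  · refine ⟨2 * k₁ + ℓ₀, by omega, le_rfl, fun j hj1 hj2 => ⟨(hmono hj2).trans hcase, ?_⟩⟩
    have h1 : R + θ ≤ E j * q ^ j := by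
      have h2 : (R + θ) / δ ≤ q ^ j := hk₁.le.trans (pow_le_pow_right₀ hq.le (by omega))
      rw [div_le_iff₀ hδ] at h2
      calc R + θ ≤ q ^ j * δ := h2
        _ ≤ q ^ j * E j := by gcongr; exact hδE.trans (hmono (Nat.zero_le j))
        _ = _ := mul_comm _ _
    have hθ0 : 0 < θ := by positivity
    constructor <;> linarith
  · have hex : ∃ j, η < E j := ⟨_, not_le.1 hcase⟩
    classical
    set j₃ := Nat.find hex with hj₃
    have h3 : η < E j₃ := Nat.find_spec hex
    have h3' : j₃ ≤ 2 * k₁ + ℓ₀ := Nat.find_min' hex (not_le.1 hcase)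
    have hE0 : E 0 ≤ η / q ^ (ℓ₀ + 1) := hEθ.trans hθ1
    have h4 : ℓ₀ + 1 < j₃ := by
      by_contra hcon
      have := hgrow 0 j₃
      rw [zero_add] at this
      have h5 : q ^ j₃ * E 0 ≤ q ^ (ℓ₀ + 1) * (η / q ^ (ℓ₀ + 1)) := by
        have : 0 ≤ E 0 := hδ.le.trans hδE
        gcongr
        · exact hq.le
        · omega
      rw [mul_div_cancel₀ _ (by positivity)] at h5
      linarith
    refine ⟨j₃ - 1, by omega, by omega, fun j hj1 hj2 => ?_⟩
    have hlow : η ≤ q ^ (j₃ - j) * E j := by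
      have := hgrow j (j₃ - j)
      rw [show j + (j₃ - j) = j₃ by omega] at this
      linarith
    have hE : 0 < E j := (hδ.trans_le hδE).trans_le (hmono (Nat.zero_le j))
    have hpow : q ^ (j₃ - j) * q ^ k₀ ≤ q * q ^ j := by
      rw [← pow_add, ← pow_succ']
      exact pow_le_pow_right₀ hq.le (by omega)
    have hkey : η * q ^ k₀ ≤ q * (E j * q ^ j) := by
      calc η * q ^ k₀ ≤ q ^ (j₃ - j) * E j * q ^ k₀ := by gcongr
        _ = E j * (q ^ (j₃ - j) * q ^ k₀) := by ring
        _ ≤ E j * (q * q ^ j) := by gcongr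
        _ = _ := by ring
    refine ⟨not_lt.1 (Nat.find_min hex (by omega)), ?_, ?_⟩
    · refine hB.trans (hθ2.trans ?_)
      rw [div_le_iff₀ hq0]
      calc η = η * 1 := (mul_one _).symm
        _ ≤ η * q ^ k₀ := by gcongr; exact one_le_pow₀ hq.le
        _ ≤ _ := by linarith
    · rw [div_lt_iff₀ hη] at hk₀
      have : q * R ≤ q * (E j * q ^ j) := by nlinarith
      exact le_of_mul_le_mul_left this hq0

end Numerics

section Digits

variable {k D : Type*} [NormedField k]

/-- The value of a word of digits in base `α`. -/
def digitSum (α : k) (dig : D → k) : List D → k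
  | [] => 0
  | d :: w => (dig d + digitSum α dig w) / α

variable {α : k} {dig : D → k}

lemma digitSum_append (hα : α ≠ 0) (v w : List D) : digitSum α dig (v ++ w) =
    digitSum α dig v + digitSum α dig w / α ^ v.length := by
  induction v with
  | nil => simp [digitSum]
  | cons d v ih =>
    simp only [List.cons_append, digitSum, ih, List.length_cons, pow_succ]
    field_simp
    ring

lemma norm_digitSum_le (hα : 2 ≤ ‖α‖) {B : ℝ} (hB : 0 ≤ B) (hdig : ∀ d, ‖dig d‖ ≤ B)
    (w : List D) : ‖digitSum α dig w‖ ≤ B := by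
  induction w with
  | nil => simpa [digitSum] using hB
  | cons d w ih =>
    rw [digitSum, norm_div, div_le_iff₀ (by linarith)]
    nlinarith [norm_add_le (dig d) (digitSum α dig w), hdig d]

end Digits


namespace WordChain

variable {Ω D : Type*} [MeasurableSpace Ω] [Fintype D] (c : WordChain Ω D)

lemma exists_word_lt_one {n : ℕ} {ω : Ω} {F : List D → ℝ≥0∞} (h : c.expect n ω F < 1) :
    ∃ w, w.length = n ∧ c.wt ω w ≠ 0 ∧ F w < 1 := by
  by_contra! hcon
  have := c.expect_mono (n := n) (ω := ω) (F := fun _ => 1) (G := F) hcon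
  rw [expect_const] at this
  exact absurd h (not_lt.2 this)

lemma measurable_wt (w : List D) : Measurable fun ω => c.wt ω w := by
  induction w with
  | nil => exact measurable_const
  | cons d w ih => exact (c.meas_p d).mul (ih.comp (c.meas_Z d))

lemma measurableSet_concentrated (n : ℕ) (η : ℝ≥0∞) :
    MeasurableSet {ω | ∃ w : List D, w.length = n ∧ η < c.wt ω w} := by
  have : {ω | ∃ w : List D, w.length = n ∧ η < c.wt ω w} =
      ⋃ w ∈ {w : List D | w.length = n}, {ω | η < c.wt ω w} := by
    ext ω; simp
  rw [this]
  exact MeasurableSet.biUnion (to_countable _) fun w _ =>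
    measurableSet_lt measurable_const (c.measurable_wt w)

/-- The expected number of visits to `V` during the first `N` steps. -/
noncomputable def hit (V : Set Ω) (N : ℕ) (ω : Ω) : ℝ≥0∞ :=
  ∑ i ∈ Finset.range N, c.expect i ω (fun v => V.indicator 1 (c.run ω v))

variable {V : Set Ω}

lemma measurable_hit (hV : MeasurableSet V) (N : ℕ) : Measurable (c.hit V N) :=
  Finset.measurable_sum _ fun i _ => c.measurable_expect i fun w =>
    (measurable_one.indicator hV).comp (c.measurable_run w)

variable {c} in
lemma Substationary.lintegral_hit_le {P : Measure Ω} (hP : c.Substationary P)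
    (hV : MeasurableSet V) (N : ℕ) : ∫⁻ ω, c.hit V N ω ∂P ≤ N * P V := by
  unfold hit
  have hm : ∀ i, Measurable fun ω => c.expect i ω (fun v => V.indicator 1 (c.run ω v)) :=
    fun i => c.measurable_expect i fun w => (measurable_one.indicator hV).comp (c.measurable_run w)
  rw [lintegral_finsetSum _ fun i _ => hm i]
  calc ∑ i ∈ Finset.range N, ∫⁻ ω, c.expect i ω (fun v => V.indicator 1 (c.run ω v)) ∂P
      ≤ ∑ _i ∈ Finset.range N, P V := Finset.sum_le_sum fun i _ =>
        (hP.lintegral_expect_le i (measurable_one.indicator hV)).trans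
          (lintegral_indicator_one hV).le
    _ = N * P V := by simp

/-- From a spread out state one can find a word avoiding few given prefixes, all of whose
extensions of moderate length can be chosen to avoid `V` simultaneously for a state and its
translate. -/
lemma exists_word_avoiding {ω : Ω} {m τ c₀ N : ℕ} (hτ : c₀ ≤ τ) {η : ℝ≥0∞}
    (hη : ∀ w, w.length = c₀ → c.wt ω w ≤ η) {Bad : Finset (List D)}
    (hBad : ∀ w ∈ Bad, w.length = c₀) (hcard : Bad.card * η ≤ 1 / 2)
    (h1 : c.expect τ ω (fun v => c.hit V N (c.run ω v)) ≤ 1 / 8)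
    (h2 : c.expect τ (c.b^[m] ω) (fun v => c.hit V N (c.run (c.b^[m] ω) v)) ≤ 1 / 8) :
    ∃ v, v.length = τ ∧ c.wt ω v ≠ 0 ∧ v.take c₀ ∉ Bad ∧ ∀ i < N, ∃ v', v'.length = i ∧
      c.wt ω (v ++ v') ≠ 0 ∧ c.run ω (v ++ v') ∉ V ∧ c.run (c.b^[m] ω) (v ++ v') ∉ V := by
  classical
  rw [expect_b_iter] at h2
  have hB : c.expect τ ω (fun v => if v.take c₀ ∈ Bad then 1 else 0) ≤ 1 / 2 := by
    rw [c.expect_take hτ ω (fun w => if w ∈ Bad then 1 else 0), c.expect_eq_sum_wt _ _ _ hBad]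
    refine le_trans ?_ hcard
    rw [← nsmul_eq_mul]
    exact Finset.sum_le_card_nsmul _ _ _ fun w hw => hη w (hBad w hw)
  have hsum : c.expect τ ω (fun v => ((c.hit V N (c.run ω v) + c.hit V N (c.run (c.b^[m] ω) v)) +
      if v.take c₀ ∈ Bad then 1 else 0)) < 1 := by
    rw [expect_add, expect_add]
    refine (add_le_add (add_le_add h1 h2) hB).trans_lt ?_
    rw [← ENNReal.toReal_lt_toReal (by finiteness) (by finiteness)]
    rw [ENNReal.toReal_add (by finiteness) (by finiteness),
      ENNReal.toReal_add (by finiteness) (by finiteness)]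
    norm_num
  obtain ⟨v, hv, hw, hlt⟩ := c.exists_word_lt_one hsum
  have hnB : v.take c₀ ∉ Bad := by
    intro h
    rw [if_pos h] at hlt
    exact absurd hlt (not_lt.2 le_add_self)
  rw [if_neg hnB, add_zero] at hlt
  refine ⟨v, hv, hw, hnB, fun i hi => ?_⟩
  have hi1 : c.expect i (c.run ω v) (fun w => V.indicator 1 (c.run (c.run ω v) w) +
      V.indicator 1 (c.run (c.run (c.b^[m] ω) v) w)) < 1 := by
    rw [expect_add]
    refine lt_of_le_of_lt (add_le_add ?_ ?_) hlt
    · exact Finset.single_le_sum (f := fun i => c.expect i (c.run ω v)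
        (fun w => V.indicator 1 (c.run (c.run ω v) w))) (fun _ _ => zero_le) (Finset.mem_range.2 hi)
    · have := Finset.single_le_sum (f := fun i => c.expect i (c.run (c.b^[m] ω) v)
        (fun w => V.indicator (1 : Ω → ℝ≥0∞) (c.run (c.run (c.b^[m] ω) v) w)))
        (fun _ _ => zero_le) (Finset.mem_range.2 hi)
      refine le_trans (le_of_eq ?_) this
      rw [run_b_iter, expect_b_iter]
  obtain ⟨v', hv', hw', hlt'⟩ := c.exists_word_lt_one hi1
  refine ⟨v', hv', ?_, ?_, ?_⟩
  · rw [wt_append]; exact mul_ne_zero hw hw'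
  · intro h
    rw [run_append] at h
    rw [indicator_of_mem h] at hlt'
    exact absurd hlt' (not_lt.2 le_self_add)
  · intro h
    rw [run_append] at h
    rw [indicator_of_mem h] at hlt'
    exact absurd hlt' (not_lt.2 le_add_self)

end WordChain

open Classical in
/-- Pigeonhole over a window of scales. -/
lemma exists_common_good {n j₂ k₀ : ℕ} (hj₂ : j₂ ≤ n) (hk : 2 * k₀ ≤ j₂)
    {b₁ b₂ b₃ : ℕ → Prop}
    (h₁ : (((Finset.Ico (n + 1 - (j₂ + 1)) (n + 1)).filter b₁).card : ℝ) ≤ 1 / 16 * (j₂ + 1 : ℕ))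
    (h₂ : (((Finset.Ico (n + 1 - (j₂ + 1)) (n + 1)).filter b₂).card : ℝ) ≤ 1 / 16 * (j₂ + 1 : ℕ))
    (h₃ : (((Finset.Ico (n + 1 - (j₂ + 1)) (n + 1)).filter b₃).card : ℝ) ≤ 1 / 16 * (j₂ + 1 : ℕ))
    {τ : ℕ → ℕ} (hτ : ∀ j, j₂ + k₀ ≤ 2 * j → j ≤ j₂ → τ j ≤ j)
    (hanti : ∀ j, j₂ + k₀ ≤ 2 * j → ∀ j', j' ≤ j₂ → j < j' → τ j' ≤ τ j) :
    ∃ j, j₂ + k₀ ≤ 2 * j ∧ j ≤ j₂ ∧ ¬ b₁ (n - j) ∧ ¬ b₂ (n - j + τ j) ∧ ¬ b₃ (n - j + τ j) := by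
  by_contra! hcon
  set I := Finset.Ico (n + 1 - (j₂ + 1)) (n + 1)
  set W := Finset.Icc ((j₂ + k₀ + 1) / 2) j₂ with hW
  have count : ∀ (b : ℕ → Prop) (T : ℕ → ℕ), (∀ j ∈ W, T j ∈ I) → InjOn T W →
      (W.filter fun j => b (T j)).card ≤ (I.filter b).card := by
    intro b T hT hinj
    refine Finset.card_le_card_of_injOn T ?_ ?_
    · intro j hj
      have hj := Finset.mem_filter.1 (Finset.mem_coe.1 hj)
      exact Finset.mem_coe.2 (Finset.mem_filter.2 ⟨hT j hj.1, hj.2⟩)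
    · exact hinj.mono fun j hj => (Finset.mem_filter.1 (Finset.mem_coe.1 hj)).1
  have memW : ∀ j, j ∈ W ↔ j₂ + k₀ ≤ 2 * j ∧ j ≤ j₂ := by
    intro j; rw [hW, Finset.mem_Icc]; omega
  have hT2 : ∀ j ∈ W, n - j + τ j ∈ I := by
    intro j hj
    rw [memW] at hj
    have := hτ j hj.1 hj.2
    simp only [I, Finset.mem_Ico]; omega
  have hinj : InjOn (fun j => n - j + τ j) W := by
    have : StrictAntiOn (fun j => n - j + τ j) W := by
      intro i hi j hj hij
      rw [Finset.mem_coe, memW] at hi hj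
      have := hanti i hi.1 j hj.2 hij
      dsimp only
      omega
    exact this.injOn
  have c1 := count b₁ (fun j => n - j) (fun j hj => by
    rw [memW] at hj; simp only [I, Finset.mem_Ico]; omega) (fun i hi j hj hij => by
    rw [Finset.mem_coe, memW] at hi hj; dsimp only at hij; omega)
  have c2 := count b₂ _ hT2 hinj
  have c3 := count b₃ _ hT2 hinj
  have hsub : W ⊆ (W.filter fun j => b₁ (n - j)) ∪ (W.filter fun j => b₂ (n - j + τ j)) ∪
      (W.filter fun j => b₃ (n - j + τ j)) := by
    intro j hj
    have hj' := (memW j).1 hj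
    have := hcon j hj'.1 hj'.2
    simp only [Finset.mem_union, Finset.mem_filter, hj, true_and]
    tauto
  have hcard := (Finset.card_le_card hsub).trans ((Finset.card_union_le _ _).trans
    (Nat.add_le_add_right (Finset.card_union_le _ _) _))
  have hWc : W.card = j₂ + 1 - (j₂ + k₀ + 1) / 2 := by rw [hW, Nat.card_Icc]
  have hlow : 4 * W.card ≥ j₂ + 1 := by rw [hWc]; omega
  have hc : (W.card : ℝ) ≤ 3 / 16 * (j₂ + 1 : ℕ) := by
    have : (W.card : ℝ) ≤ (I.filter b₁).card + (I.filter b₂).card + (I.filter b₃).card := by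
      exact_mod_cast hcard.trans (add_le_add (add_le_add c1 c2) c3)
    linarith
  have hlow' : (j₂ + 1 : ℕ) ≤ 4 * (W.card : ℝ) := by exact_mod_cast hlow
  have : (0 : ℝ) < (j₂ + 1 : ℕ) := by positivity
  linarith

namespace TreeSystem

variable {X D : Type} [TopologicalSpace X] {s : TreeSystem X D} [Fintype D]

lemma point_mem (ω : s.State) : ω.1.1 ∈ s.K :=
  (ω.2.mem []).resolve_left (by rw [ω.2.nil]; exact one_ne_zero)

lemma run_point {ω : s.State} {w : List D} (h : s.chain.wt ω w ≠ 0) :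
    (s.chain.run ω w).1.1 = s.follow ω.1.1 w := by
  induction w generalizing ω with
  | nil => rfl
  | cons d w ih =>
    have h1 : ω.1.2 [d] ≠ 0 := by
      intro h0
      apply h
      simp [WordChain.wt, chain, h0]
    have h2 : s.chain.wt (step d ω) w ≠ 0 := right_ne_zero_of_mul h
    change (s.chain.run (step d ω) w).1.1 = s.follow (s.f d ω.1.1) w
    rw [ih h2, step_val h1]

lemma b_iterate_point (m : ℕ) (ω : s.State) : (s.chain.b^[m] ω).1.1 = s.b^[m] ω.1.1 := by
  induction m generalizing ω with
  | zero => rfl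
  | succ m ih => rw [Function.iterate_succ_apply, ih, Function.iterate_succ_apply]; rfl

end TreeSystem


section SL2

variable {k : Type*} [NormedField k]

/-- Upper unipotent matrices. -/
def unip (s : k) : SL(2, k) := ⟨!![1, s; 0, 1], by simp [Matrix.det_fin_two_of]⟩

/-- Diagonal matrices. -/
def dia (l : kˣ) : SL(2, k) := ⟨!![(l : k), 0; 0, (l⁻¹ : kˣ)], by simp [Matrix.det_fin_two_of]⟩

lemma coe_unip (s : k) : (unip s : Matrix (Fin 2) (Fin 2) k) = !![1, s; 0, 1] := rfl

lemma coe_dia (l : kˣ) : (dia l : Matrix (Fin 2) (Fin 2) k) = !![(l : k), 0; 0, (l⁻¹ : kˣ)] := rfl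

lemma unip_add (s t : k) : unip (s + t) = unip s * unip t := by
  apply Subtype.ext
  rw [Matrix.SpecialLinearGroup.coe_mul, coe_unip, coe_unip, coe_unip]
  simp [add_comm]

lemma unip_zero : unip (0 : k) = 1 := by
  apply Subtype.ext
  simp [unip, Matrix.one_fin_two]

lemma continuous_unip : Continuous (unip : k → SL(2, k)) := by
  refine Continuous.subtype_mk ?_ _
  refine continuous_matrix fun i j => ?_
  fin_cases i <;> fin_cases j <;> simp <;> fun_prop

lemma dia_mul (l m : kˣ) : dia (l * m) = dia l * dia m := by
  apply Subtype.ext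
  rw [Matrix.SpecialLinearGroup.coe_mul, coe_dia, coe_dia, coe_dia]
  simp [mul_comm]

lemma dia_pow (l : kˣ) (n : ℕ) : dia (l ^ n) = dia l ^ n := by
  induction n with
  | zero => apply Subtype.ext; rw [coe_dia]; simp [Matrix.one_fin_two]
  | succ n ih => rw [pow_succ, dia_mul, ih, pow_succ]

lemma dia_inv (l : kˣ) : dia l⁻¹ = (dia l)⁻¹ := by
  rw [eq_inv_iff_mul_eq_one, ← dia_mul]
  simpa using dia_pow l 0

lemma dia_mul_unip (l : kˣ) (s : k) : dia l * unip s = unip ((l : k) ^ 2 * s) * dia l := by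
  apply Subtype.ext
  rw [Matrix.SpecialLinearGroup.coe_mul, Matrix.SpecialLinearGroup.coe_mul, coe_dia, coe_unip,
    coe_unip]
  simp [pow_two]
  field_simp

lemma dia_pow_mul_unip (l : kˣ) (n : ℕ) (s : k) :
    dia l ^ n * unip s = unip (((l : k) ^ 2) ^ n * s) * dia l ^ n := by
  rw [← dia_pow, dia_mul_unip]
  congr 3
  push_cast; ring

/-- The entries of the conjugate of a matrix by a renormalised translation. -/
lemma conj_entries (l : kˣ) (i j : ℕ) (σ : k) (g : SL(2, k)) {P : SL(2, k)}
    (hP : P = dia l ^ i * unip σ * (dia l ^ j)⁻¹) :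
    (P * g * P⁻¹) 0 0 = g 0 0 + σ * (g 1 0 * ((l : k) ^ 2) ^ j) ∧
    (P * g * P⁻¹) 1 1 = g 1 1 - σ * (g 1 0 * ((l : k) ^ 2) ^ j) ∧
    (P * g * P⁻¹) 1 0 = g 1 0 * ((l : k) ^ 2) ^ j / ((l : k) ^ 2) ^ i ∧
    (P * g * P⁻¹) 0 1 = ((l : k) ^ 2) ^ i * (g 0 1 / ((l : k) ^ 2) ^ j + σ * (g 1 1 - g 0 0) -
      σ ^ 2 * (g 1 0 * ((l : k) ^ 2) ^ j)) := by
  have hl : (l : k) ≠ 0 := l.ne_zero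
  have hPm : (P : Matrix (Fin 2) (Fin 2) k) =
      !![(l : k) ^ i / (l : k) ^ j, σ * (l : k) ^ i * (l : k) ^ j; 0, (l : k) ^ j / (l : k) ^ i] := by
    rw [hP, ← dia_pow, ← dia_pow, ← dia_inv]
    simp only [Matrix.SpecialLinearGroup.coe_mul, coe_dia, coe_unip]
    simp
    refine ⟨⟨?_, ?_⟩, ?_⟩ <;> field_simp
  have hPi : ((P⁻¹ : SL(2, k)) : Matrix (Fin 2) (Fin 2) k) =
      !![(l : k) ^ j / (l : k) ^ i, -(σ * (l : k) ^ i * (l : k) ^ j); 0, (l : k) ^ i / (l : k) ^ j] := by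
    rw [Matrix.SpecialLinearGroup.coe_inv, hPm, Matrix.adjugate_fin_two_of]
    simp
  have e : ∀ x y, (P * g * P⁻¹) x y = ((P : Matrix (Fin 2) (Fin 2) k) * g * (P⁻¹ : SL(2, k))) x y :=
    fun _ _ => rfl
  simp only [e, hPm, hPi, Matrix.mul_apply, Fin.sum_univ_two]
  simp
  refine ⟨?_, ?_, ?_, ?_⟩ <;> field_simp <;> ring

lemma exists_nhds_one_SL {G₂ : Type*} [TopologicalSpace G₂] [One G₂] {N : Set (SL(2, k) × G₂)}
    (hN : N ∈ 𝓝 (1 : SL(2, k) × G₂)) : ∃ ϑ : ℝ, 0 < ϑ ∧ ∃ N₂ ∈ 𝓝 (1 : G₂), ∀ g : SL(2, k),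
      (∀ i j, ‖g i j - (1 : Matrix (Fin 2) (Fin 2) k) i j‖ ≤ ϑ) → ∀ g₂ ∈ N₂, (g, g₂) ∈ N := by
  rw [show (1 : SL(2, k) × G₂) = (1, 1) from rfl, mem_nhds_prod_iff] at hN
  obtain ⟨N₁, hN₁, N₂, hN₂, hsub⟩ := hN
  have h1 := Matrix.SpecialLinearGroup.isClosedEmbedding_val.isInducing.nhds_eq_comap
    (1 : SL(2, k))
  obtain ⟨t, ht, hts⟩ := mem_comap.1 (h1 ▸ hN₁)
  obtain ⟨ϑ, hϑ, hball⟩ := Metric.nhds_basis_closedBall.mem_iff.1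
    (show t ∈ 𝓝 (fun i j => (1 : Matrix (Fin 2) (Fin 2) k) i j) from ht)
  refine ⟨ϑ, hϑ, N₂, hN₂, fun g hg g₂ hg₂ => hsub ⟨hts ?_, hg₂⟩⟩
  refine hball ((dist_pi_le_iff hϑ.le).2 fun i => ?_)
  rw [dist_pi_le_iff hϑ.le]
  intro j
  rw [dist_eq_norm]
  exact hg i j

lemma nhds_one_SL {G₂ : Type*} [TopologicalSpace G₂] [One G₂] {ϑ : ℝ} (hϑ : 0 < ϑ) {N₂ : Set G₂}
    (hN₂ : N₂ ∈ 𝓝 (1 : G₂)) : {g : SL(2, k) × G₂ |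
      (∀ i j, ‖g.1 i j - (1 : Matrix (Fin 2) (Fin 2) k) i j‖ ≤ ϑ) ∧ g.2 ∈ N₂} ∈
      𝓝 (1 : SL(2, k) × G₂) := by
  have h1 : ∀ i j, {g : SL(2, k) × G₂ | ‖g.1 i j - (1 : Matrix (Fin 2) (Fin 2) k) i j‖ ≤ ϑ} ∈
      𝓝 (1 : SL(2, k) × G₂) := by
    intro i j
    have hc : Continuous fun g : SL(2, k) × G₂ =>
        ‖g.1 i j - (1 : Matrix (Fin 2) (Fin 2) k) i j‖ := by
      have : Continuous fun g : SL(2, k) × G₂ => g.1 i j :=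
        (_root_.continuous_apply j).comp
          (Matrix.SpecialLinearGroup.continuous_apply _ continuous_fst i)
      fun_prop
    refine hc.continuousAt.preimage_mem_nhds (Iic_mem_nhds ?_)
    simpa using hϑ
  have h2 : {g : SL(2, k) × G₂ | g.2 ∈ N₂} ∈ 𝓝 (1 : SL(2, k) × G₂) :=
    continuous_snd.continuousAt.preimage_mem_nhds hN₂
  filter_upwards [h1 0 0, h1 0 1, h1 1 0, h1 1 1, h2] with g h00 h01 h10 h11 hg
  refine ⟨fun i j => ?_, hg⟩
  fin_cases i <;> fin_cases j <;> assumption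

end SL2


/-- The data and hypotheses of the shearing argument: a compact set invariant under a diagonal
element of each of two groups, which has bounded gaps of escape along unipotent orbits. -/
structure ShearSystem (k G₂ X D : Type) [NormedField k] [Group G₂] [TopologicalSpace G₂]
    [TopologicalSpace X] [MulAction (SL(2, k) × G₂) X] where
  l : kˣ
  b : G₂
  Y : Set X
  dig : D → k
  two_le : 2 ≤ ‖(l : k) ^ 2‖
  compact : IsCompact Y
  a_mem : ∀ y, ((dia l, 1) : SL(2, k) × G₂) • y ∈ Y ↔ y ∈ Y
  b_mem : ∀ y, ((1, b) : SL(2, k) × G₂) • y ∈ Y ↔ y ∈ Y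
  avoid : ∃ L ρ : ℝ, 0 < ρ ∧ ∀ x ∈ Y, ∃ σ : k, ‖σ‖ ≤ L ∧ ∀ s : k, ‖s - σ‖ < ρ →
    ((unip s, 1) : SL(2, k) × G₂) • x ∉ Y
  orb : ∀ x : X, ∀ N ∈ 𝓝 (1 : SL(2, k) × G₂), (fun g : SL(2, k) × G₂ => g • x) '' N ∈ 𝓝 x
  nonunip : ∃ N₀ ∈ 𝓝 (1 : SL(2, k) × G₂), ∀ m : ℕ, 1 ≤ m → ∀ x : X, ∀ g ∈ N₀,
    ((1, b ^ m) : SL(2, k) × G₂) • x = g • x → ¬ (g.1 1 0 = 0 ∧ g.1 0 0 = g.1 1 1)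
  prog : ∀ L ρ : ℝ, 0 < ρ → ∃ r₀ : ℝ, 0 < r₀ ∧ ∃ N₀ : ℕ, ∀ r : k, r₀ ≤ ‖r‖ →
    ‖r‖ ≤ 2 * ‖(l : k) ^ 2‖ * r₀ → ∀ σ : k, ‖σ‖ ≤ L → ∃ j : ℤ, |j| ≤ N₀ ∧ ‖j * r - σ‖ < ρ
  sep : ∀ R : ℝ, ∃ C : ℕ, ∀ n : ℕ, ∀ T : Finset (List D), (∀ w ∈ T, w.length = n) →
    (∀ w ∈ T, ∀ w' ∈ T, ‖digitSum ((l : k) ^ 2) dig w - digitSum ((l : k) ^ 2) dig w'‖ ≤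
      R / ‖(l : k) ^ 2‖ ^ n) → T.card ≤ C

namespace ShearSystem

variable {k G₂ X D : Type} [NormedField k] [ProperSpace k] [Group G₂] [TopologicalSpace G₂]
  [IsTopologicalGroup G₂] [TopologicalSpace X] [MulAction (SL(2, k) × G₂) X]
  [ContinuousSMul (SL(2, k) × G₂) X] (S : ShearSystem k G₂ X D)

/-- Unipotent elements. -/
def u (s : k) : SL(2, k) × G₂ := (unip s, 1)

lemma u_add (s t : k) : (u (s + t) : SL(2, k) × G₂) = u s * u t := by
  simp [u, unip_add]

lemma continuous_u : Continuous (u : k → SL(2, k) × G₂) :=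
  continuous_unip.prodMk continuous_const

/-- The expanded square of the diagonal entry. -/
def α : k := (S.l : k) ^ 2

lemma α_ne_zero : S.α ≠ 0 := pow_ne_zero _ S.l.ne_zero

/-- The points which reach `Y` after a unipotent move of size at most one. -/
def K : Set X := {y | ∃ s : k, ‖s‖ ≤ 1 ∧ (u s : SL(2, k) × G₂) • y ∈ S.Y}

lemma isCompact_K : IsCompact S.K := by
  have h1 : S.K = (fun z : k × X => (u (-z.1) : SL(2, k) × G₂) • z.2) ''
      (Metric.closedBall 0 1 ×ˢ S.Y) := by
    ext y
    constructor
    · rintro ⟨s, hs, h⟩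
      refine ⟨(s, (u s : SL(2, k) × G₂) • y), ⟨by simpa using hs, h⟩, ?_⟩
      dsimp only
      rw [← mul_smul, ← u_add]; simp [u, unip_zero, ← Prod.one_eq_mk]
    · rintro ⟨⟨s, x⟩, ⟨hs, hx⟩, rfl⟩
      refine ⟨s, by simpa using hs, ?_⟩
      rw [← mul_smul, ← u_add]; simpa [u, unip_zero, ← Prod.one_eq_mk] using hx
  rw [h1]
  refine ((isCompact_closedBall _ _).prod S.compact).image ?_
  have := continuous_u (k := k) (G₂ := G₂)
  fun_prop

lemma b_pow_mem (m : ℕ) (y : X) : ((1, S.b ^ m) : SL(2, k) × G₂) • y ∈ S.Y ↔ y ∈ S.Y := by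
  induction m with
  | zero => simp [← Prod.one_eq_mk]
  | succ m ih =>
    rw [show ((1, S.b ^ (m + 1)) : SL(2, k) × G₂) = (1, S.b) * (1, S.b ^ m) by
      simp [pow_succ'], mul_smul, S.b_mem, ih]

lemma a_pow_mem (m : ℕ) (y : X) : ((dia S.l ^ m, 1) : SL(2, k) × G₂) • y ∈ S.Y ↔ y ∈ S.Y := by
  induction m with
  | zero => simp [← Prod.one_eq_mk]
  | succ m ih =>
    rw [show ((dia S.l ^ (m + 1), 1) : SL(2, k) × G₂) = (dia S.l, 1) * (dia S.l ^ m, 1) by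
      simp [pow_succ'], mul_smul, S.a_mem, ih]

lemma first_smul_b (m : ℕ) (g : SL(2, k)) (y : X) :
    ((g, 1) : SL(2, k) × G₂) • ((1, S.b ^ m) : SL(2, k) × G₂) • y =
      ((1, S.b ^ m) : SL(2, k) × G₂) • ((g, 1) : SL(2, k) × G₂) • y := by
  rw [← mul_smul, ← mul_smul]; simp

/-- The associated tree system. -/
def tree : TreeSystem X D where
  f d y := ((dia S.l * unip (S.dig d / S.α), 1) : SL(2, k) × G₂) • y
  b y := ((1, S.b) : SL(2, k) × G₂) • y
  K := S.K
  cont_f _ := continuous_const_smul _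
  cont_b := continuous_const_smul _
  comm d x := by rw [← mul_smul, ← mul_smul]; simp
  compact := S.isCompact_K
  map_b := by
    rintro x ⟨s, hs, h⟩
    refine ⟨s, hs, ?_⟩
    have := S.first_smul_b 1 (unip s) x
    rw [pow_one] at this
    rw [u, this, S.b_mem]; exact h

lemma tree_b_iterate (m : ℕ) (y : X) : S.tree.b^[m] y = ((1, S.b ^ m) : SL(2, k) × G₂) • y := by
  induction m with
  | zero => simp [← Prod.one_eq_mk]
  | succ m ih =>
    rw [Function.iterate_succ_apply', ih]
    change ((1, S.b) : SL(2, k) × G₂) • _ = _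
    rw [← mul_smul]; simp [pow_succ']

lemma tree_follow (y : X) (w : List D) : S.tree.follow y w =
    ((dia S.l ^ w.length * unip (digitSum S.α S.dig w), 1) : SL(2, k) × G₂) • y := by
  induction w generalizing y with
  | nil => simp [TreeSystem.follow, digitSum, unip_zero, ← Prod.one_eq_mk]
  | cons d w ih =>
    rw [TreeSystem.follow, ih]
    change _ • ((dia S.l * unip (S.dig d / S.α), 1) : SL(2, k) × G₂) • y = _
    rw [← mul_smul]
    congr 1
    simp only [Prod.mk_mul_mk, mul_one, Prod.mk.injEq, and_true, List.length_cons, digitSum]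
    have h1 : unip (digitSum S.α S.dig w) * dia S.l =
        dia S.l * unip (digitSum S.α S.dig w / S.α) := by
      rw [dia_mul_unip, show (S.l : k) ^ 2 = S.α from rfl, mul_div_cancel₀ _ S.α_ne_zero]
    rw [mul_assoc, ← mul_assoc (unip _), h1, mul_assoc, ← unip_add, pow_succ, mul_assoc]
    congr 3
    ring

/-- Nearly unipotent return maps of the right size cannot occur away from a set of small
measure. -/
lemma exists_obstruction [FirstCountableTopology G₂] [T2Space X] [MeasurableSpace X]
    [BorelSpace X] : ∃ r₀ : ℝ, 0 < r₀ ∧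
    ∀ (μ : Measure X) [IsFiniteMeasure μ] (ε : ℝ≥0∞), ε ≠ 0 → ∃ V : Set X, MeasurableSet V ∧
      μ V < ε ∧ ∃ ϑ : ℝ, 0 < ϑ ∧ ∃ N₂ ∈ 𝓝 (1 : G₂), ∀ (m : ℕ) (y : X), y ∈ S.K → y ∉ V →
        ((1, S.b ^ m) : SL(2, k) × G₂) • y ∉ V → ∀ (H : SL(2, k)), ∀ g₂ ∈ N₂,
        ((1, S.b ^ m) : SL(2, k) × G₂) • y = ((H, g₂) : SL(2, k) × G₂) • y →
        ‖H 0 0 - 1‖ ≤ ϑ → ‖H 1 1 - 1‖ ≤ ϑ → ‖H 1 0‖ ≤ ϑ → r₀ ≤ ‖H 0 1‖ →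
        ‖H 0 1‖ ≤ 2 * ‖S.α‖ * r₀ → False := by
  obtain ⟨L, ρ, hρ, havoid⟩ := S.avoid
  obtain ⟨r₀, hr₀, N₀, hprog⟩ := S.prog L (ρ / 2) (half_pos hρ)
  refine ⟨r₀, hr₀, fun μ _ ε hε => ?_⟩
  set r₁ : ℝ := 2 * ‖S.α‖ * r₀ with hr₁
  have hr₁0 : 0 ≤ r₁ := by positivity
  set ρ' : ℝ := ρ / (2 * (N₀ + 1)) with hρ'
  have hρ'0 : 0 < ρ' := by positivity
  have hNρ : N₀ * ρ' ≤ ρ / 2 := by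
    rw [hρ', mul_div_assoc', div_le_div_iff₀ (by positivity) (by norm_num)]
    nlinarith
  have : FirstCountableTopology (Matrix (Fin 2) (Fin 2) k) :=
    inferInstanceAs (FirstCountableTopology (Fin 2 → Fin 2 → k))
  have : FirstCountableTopology (SL(2, k)) :=
    Matrix.SpecialLinearGroup.isClosedEmbedding_val.isInducing.firstCountableTopology
  obtain ⟨V, hV, hVμ, N, hN, htrans⟩ := exists_transfer S.orb (continuous_u (k := k) (G₂ := G₂))
    S.compact.isClosed (1 + N₀ * (r₁ + ρ')) hρ'0 μ hε
  obtain ⟨ϑ, hϑ, N₂, hN₂, hball⟩ := exists_nhds_one_SL hN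
  refine ⟨V, hV, hVμ, ϑ / (1 + r₁), by positivity, N₂ ∩ N₂⁻¹, ?_, ?_⟩
  · exact inter_mem hN₂ (inv_mem_nhds_one _ hN₂)
  intro m y hyK hyV hzV H g₂ hg₂ hz h00 h11 h10 hr hr'
  set z : X := ((1, S.b ^ m) : SL(2, k) × G₂) • y with hzdef
  set r : k := H 0 1 with hrdef
  have hϑ' : ϑ / (1 + r₁) ≤ ϑ := div_le_self hϑ.le (by linarith)
  have small : ∀ {x : k}, ‖x‖ ≤ ϑ / (1 + r₁) → ‖x‖ ≤ ϑ := fun h => h.trans hϑ'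
  have small2 : ∀ {x y : k}, ‖x‖ ≤ ϑ / (1 + r₁) → ‖y‖ ≤ ϑ / (1 + r₁) → ‖x - r * y‖ ≤ ϑ := by
    intro x y hx hy
    calc ‖x - r * y‖ ≤ ϑ / (1 + r₁) + r₁ * (ϑ / (1 + r₁)) := by
          refine (norm_sub_le _ _).trans (add_le_add hx ?_)
          rw [norm_mul]; gcongr
      _ = ϑ := by field_simp
  have small3 : ∀ {y : k}, ‖y‖ ≤ ϑ / (1 + r₁) → ‖r * y‖ ≤ ϑ := by
    intro y hy
    have h0 : ‖(0 : k)‖ ≤ ϑ / (1 + r₁) := by simp; positivity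
    simpa using small2 h0 hy
  have hS : ∀ s : k, (u s : SL(2, k) × G₂) • z ∈ S.Y ↔ (u s : SL(2, k) × G₂) • y ∈ S.Y := by
    intro s
    rw [hzdef, u, S.first_smul_b, S.b_pow_mem]
  have hmem1 : (u (-r) : SL(2, k) × G₂) * (H, g₂) ∈ N := by
    rw [u, Prod.mk_mul_mk, one_mul]
    refine hball _ (fun i j => ?_) _ hg₂.1
    rw [Matrix.SpecialLinearGroup.coe_mul, coe_unip]
    fin_cases i <;> fin_cases j <;> simp [Matrix.mul_apply, Fin.sum_univ_two]
    · convert small2 h00 h10 using 2; ring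
    · convert small3 (y := -(H 1 1 - 1)) (by rwa [norm_neg]) using 2; rw [hrdef]; ring
    · exact small h10
    · exact small h11
  have hmem2 : (u r : SL(2, k) × G₂) * (H, g₂)⁻¹ ∈ N := by
    rw [u, Prod.inv_mk, Prod.mk_mul_mk, one_mul]
    refine hball _ (fun i j => ?_) _ (by simpa using hg₂.2)
    rw [Matrix.SpecialLinearGroup.coe_mul, coe_unip, Matrix.SpecialLinearGroup.coe_inv,
      Matrix.adjugate_fin_two]
    fin_cases i <;> fin_cases j <;> simp [Matrix.mul_apply, Fin.sum_univ_two]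
    · convert small2 h11 h10 using 2; ring
    · convert small3 h00 using 2; rw [hrdef]; ring
    · exact small h10
    · exact small h00
  obtain ⟨s₀, hs₀, hs₀Y⟩ := hyK
  obtain ⟨σ, hσ, hσY⟩ := havoid _ hs₀Y
  obtain ⟨j, hj, hjr⟩ := hprog r hr hr' σ hσ
  obtain ⟨s, hs, hsn⟩ := exists_mem_near_of_steps (S := {s : k | (u s : SL(2, k) × G₂) • y ∈ S.Y})
    (R := 1 + N₀ * (r₁ + ρ')) (η := ρ') hs₀Y (fun s hs hsR => by
      obtain ⟨s', hs', h'⟩ := htrans y hyV _ hmem1 (s + r) hsR (by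
        rw [← mul_smul, ← mul_assoc, ← u_add, add_neg_cancel_right, mul_smul, ← hz]
        exact (hS s).2 hs)
      exact ⟨s', h', hs'⟩) (fun s hs hsR => by
      obtain ⟨s', hs', h'⟩ := htrans z hzV _ hmem2 (s - r) hsR (by
        rw [← mul_smul, ← mul_assoc, ← u_add, sub_add_cancel, mul_smul, hz, inv_smul_smul]
        exact hs)
      exact ⟨s', (hS s').1 h', hs'⟩) hj hjr (by gcongr) hρ'0.le
  refine hσY (s - s₀) (hsn.trans_le (by linarith)) ?_
  change (u (s - s₀) : SL(2, k) × G₂) • (u s₀ : SL(2, k) × G₂) • y ∈ S.Y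
  rw [← mul_smul, ← u_add, sub_add_cancel]
  exact hs

end ShearSystem


open Classical in
/-- A finite set without three elements pairwise unrelated is covered by two neighbourhoods. -/
lemma card_le_two_mul_of_no_three {β : Type*} {T : Finset β} {r : β → β → Prop} {C : ℕ}
    (hC : ∀ x ∈ T, (T.filter (r x)).card ≤ C)
    (h3 : ∀ x ∈ T, ∀ y ∈ T, ∀ z ∈ T, ¬ r x y → ¬ r x z → ¬ r y z → False) :
    T.card ≤ 2 * C := by
  by_contra! hlt
  have h1 : T.Nonempty := Finset.card_pos.1 (by omega)
  obtain ⟨x, hx⟩ := h1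
  have hsplit := Finset.card_filter_add_card_filter_not (s := T) (r x)
  have hx' := hC x hx
  have h2 : (T.filter fun y => ¬ r x y).Nonempty := Finset.card_pos.1 (by omega)
  obtain ⟨y, hy⟩ := h2
  rw [Finset.mem_filter] at hy
  have hsplit2 := Finset.card_filter_add_card_filter_not (s := T.filter fun y => ¬ r x y) (r y)
  have hy' : ((T.filter fun y => ¬ r x y).filter (r y)).card ≤ C :=
    (Finset.card_le_card (Finset.filter_subset_filter _ (Finset.filter_subset _ _))).trans
      (hC y hy.1)
  have h3' : ((T.filter fun y => ¬ r x y).filter fun z => ¬ r y z).Nonempty :=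
    Finset.card_pos.1 (by omega)
  obtain ⟨z, hz⟩ := h3'
  simp only [Finset.mem_filter] at hz
  exact h3 x hx y hy.1 z hz.1.1 hy.2 hz.1.2 hz.2

open Classical in
/-- Following a generic continuation, the quadratic displacement is at least its natural
size. -/
lemma exists_shear_word {k D Ω : Type} [NormedField k] [Fintype D] [MeasurableSpace Ω]
    {α : k} (hα : 2 ≤ ‖α‖)
    (dig : D → k) {B : ℝ} (hB : 0 ≤ B) (hdig : ∀ d, ‖dig d‖ ≤ B)
    (sep : ∀ R : ℝ, ∃ C : ℕ, ∀ n : ℕ, ∀ T : Finset (List D), (∀ w ∈ T, w.length = n) →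
      (∀ w ∈ T, ∀ w' ∈ T, ‖digitSum α dig w - digitSum α dig w'‖ ≤ R / ‖α‖ ^ n) → T.card ≤ C) :
    ∃ η : ℝ≥0∞, η ≠ 0 ∧ ∀ c₀ : ℕ, ∃ N : ℕ, ∀ r₀ : ℝ, 0 < r₀ → ∃ R : ℝ, 0 < R ∧ ∃ c₁ : ℕ,
      ∀ (c : WordChain Ω D) (V : Set Ω) (ω : Ω) (m : ℕ) (b e a s₀ : k) (E : ℝ), ‖s₀‖ ≤ B → 0 < E →
      E ≤ R → c₁ ≤ level ‖α‖ R E → (E ≤ ‖e‖ ∨ E ≤ ‖a‖) → ‖e‖ ≤ E → ‖a‖ ≤ E → ‖b‖ ≤ E →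
      (∀ w : List D, w.length = c₀ → c.wt ω w ≤ η) →
      (c.expect (level ‖α‖ R E) ω fun v => c.hit V N (c.run ω v)) ≤ 1 / 8 →
      (c.expect (level ‖α‖ R E) (c.b^[m] ω) fun v => c.hit V N (c.run (c.b^[m] ω) v)) ≤ 1 / 8 →
      ∃ v : List D, c.wt ω v ≠ 0 ∧ c.run ω v ∉ V ∧ c.run (c.b^[m] ω) v ∉ V ∧
        r₀ ≤ ‖α‖ ^ v.length * ‖b + (digitSum α dig v - s₀) * e - (digitSum α dig v - s₀) ^ 2 * a‖ ∧
        ‖α‖ ^ v.length * ‖b + (digitSum α dig v - s₀) * e - (digitSum α dig v - s₀) ^ 2 * a‖ ≤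
          2 * ‖α‖ * r₀ := by
  set q := ‖α‖ with hq
  have hα0 : α ≠ 0 := by
    intro h; rw [h, norm_zero] at hq; linarith
  have hq1 : 1 < q := by linarith
  have hq0 : 0 < q := by linarith
  obtain ⟨C, hC⟩ := sep (2 * (2 * B + 1))
  refine ⟨((4 * C + 4 : ℕ) : ℝ≥0∞)⁻¹, ENNReal.inv_ne_zero.2 (ENNReal.natCast_ne_top _), fun c₀ => ?_⟩
  set S : ℝ := 2 * B with hS
  have hS0 : 0 ≤ S := by positivity
  obtain ⟨κ, hκ, hgap⟩ := exists_quadratic_gap (k := k) hS0 (κ' := 1 / q ^ c₀) (by positivity)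
  set K : ℝ := 1 + S + S ^ 2 with hK
  have hK0 : 0 < K := by positivity
  obtain ⟨n, hn⟩ := pow_unbounded_of_one_lt (K / κ) hq1
  rw [div_lt_iff₀ hκ] at hn
  refine ⟨n + 2, fun r₀ hr₀ => ⟨4 / 3 * r₀ / K, by positivity, ?_⟩⟩
  set R : ℝ := 4 / 3 * r₀ / K with hR
  have hRK : R * K = 4 / 3 * r₀ := by rw [hR]; field_simp
  obtain ⟨c₁', hc₁'⟩ := pow_unbounded_of_one_lt (B * (1 + 2 * S) * 4 / κ) hq1
  rw [div_lt_iff₀ hκ] at hc₁'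
  refine ⟨max c₀ c₁', fun c V ω m b e a s₀ E hs₀ hE hER hτ hEea he ha hb hη h1 h2 => ?_⟩
  set τ := level q R E with hτdef
  have hτc₀ : c₀ ≤ τ := (le_max_left _ _).trans hτ
  have hτc₁ : c₁' ≤ τ := (le_max_right _ _).trans hτ
  set Q : k → k := fun σ => b + σ * e - σ ^ 2 * a with hQ
  have hπ : ∀ w : List D, ‖digitSum α dig w‖ ≤ B := norm_digitSum_le hα hB hdig
  have hσ : ∀ w : List D, ‖digitSum α dig w - s₀‖ ≤ S := fun w =>
    (norm_sub_le _ _).trans (by linarith [hπ w])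
  have hfin : {w : List D | w.length = c₀ ∧ ∃ v : List D, v.length = τ ∧ v.take c₀ = w ∧
      ‖Q (digitSum α dig v - s₀)‖ ≤ κ * E}.Finite :=
    (List.finite_length_eq D c₀).subset fun w hw => hw.1
  set Bad := hfin.toFinset with hBad
  have memBad : ∀ w ∈ Bad, w.length = c₀ ∧ ∃ v : List D, v.length = τ ∧ v.take c₀ = w ∧
      ‖Q (digitSum α dig v - s₀)‖ ≤ κ * E := fun w hw => by simpa [hBad] using hw
  have hcard : Bad.card ≤ 2 * C := by
    have far : ∀ v v' : List D, v.length = τ → v'.length = τ →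
        ¬ ‖digitSum α dig (v.take c₀) - digitSum α dig (v'.take c₀)‖ ≤ (2 * B + 1) / q ^ c₀ →
        1 / q ^ c₀ ≤ ‖(digitSum α dig v - s₀) - (digitSum α dig v' - s₀)‖ := by
      intro v v' hv hv' h
      have e1 : ∀ v : List D, v.length = τ → digitSum α dig v =
          digitSum α dig (v.take c₀) + digitSum α dig (v.drop c₀) / α ^ c₀ := by
        intro v hv
        conv_lhs => rw [← List.take_append_drop c₀ v]
        rw [digitSum_append hα0, List.length_take, hv, min_eq_left hτc₀]
      have e2 : ∀ v : List D, ‖digitSum α dig (v.drop c₀) / α ^ c₀‖ ≤ B / q ^ c₀ := by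
        intro v
        rw [norm_div, norm_pow]
        gcongr
        exact hπ _
      rw [e1 v hv, e1 v' hv']
      set x := digitSum α dig (v.take c₀)
      set x' := digitSum α dig (v'.take c₀)
      have h3 := e2 v
      have h4 := e2 v'
      set y := digitSum α dig (v.drop c₀) / α ^ c₀
      set y' := digitSum α dig (v'.drop c₀) / α ^ c₀
      have h5 : x - x' = (x + y - s₀ - (x' + y' - s₀)) - y + y' := by ring
      have h6 : ‖x - x'‖ ≤ ‖x + y - s₀ - (x' + y' - s₀)‖ + ‖y‖ + ‖y'‖ := by
        rw [h5]
        exact (norm_add_le _ _).trans (add_le_add_left (norm_sub_le _ _) _)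
      have h7 : (2 * B + 1) / q ^ c₀ = 1 / q ^ c₀ + B / q ^ c₀ + B / q ^ c₀ := by ring
      linarith [not_le.1 h]
    refine card_le_two_mul_of_no_three
      (r := fun w w' => ‖digitSum α dig w - digitSum α dig w'‖ ≤ (2 * B + 1) / q ^ c₀) ?_ ?_
    · intro w _
      refine hC c₀ _ (fun w' hw' => (memBad w' (Finset.mem_filter.1 hw').1).1) ?_
      intro w₁ h₁ w₂ h₂
      have h₁ := (Finset.mem_filter.1 h₁).2
      have h₂ := (Finset.mem_filter.1 h₂).2
      calc _ ≤ ‖digitSum α dig w₁ - digitSum α dig w‖ + ‖digitSum α dig w - digitSum α dig w₂‖ :=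
            norm_sub_le_norm_sub_add_norm_sub _ _ _
        _ ≤ (2 * B + 1) / q ^ c₀ + (2 * B + 1) / q ^ c₀ := by
            rw [norm_sub_rev]; exact add_le_add h₁ h₂
        _ = _ := by ring
    · intro x hx y hy z hz hxy hxz hyz
      obtain ⟨_, vx, lx, rfl, bx⟩ := memBad x hx
      obtain ⟨_, vy, ly, rfl, by'⟩ := memBad y hy
      obtain ⟨_, vz, lz, rfl, bz⟩ := memBad z hz
      exact hgap b e a E hE hEea _ _ _ (hσ vx) (hσ vy) (hσ vz) (far _ _ lx ly hxy)
        (far _ _ lx lz hxz) (far _ _ ly lz hyz) bx by' bz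
  have hcard' : (Bad.card : ℝ≥0∞) * ((4 * C + 4 : ℕ) : ℝ≥0∞)⁻¹ ≤ 1 / 2 := by
    rw [← div_eq_mul_inv]
    refine ENNReal.div_le_of_le_mul ?_
    calc (Bad.card : ℝ≥0∞) ≤ ((2 * C + 2 : ℕ) : ℝ≥0∞) := by exact_mod_cast (by omega)
      _ = 1 / 2 * (2 * ((2 * C + 2 : ℕ) : ℝ≥0∞)) := by
        rw [← mul_assoc, one_div, ENNReal.inv_mul_cancel two_ne_zero ENNReal.ofNat_ne_top, one_mul]
      _ = _ := by push_cast; ring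
  obtain ⟨v, hvτ, hvw, hvBad, hext⟩ := c.exists_word_avoiding hτc₀ hη (fun w hw => (memBad w hw).1)
    hcard' h1 h2
  set σ := digitSum α dig v - s₀ with hσdef
  have hQbig : κ * E < ‖Q σ‖ := by
    by_contra! hle
    apply hvBad
    rw [hBad, Set.Finite.mem_toFinset]
    exact ⟨by simp [hvτ, hτc₀], v, hvτ, rfl, hle⟩
  have hQK : ‖Q σ‖ ≤ K * E := by
    have hs := hσ v
    calc ‖Q σ‖ ≤ ‖b‖ + ‖σ‖ * ‖e‖ + ‖σ‖ ^ 2 * ‖a‖ := by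
          rw [hQ]; dsimp only
          refine (norm_sub_le _ _).trans (add_le_add ((norm_add_le _ _).trans ?_) ?_) <;> simp
      _ ≤ E + S * E + S ^ 2 * E := by gcongr
      _ = K * E := by rw [hK]; ring
  have hlev := pow_level_mul_le hq1 hE hER
  have hlev' := lt_pow_level_succ_mul hq1 hE hER
  rw [← hτdef] at hlev hlev'
  have hex : ∃ i, 4 / 3 * r₀ ≤ q ^ (τ + i) * ‖Q σ‖ := by
    refine ⟨n + 1, ?_⟩
    calc 4 / 3 * r₀ = R * K := hRK.symm
      _ ≤ (q ^ (τ + 1) * E) * (q ^ n * κ) :=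
          mul_le_mul hlev'.le hn.le hK0.le (by positivity)
      _ = q ^ (τ + (n + 1)) * (κ * E) := by ring
      _ ≤ _ := by gcongr
  have hin : Nat.find hex < n + 2 := by
    have : Nat.find hex ≤ n + 1 := by
      refine Nat.find_min' hex ?_
      calc 4 / 3 * r₀ = R * K := hRK.symm
        _ ≤ (q ^ (τ + 1) * E) * (q ^ n * κ) :=
            mul_le_mul hlev'.le hn.le hK0.le (by positivity)
        _ = q ^ (τ + (n + 1)) * (κ * E) := by ring
        _ ≤ _ := by gcongr
    omega
  set i := Nat.find hex with hi
  have hlow : 4 / 3 * r₀ ≤ q ^ (τ + i) * ‖Q σ‖ := Nat.find_spec hex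
  have hhigh : q ^ (τ + i) * ‖Q σ‖ ≤ q * (4 / 3 * r₀) := by
    rcases Nat.eq_zero_or_pos i with h0 | h0
    · rw [h0, add_zero]
      calc q ^ τ * ‖Q σ‖ ≤ q ^ τ * (K * E) := by gcongr
        _ = (q ^ τ * E) * K := by ring
        _ ≤ R * K := by gcongr
        _ ≤ q * (4 / 3 * r₀) := by rw [hRK]; nlinarith
    · have h2 : ¬ _ := Nat.find_min hex (m := i - 1) (by omega)
      rw [show τ + i = (τ + (i - 1)) + 1 by omega, pow_succ', mul_assoc]
      exact mul_le_mul_of_nonneg_left (not_le.1 h2).le hq0.le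
  obtain ⟨v', hv'i, hwt, hV1, hV2⟩ := hext i hin
  refine ⟨v ++ v', hwt, hV1, hV2, ?_⟩
  set d := digitSum α dig v' / α ^ τ with hd
  have hdn : ‖d‖ * (1 + 2 * S) ≤ κ / 4 := by
    have h3 : ‖d‖ ≤ B / q ^ c₁' := by
      rw [hd, norm_div, norm_pow]
      gcongr
      · exact hπ _
      · exact hq1.le
    calc ‖d‖ * (1 + 2 * S) ≤ B / q ^ c₁' * (1 + 2 * S) := by gcongr
      _ = B * (1 + 2 * S) / q ^ c₁' := by ring
      _ ≤ κ / 4 := by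
        rw [div_le_div_iff₀ (by positivity) (by norm_num)]
        linarith
  have hsum : digitSum α dig (v ++ v') - s₀ = σ + d := by
    rw [digitSum_append hα0, hvτ, hσdef]; ring
  have hσ' : ‖σ + d‖ ≤ S := hsum ▸ hσ (v ++ v')
  have hdiff : ‖Q (σ + d) - Q σ‖ ≤ ‖Q σ‖ / 4 := by
    have e1 : Q (σ + d) - Q σ = d * e - (σ + (σ + d)) * d * a := by simp only [hQ]; ring
    rw [e1]
    calc _ ≤ ‖d‖ * ‖e‖ + (‖σ‖ + ‖σ + d‖) * ‖d‖ * ‖a‖ := by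
          refine (norm_sub_le _ _).trans ?_
          rw [norm_mul, norm_mul, norm_mul]
          gcongr
          exact norm_add_le _ _
      _ ≤ ‖d‖ * E + (S + S) * ‖d‖ * E := by gcongr; exact hσ v
      _ = ‖d‖ * (1 + 2 * S) * E := by ring
      _ ≤ κ / 4 * E := by gcongr
      _ ≤ ‖Q σ‖ / 4 := by linarith
  have hlen : (v ++ v').length = τ + i := by rw [List.length_append, hvτ, hv'i]
  rw [hsum, hlen]
  change r₀ ≤ q ^ (τ + i) * ‖Q (σ + d)‖ ∧ q ^ (τ + i) * ‖Q (σ + d)‖ ≤ _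
  have h4 : ‖Q (σ + d)‖ ≤ ‖Q σ‖ + ‖Q σ‖ / 4 := by
    have := norm_add_le (Q σ) (Q (σ + d) - Q σ)
    rw [add_sub_cancel] at this
    linarith
  have h5 : ‖Q σ‖ - ‖Q σ‖ / 4 ≤ ‖Q (σ + d)‖ := by
    have := norm_sub_norm_le (Q σ) (Q (σ + d))
    rw [norm_sub_rev] at hdiff
    linarith
  have hp : 0 < q ^ (τ + i) := by positivity
  have h6 := mul_le_mul_of_nonneg_left h4 hp.le
  have h7 := mul_le_mul_of_nonneg_left h5 hp.le
  have h8 : 0 < q * r₀ := by positivity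
  constructor <;> linarith

namespace ShearSystem

variable {k G₂ X D : Type} [NormedField k] [ProperSpace k] [Group G₂] [TopologicalSpace G₂]
  [IsTopologicalGroup G₂] [TopologicalSpace X] [MulAction (SL(2, k) × G₂) X]
  [ContinuousSMul (SL(2, k) × G₂) X] (S : ShearSystem k G₂ X D)

/-- Return displacements in a compact neighbourhood are uniformly far from unipotent. -/
lemma exists_lower_bound [T2Space X] {C N₀ : Set (SL(2, k) × G₂)} (hC : IsCompact C) (hCN : C ⊆ N₀)
    (hN₀ : ∀ m : ℕ, 1 ≤ m → ∀ x : X, ∀ g ∈ N₀,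
      ((1, S.b ^ m) : SL(2, k) × G₂) • x = g • x → ¬ (g.1 1 0 = 0 ∧ g.1 0 0 = g.1 1 1)) (M : ℕ) :
    ∃ δ : ℝ, 0 < δ ∧ ∀ m < M, 1 ≤ m → ∀ x ∈ S.K, ∀ g ∈ C,
      ((1, S.b ^ m) : SL(2, k) × G₂) • x = g • x → δ ≤ max ‖g.1 1 1 - g.1 0 0‖ ‖g.1 1 0‖ := by
  induction M with
  | zero => exact ⟨1, one_pos, by simp⟩
  | succ M ih =>
    obtain ⟨δ, hδ, h⟩ := ih
    rcases Nat.eq_zero_or_pos M with rfl | hM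
    · exact ⟨1, one_pos, fun m hm h1 => by omega⟩
    set T : Set (X × (SL(2, k) × G₂)) :=
      (S.K ×ˢ C) ∩ {z | ((1, S.b ^ M) : SL(2, k) × G₂) • z.1 = z.2 • z.1} with hT
    have hTc : IsCompact T := by
      refine (S.isCompact_K.prod hC).inter_right (isClosed_eq ?_ ?_) <;> fun_prop
    have ent : ∀ i j, Continuous fun z : X × (SL(2, k) × G₂) => z.2.1 i j := by
      intro i j
      have h1 : Continuous fun g : SL(2, k) => (g : Matrix (Fin 2) (Fin 2) k) :=
        Matrix.SpecialLinearGroup.isClosedEmbedding_val.continuous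
      exact (continuous_apply_apply i j).comp (h1.comp (continuous_fst.comp continuous_snd))
    have hcont : Continuous fun z : X × (SL(2, k) × G₂) =>
        max ‖z.2.1 1 1 - z.2.1 0 0‖ ‖z.2.1 1 0‖ :=
      (((ent 1 1).sub (ent 0 0)).norm).max (ent 1 0).norm
    have hδ' : ∃ δ' : ℝ, 0 < δ' ∧ ∀ z ∈ T, δ' ≤ max ‖z.2.1 1 1 - z.2.1 0 0‖ ‖z.2.1 1 0‖ := by
      rcases T.eq_empty_or_nonempty with h0 | h0
      · exact ⟨1, one_pos, by simp [h0]⟩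
      · obtain ⟨z, hz, hmin⟩ := hTc.exists_isMinOn h0 hcont.continuousOn
        refine ⟨_, ?_, fun z' hz' => hmin hz'⟩
        by_contra! hle
        have h1 := (le_max_left _ _).trans hle
        have h2 := (le_max_right _ _).trans hle
        refine hN₀ M hM z.1 z.2 (hCN hz.1.2) hz.2 ⟨norm_le_zero_iff.1 h2, ?_⟩
        exact (sub_eq_zero.1 (norm_le_zero_iff.1 h1)).symm
    obtain ⟨δ', hδ', h'⟩ := hδ'
    refine ⟨min δ δ', lt_min hδ hδ', fun m hm h1 x hx g hg heq => ?_⟩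
    rcases (Nat.lt_succ_iff.1 hm).lt_or_eq with h2 | rfl
    · exact (min_le_left _ _).trans (h m h2 h1 x hx g hg heq)
    · exact (min_le_right _ _).trans (h' (x, g) ⟨⟨hx, hg⟩, heq⟩)

/-- Among many points of `K` two are close. -/
lemma exists_close_pair {N : Set (SL(2, k) × G₂)} (hN : N ∈ 𝓝 1) : ∃ M : ℕ, ∀ (A : Finset ℕ)
    (y : ℕ → X), M < A.card → (∀ m ∈ A, y m ∈ S.K) →
    ∃ m₁ ∈ A, ∃ m₂ ∈ A, m₁ < m₂ ∧ ∃ g ∈ N, y m₂ = g • y m₁ := by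
  obtain ⟨U, hU, hUN⟩ := exists_nhds_split_inv hN
  obtain ⟨t, -, ht⟩ := S.isCompact_K.elim_nhds_subcover
    (fun x => (fun g : SL(2, k) × G₂ => g • x) '' U) fun x _ => S.orb x U hU
  refine ⟨t.card, fun A y hA hy => ?_⟩
  have h1 : ∀ m : ℕ, ∃ x : X, m ∈ A → x ∈ t ∧ ∃ g ∈ U, g • x = y m := by
    intro m
    by_cases hm : m ∈ A
    · obtain ⟨x, hx, g, hg, h⟩ := mem_iUnion₂.1 (ht (hy m hm))
      exact ⟨x, fun _ => ⟨hx, g, hg, h⟩⟩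
    · exact ⟨y 0, fun h => absurd h hm⟩
  choose f hf using h1
  obtain ⟨a, ha, b, hb, hab, hfab⟩ :=
    Finset.exists_ne_map_eq_of_card_lt_of_maps_to hA (f := f) fun m hm => (hf m hm).1
  have key : ∀ a ∈ A, ∀ b ∈ A, f a = f b → ∃ g ∈ N, y b = g • y a := by
    intro a ha b hb hfab
    obtain ⟨_, g, hg, h⟩ := hf a ha
    obtain ⟨_, g', hg', h'⟩ := hf b hb
    refine ⟨g' / g, hUN _ hg' _ hg, ?_⟩
    rw [← h, ← h', hfab, div_eq_mul_inv, mul_smul, inv_smul_smul]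
  rcases lt_or_gt_of_ne hab with h | h
  · exact ⟨a, ha, b, hb, h, key a ha b hb hfab⟩
  · exact ⟨b, hb, a, ha, h, key b hb a ha hfab.symm⟩

end ShearSystem

namespace ShearSystem

variable {k G₂ X D : Type} [NormedField k] [ProperSpace k] [Group G₂] [TopologicalSpace G₂]
  [IsTopologicalGroup G₂] [TopologicalSpace X] [MulAction (SL(2, k) × G₂) X]
  [ContinuousSMul (SL(2, k) × G₂) X] (S : ShearSystem k G₂ X D)

lemma return_conj (y : X) (w v : List D) (m : ℕ) (g : SL(2, k) × G₂)
    (h : ((1, S.b ^ m) : SL(2, k) × G₂) • S.tree.follow y w = g • S.tree.follow y w)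
    {P : SL(2, k)} (hP : P = dia S.l ^ v.length *
      unip (digitSum S.α S.dig v - digitSum S.α S.dig w) * (dia S.l ^ w.length)⁻¹) :
    ((1, S.b ^ m) : SL(2, k) × G₂) • S.tree.follow y v =
      ((P * g.1 * P⁻¹, g.2) : SL(2, k) × G₂) • S.tree.follow y v := by
  have hPv : S.tree.follow y v = ((P, 1) : SL(2, k) × G₂) • S.tree.follow y w := by
    rw [S.tree_follow, S.tree_follow, ← mul_smul, hP]
    congr 1
    rw [Prod.mk_mul_mk, mul_one]
    congr 1
    rw [mul_assoc, inv_mul_cancel_left, mul_assoc, ← unip_add, sub_add_cancel]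
  rw [hPv, ← S.first_smul_b, h, ← mul_smul, ← mul_smul]
  congr 1
  obtain ⟨g1, g2⟩ := g
  simp

open Classical in
/-- There is no substationary measure without concentration on a shear system. -/
theorem false_of_substationary [Fintype D] [T2Space X] [SecondCountableTopology X]
    [FirstCountableTopology G₂] [LocallyCompactSpace (SL(2, k) × G₂)]
    {P : Measure S.tree.State} [IsProbabilityMeasure P] (hP : S.tree.chain.Substationary P)
    (hNC : ∀ η : ℝ≥0∞, η ≠ 0 → ∀ ε : ℝ≥0∞, ε ≠ 0 → ∃ n₀, ∀ n ≥ n₀,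
      P {ω | ∃ w : List D, w.length = n ∧ η < S.tree.chain.wt ω w} < ε) : False := by
  borelize X
  set c := S.tree.chain with hc
  set q := ‖S.α‖ with hq
  have hq2 : 2 ≤ q := S.two_le
  have hq1 : 1 < q := by linarith
  have hq0 : 0 < q := by linarith
  obtain ⟨r₀, hr₀, hobs⟩ := S.exists_obstruction
  set B : ℝ := ∑ d, ‖S.dig d‖ with hB
  have hB0 : 0 ≤ B := Finset.sum_nonneg fun _ _ => norm_nonneg _
  have hdig : ∀ d, ‖S.dig d‖ ≤ B := fun d =>
    Finset.single_le_sum (f := fun d => ‖S.dig d‖) (fun _ _ => norm_nonneg _) (Finset.mem_univ d)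
  obtain ⟨η, hη, hword⟩ := exists_shear_word (Ω := S.tree.State) (α := S.α) hq2 S.dig hB0 hdig S.sep
  obtain ⟨c₀, hc₀⟩ := hNC η hη (ENNReal.ofReal (1 / 256)) (by simp)
  have hc₀ := hc₀ c₀ le_rfl
  set Z : Set S.tree.State := {ω | ∃ w : List D, w.length = c₀ ∧ η < c.wt ω w} with hZ
  have hZm : MeasurableSet Z := c.measurableSet_concentrated c₀ η
  obtain ⟨N, hN⟩ := hword c₀
  obtain ⟨R, hR, c₁, hshear⟩ := hN r₀ hr₀
  set pt : S.tree.State → X := fun ω => ω.1.1 with hpt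
  have ptK : ∀ ω : S.tree.State, ω.1.1 ∈ S.K := fun ω => TreeSystem.point_mem (s := S.tree) ω
  have hptm : Measurable pt := TreeSystem.continuous_point.measurable
  have : IsFiniteMeasure (P.map pt) := inferInstance
  obtain ⟨V, hV, hVP, ϑ, hϑ, N₂, hN₂, hno⟩ := hobs (P.map pt)
    (ENNReal.ofReal (1 / (1024 * (N + 1)))) (by simp; positivity)
  rw [Measure.map_apply hptm hV] at hVP
  set V' := pt ⁻¹' V with hV'
  have hV'm : MeasurableSet V' := hptm hV
  have h_integral : ∫⁻ ω, c.hit V' N ω ∂P ≤ ENNReal.ofReal (1 / 1024) := by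
    refine (hP.lintegral_hit_le hV'm N).trans ?_
    calc (N : ℝ≥0∞) * P V' ≤ ENNReal.ofReal N * ENNReal.ofReal (1 / (1024 * (N + 1))) := by
          rw [ENNReal.ofReal_natCast]; gcongr
      _ = ENNReal.ofReal (N * (1 / (1024 * (N + 1)))) := (ENNReal.ofReal_mul (by positivity)).symm
      _ ≤ _ := by
        apply ENNReal.ofReal_le_ofReal
        rw [mul_one_div, div_le_div_iff₀ (by positivity) (by norm_num)]
        linarith
  have hsmall : 4 * (P Z + (1 / 8 : ℝ≥0∞)⁻¹ * ∫⁻ ω, c.hit V' N ω ∂P) < ENNReal.ofReal (1 / 16) := by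
    have e8 : (1 / 8 : ℝ≥0∞)⁻¹ = ENNReal.ofReal 8 := by simp
    have e4 : (4 : ℝ≥0∞) = ENNReal.ofReal 4 := by simp
    rw [e8, e4]
    calc _ ≤ ENNReal.ofReal 4 * (ENNReal.ofReal (1 / 256) +
          ENNReal.ofReal 8 * ENNReal.ofReal (1 / 1024)) := by gcongr
      _ = ENNReal.ofReal (4 * (1 / 256 + 8 * (1 / 1024))) := by
        rw [← ENNReal.ofReal_mul (by norm_num), ← ENNReal.ofReal_add (by norm_num) (by norm_num),
          ← ENNReal.ofReal_mul (by norm_num)]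
      _ < _ := by
        rw [ENNReal.ofReal_lt_ofReal_iff (by norm_num)]; norm_num
  set ηs : ℝ := min (R / q ^ c₁) (ϑ / (2 * (1 + 2 * B))) with hηs
  have hηs0 : 0 < ηs := lt_min (by positivity) (by positivity)
  have hηsR : ηs * q ^ c₁ ≤ R := by
    rw [← le_div_iff₀ (by positivity)]; exact min_le_left _ _
  have hηsR' : ηs ≤ R := by
    refine le_trans ?_ hηsR
    exact le_mul_of_one_le_right hηs0.le (one_le_pow₀ hq1.le)
  have hηsϑ : ηs * (1 + 2 * B) ≤ ϑ / 2 := by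
    calc ηs * (1 + 2 * B) ≤ ϑ / (2 * (1 + 2 * B)) * (1 + 2 * B) := by
          gcongr; exact min_le_right _ _
      _ = ϑ / 2 := by field_simp
  obtain ⟨k₀, hwin⟩ := exists_window hq1 hηs0 hR
  obtain ⟨θ₀, hθ₀, hwin⟩ := hwin (2 * k₀)
  set θ : ℝ := min (θ₀ / 2) (ϑ / 2) with hθ
  have hθ0 : 0 < θ := lt_min (by positivity) (by positivity)
  obtain ⟨N₀, hN₀, hnon⟩ := S.nonunip
  obtain ⟨C, hC1, hCN, hCc⟩ := LocallyCompactSpace.local_compact_nhds 1 _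
    (inter_mem (nhds_one_SL hθ0 hN₂) hN₀)
  obtain ⟨M₀, hpair⟩ := S.exists_close_pair hC1
  obtain ⟨δ, hδ, hlow⟩ := S.exists_lower_bound hCc (hCN.trans inter_subset_right) hnon (2 * M₀ + 2)
  obtain ⟨J₁, hwin⟩ := hwin δ hδ
  obtain ⟨ω, w, n, hwl, hwt, hHn, hnH, hcount⟩ := hP.exists_goodEnd hZm (c.measurable_hit hV'm N)
    (ε := 1 / 8) (by simp) (by simp) (ζ := 1 / 16) (by norm_num) hsmall (H := J₁ + 1)
    (M := 2 * M₀ + 2) (by omega) (by omega)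
  obtain ⟨m₁, hm₁, m₂, hm₂, hm12, g, hg, hgy⟩ := hpair
    ((Finset.range (2 * M₀ + 2)).filter fun m =>
      c.GoodEnd Z (c.hit V' N) (1 / 8) (1 / 16) (J₁ + 1) (c.b^[m] ω) w n)
    (fun m => (c.run (c.b^[m] ω) (w.take n)).1.1) (by omega)
    (fun m _ => ptK _)
  rw [Finset.mem_filter, Finset.mem_range] at hm₁ hm₂
  set m := m₂ - m₁ with hm
  have hm1 : 1 ≤ m := by omega
  set ω₁ := c.b^[m₁] ω with hω₁
  have hω₂ : c.b^[m₂] ω = c.b^[m] ω₁ := by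
    rw [hω₁, ← Function.iterate_add_apply]; congr; omega
  have good₁ := hm₁.2
  have good₂ := hm₂.2
  rw [hω₂] at good₂ hgy
  have bpt : ∀ ω : S.tree.State, (c.b^[m] ω).1.1 = ((1, S.b ^ m) : SL(2, k) × G₂) • ω.1.1 :=
    fun ω => by rw [hc, TreeSystem.b_iterate_point, S.tree_b_iterate]
  rw [c.run_b_iter, bpt] at hgy
  have hwt₁ : c.wt ω₁ w ≠ 0 := by rwa [hω₁, c.wt_b_iter]
  set yn := (c.run ω₁ (w.take n)).1.1 with hyn
  obtain ⟨⟨hent, hg2⟩, hgN₀⟩ := hCN hg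
  have hδE := hlow m (by omega) hm1 yn (ptK _) g hg hgy
  set E : ℕ → ℝ := fun j => max ‖g.1 1 1 - g.1 0 0‖ (‖g.1 1 0‖ * q ^ j) with hE
  have h00 : ‖g.1 0 0 - 1‖ ≤ θ := by simpa using hent 0 0
  have h11 : ‖g.1 1 1 - 1‖ ≤ θ := by simpa using hent 1 1
  have h01 : ‖g.1 0 1‖ ≤ θ := by simpa using hent 0 1
  have h10 : ‖g.1 1 0‖ ≤ θ := by simpa using hent 1 0
  have hθθ₀ : θ ≤ θ₀ / 2 := min_le_left _ _
  have hθϑ : θ ≤ ϑ / 2 := min_le_right _ _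
  have hE0 : δ ≤ E 0 := by simpa [hE] using hδE
  have hEmono : Monotone E := by
    intro i j hij
    simp only [hE]
    gcongr
    exact hq1.le
  have hEpos : ∀ j, 0 < E j := fun j => (hδ.trans_le hE0).trans_le (hEmono (Nat.zero_le j))
  obtain ⟨j₂, hkj, hjJ, hwin⟩ := hwin E ‖g.1 0 1‖ hEmono (fun j => by
      simp only [hE]
      refine max_le ?_ ?_
      · exact (le_mul_of_one_le_left (norm_nonneg _) hq1.le).trans
          (mul_le_mul_of_nonneg_left (le_max_left _ _) hq0.le)
      · calc ‖g.1 1 0‖ * q ^ (j + 1) = q * (‖g.1 1 0‖ * q ^ j) := by ring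
          _ ≤ _ := mul_le_mul_of_nonneg_left (le_max_right _ _) hq0.le) hE0 (by
      simp only [hE, pow_zero, mul_one]
      refine max_le ?_ (by linarith)
      calc ‖g.1 1 1 - g.1 0 0‖ = ‖(g.1 1 1 - 1) - (g.1 0 0 - 1)‖ := by congr 1; ring
        _ ≤ θ + θ := (norm_sub_le _ _).trans (add_le_add h11 h00)
        _ ≤ θ₀ := by linarith) (norm_nonneg _) (by linarith)
  set τ : ℕ → ℕ := fun j => level q R (E j) with hτ
  obtain ⟨j, hj1, hj2, hb1, hb2, hb3⟩ := exists_common_good (n := n) (j₂ := j₂) (k₀ := k₀)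
    (by omega) hkj (good₁ (j₂ + 1) (by omega) (by omega)) (good₁ (j₂ + 1) (by omega) (by omega))
    (good₂ (j₂ + 1) (by omega) (by omega)) (τ := τ)
    (fun j h1 h2 => level_le hq1 (hEpos j) ((hwin j h1 h2).1.trans hηsR') (hwin j h1 h2).2.2)
    (fun j h1 j' h2 hjj' => level_anti hq1 (hEpos j) (hEmono hjj'.le)
      ((hwin j' (by omega) h2).1.trans hηsR'))
  obtain ⟨hEη, hBE, hRE⟩ := hwin j hj1 hj2
  have hτj : τ j ≤ j := level_le hq1 (hEpos j) (hEη.trans hηsR') hRE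
  set t := n - j with ht
  set ωt := c.run ω₁ (w.take t) with hωt
  have hηt : ∀ u : List D, u.length = c₀ → c.wt ωt u ≤ η := by
    intro u hu
    by_contra! hlt
    exact hb1 (Or.inl ⟨u, hu, hlt⟩)
  have hx1 := c.expect_le_of_not_peak (T := t + τ j) (by omega) (fun h => hb2 (Or.inr h))
    (Nat.le_add_right t _)
  have hx2 := c.expect_le_of_not_peak (T := t + τ j) (by omega) (fun h => hb3 (Or.inr h))
    (Nat.le_add_right t _)
  rw [Nat.add_sub_cancel_left] at hx1 hx2
  rw [c.run_b_iter] at hx2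
  set tail := (w.take n).drop t with htail
  have htl : tail.length = j := by rw [htail, List.length_drop, List.length_take]; omega
  have hsplit : w.take n = w.take t ++ tail := by
    conv_lhs => rw [← List.take_append_drop t (w.take n), List.take_take, min_eq_left (by omega)]
  have hwtn : c.wt ω₁ (w.take n) ≠ 0 := by
    rw [← List.take_append_drop n w, c.wt_append] at hwt₁
    exact left_ne_zero_of_mul hwt₁
  rw [hsplit, c.wt_append] at hwtn
  have hwtt := right_ne_zero_of_mul hwtn
  have hynf : yn = S.tree.follow ωt.1.1 tail := by
    rw [hyn, hsplit, c.run_append]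
    exact TreeSystem.run_point hwtt
  obtain ⟨v, hv, hvV, hvV', hlo, hhi⟩ := hshear c V' ωt m (g.1 0 1 / S.α ^ j)
    (g.1 1 1 - g.1 0 0) (g.1 1 0 * S.α ^ j) (digitSum S.α S.dig tail) (E j)
    (norm_digitSum_le hq2 hB0 hdig _) (hEpos j) (hEη.trans hηsR')
    (le_level hq1 (hEpos j) (hEη.trans hηsR') (by
      rw [mul_comm]; exact (mul_le_mul_of_nonneg_right hEη (by positivity)).trans hηsR))
    (by rw [norm_mul, norm_pow]; exact (le_max_iff.1 (le_refl (E j)))) (le_max_left _ _)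
    (by rw [norm_mul, norm_pow]; exact le_max_right _ _)
    (by rw [norm_div, norm_pow, div_le_iff₀ (by positivity)]; exact hBE) hηt hx1 hx2
  have hrun : (c.run ωt v).1.1 = S.tree.follow ωt.1.1 v := TreeSystem.run_point hv
  rw [hynf] at hgy
  set σ := digitSum S.α S.dig v - digitSum S.α S.dig tail with hσ
  have hconj := S.return_conj ωt.1.1 tail v m g hgy rfl
  obtain ⟨e00, e11, e10, e01⟩ := conj_entries S.l v.length tail.length σ g.1 rfl
  set Q : SL(2, k) := dia S.l ^ v.length * unip σ * (dia S.l ^ tail.length)⁻¹ with hQ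
  have hσn : ‖σ‖ ≤ 2 * B := (norm_sub_le _ _).trans (by
    linarith [norm_digitSum_le hq2 hB0 hdig v, norm_digitSum_le hq2 hB0 hdig tail])
  have ha : ‖g.1 1 0 * ((S.l : k) ^ 2) ^ tail.length‖ ≤ ηs := by
    rw [htl, norm_mul, norm_pow]; exact (le_max_right _ _).trans hEη
  have hσa : ‖σ * (g.1 1 0 * ((S.l : k) ^ 2) ^ tail.length)‖ ≤ 2 * B * ηs := by
    rw [norm_mul]; gcongr
  have hval : ‖(Q * g.1 * Q⁻¹) 0 1‖ = q ^ v.length * ‖g.1 0 1 / S.α ^ j + σ * (g.1 1 1 - g.1 0 0)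
      - σ ^ 2 * (g.1 1 0 * S.α ^ j)‖ := by
    rw [e01, htl, norm_mul, norm_pow]; rfl
  refine hno m (c.run ωt v).1.1 (ptK _) hvV ?_ (Q * g.1 * Q⁻¹) g.2 hg2 ?_ ?_ ?_ ?_
    ?_ ?_
  · rw [← bpt, ← c.run_b_iter]; exact hvV'
  · rw [hrun]; exact hconj
  · rw [e00, add_sub_right_comm]
    refine (norm_add_le _ _).trans ?_
    linarith
  · rw [e11, sub_right_comm]
    refine (norm_sub_le _ _).trans ?_
    linarith
  · rw [e10, norm_div, norm_pow]
    refine (div_le_self (norm_nonneg _) (one_le_pow₀ hq1.le)).trans (ha.trans ?_)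
    nlinarith
  · rw [hval]; exact hlo
  · rw [hval]; exact hhi

end ShearSystem

namespace ShearSystem

variable {k G₂ X D : Type} [NormedField k] [ProperSpace k] [Group G₂] [TopologicalSpace G₂]
  [IsTopologicalGroup G₂] [TopologicalSpace X] [MulAction (SL(2, k) × G₂) X]
  [ContinuousSMul (SL(2, k) × G₂) X] (S : ShearSystem k G₂ X D)

/-- Unipotent orbits meet `Y` in a set of subexponential complexity. -/
theorem not_rich [Fintype D] [T2Space X] [SecondCountableTopology X]
    [FirstCountableTopology G₂] [LocallyCompactSpace (SL(2, k) × G₂)]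
    {cell : Set k} (hcell : ∀ s ∈ cell, ‖s‖ ≤ 1)
    (hdigit : ∀ s ∈ cell, ∃ d, S.α * s - S.dig d ∈ cell) {δ : ℝ} (hδ : 0 < δ) :
    ¬ ∀ N : ℕ, ∃ n ≥ N, ∃ x : X, ∃ F : Finset k, Real.exp (δ * n) ≤ F.card ∧
      (∀ s ∈ F, s ∈ cell ∧ (u s : SL(2, k) × G₂) • x ∈ S.Y) ∧
      ∀ s ∈ F, ∀ s' ∈ F, s ≠ s' → 2 / ‖S.α‖ ^ n < ‖s - s'‖ := by
  classical
  intro hrich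
  have hα := S.α_ne_zero
  have : ∀ s : k, ∃ d : D, s ∈ cell → S.α * s - S.dig d ∈ cell := by
    obtain ⟨n, -, x, F, hF, hF', -⟩ := hrich 0
    have hne : F.Nonempty := by
      rw [← Finset.card_pos]
      have := (Real.exp_pos (δ * n)).trans_le hF
      exact_mod_cast this
    obtain ⟨s₀, hs₀⟩ := hne
    obtain ⟨d₀, -⟩ := hdigit s₀ (hF' s₀ hs₀).1
    intro s
    by_cases hs : s ∈ cell
    · obtain ⟨d, hd⟩ := hdigit s hs
      exact ⟨d, fun _ => hd⟩
    · exact ⟨d₀, fun h => absurd h hs⟩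
  choose dg hdg using this
  set sq : k → ℕ → k := fun s t => (fun s => S.α * s - S.dig (dg s))^[t] s with hsq
  set ξ : k → ℕ → D := fun s t => dg (sq s t) with hξ
  have sq_succ : ∀ s t, sq s (t + 1) = S.α * sq s t - S.dig (ξ s t) := by
    intro s t; simp only [hsq, hξ, Function.iterate_succ_apply']
  have sq_mem : ∀ s ∈ cell, ∀ t, sq s t ∈ cell := by
    intro s hs t
    induction t with
    | zero => exact hs
    | succ t ih => rw [sq_succ]; exact hdg _ ih
  have hpi : ∀ s t, digitSum S.α S.dig (TreeSystem.pre (ξ s) t) = s - sq s t / S.α ^ t := by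
    intro s t
    induction t with
    | zero => simp [TreeSystem.pre, digitSum, hsq]
    | succ t ih =>
      have : TreeSystem.pre (ξ s) (t + 1) = TreeSystem.pre (ξ s) t ++ [ξ s t] := by
        simp [TreeSystem.pre, List.range_succ]
      rw [this, digitSum_append hα, ih, sq_succ]
      simp only [digitSum, TreeSystem.pre, List.length_map, List.length_range]
      field_simp
      ring
  have hfollow : ∀ s x t, (u s : SL(2, k) × G₂) • x ∈ S.Y → s ∈ cell →
      S.tree.follow x (TreeSystem.pre (ξ s) t) ∈ S.K := by
    intro s x t hY hs
    refine ⟨sq s t, hcell _ (sq_mem s hs t), ?_⟩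
    have hl : (TreeSystem.pre (ξ s) t).length = t := by simp [TreeSystem.pre]
    rw [S.tree_follow, hpi, hl]
    have e : (u (sq s t) : SL(2, k) × G₂) * (dia S.l ^ t * unip (s - sq s t / S.α ^ t), 1) =
        (dia S.l ^ t, 1) * u s := by
      rw [u, u, Prod.mk_mul_mk, Prod.mk_mul_mk]
      congr 1
      rw [dia_pow_mul_unip, dia_pow_mul_unip, ← mul_assoc, ← unip_add]
      congr 2
      change _ + S.α ^ t * _ = S.α ^ t * _
      field_simp
      ring
    rw [← mul_smul, e, mul_smul, S.a_pow_mem]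
    exact hY
  obtain ⟨P, hPp, hP, hNC⟩ := S.tree.exists_substationary hδ (fun N => by
    obtain ⟨n, hn, x, F, hF, hFY, hsep⟩ := hrich N
    have hinj : ∀ s ∈ F, ∀ s' ∈ F, TreeSystem.pre (ξ s) n = TreeSystem.pre (ξ s') n → s = s' := by
      intro s hs s' hs' h
      by_contra hne
      have h1 := hsep s hs s' hs' hne
      have h2 : s - s' = (sq s n - sq s' n) / S.α ^ n := by
        have e1 := hpi s n
        rw [h, hpi s' n] at e1
        rw [sub_div]
        linear_combination -e1
      rw [h2, norm_div, norm_pow] at h1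
      have h3 : ‖sq s n - sq s' n‖ ≤ 2 := (norm_sub_le _ _).trans (by
        linarith [hcell _ (sq_mem s (hFY s hs).1 n), hcell _ (sq_mem s' (hFY s' hs').1 n)])
      have h4 : 0 < ‖S.α‖ ^ n := by positivity
      exact absurd h1 (not_lt.2 (by gcongr))
    refine ⟨n, hn, x, F.image ξ, ?_, ?_, ?_⟩
    · rw [Finset.card_image_of_injOn fun s hs s' hs' h => hinj s hs s' hs' (by rw [h])]
      exact hF
    · simp only [Finset.mem_image]
      rintro _ ⟨s, hs, rfl⟩ t
      exact hfollow s x t (hFY s hs).2 (hFY s hs).1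
    · intro a ha b hb h
      simp only [Finset.coe_image, mem_image] at ha hb
      obtain ⟨s, hs, rfl⟩ := ha
      obtain ⟨s', hs', rfl⟩ := hb
      rw [hinj s hs s' hs' h])
  exact S.false_of_substationary hP hNC

end ShearSystem

/-- Two embeddings of a ring into normed fields for which the product of the two absolute values
of a nonzero element is at least one, together with expanding units. -/
structure ArithPair (k₁ k₂ R : Type) [NormedField k₁] [NormedField k₂] [CommRing R] where
  φ₁ : R →+* k₁
  φ₂ : R →+* k₂
  one_le : ∀ r : R, r ≠ 0 → 1 ≤ ‖φ₁ r‖ * ‖φ₂ r‖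
  l₁ : k₁ˣ
  l₂ : k₂ˣ
  two_le₁ : 2 ≤ ‖(l₁ : k₁)‖
  two_le₂ : 2 ≤ ‖(l₂ : k₂)‖

namespace ArithPair

variable {k₁ k₂ R : Type} [NormedField k₁] [NormedField k₂] [CommRing R]

/-- Exchange the two embeddings. -/
def swap (P : ArithPair k₁ k₂ R) : ArithPair k₂ k₁ R where
  φ₁ := P.φ₂
  φ₂ := P.φ₁
  one_le r hr := by rw [mul_comm]; exact P.one_le r hr
  l₁ := P.l₂
  l₂ := P.l₁
  two_le₁ := P.two_le₂
  two_le₂ := P.two_le₁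

variable (P : ArithPair k₁ k₂ R)

lemma φ₁_injective : Function.Injective P.φ₁ := by
  rw [injective_iff_map_eq_zero]
  intro r hr
  by_contra h
  have := P.one_le r h
  rw [hr] at this
  norm_num at this

lemma eq_zero_of_norm_lt {r : R} (h₁ : ‖P.φ₁ r‖ ≤ 1 / 2) (h₂ : ‖P.φ₂ r‖ ≤ 1 / 2) : r = 0 := by
  by_contra h
  nlinarith [P.one_le r h, norm_nonneg (P.φ₁ r), norm_nonneg (P.φ₂ r)]

/-- The diagonal embedding of `SL₂(R)`. -/
def emb : SL(2, R) →* SL(2, k₁) × SL(2, k₂) :=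
  (Matrix.SpecialLinearGroup.map P.φ₁).prod (Matrix.SpecialLinearGroup.map P.φ₂)

/-- The arithmetic lattice. -/
def lattice : Subgroup (SL(2, k₁) × SL(2, k₂)) := P.emb.range

lemma emb_fst_apply (γ : SL(2, R)) (i j : Fin 2) : (P.emb γ).1 i j = P.φ₁ (γ i j) := rfl

lemma emb_snd_apply (γ : SL(2, R)) (i j : Fin 2) : (P.emb γ).2 i j = P.φ₂ (γ i j) := rfl

lemma nhds_one_SL_prod {ϑ : ℝ} (hϑ : 0 < ϑ) : {g : SL(2, k₁) × SL(2, k₂) |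
    (∀ i j, ‖g.1 i j - (1 : Matrix (Fin 2) (Fin 2) k₁) i j‖ ≤ ϑ) ∧
    ∀ i j, ‖g.2 i j - (1 : Matrix (Fin 2) (Fin 2) k₂) i j‖ ≤ ϑ} ∈
    𝓝 (1 : SL(2, k₁) × SL(2, k₂)) := by
  have h := nhds_one_SL (k := k₂) (G₂ := SL(2, k₁)) hϑ (univ_mem : univ ∈ 𝓝 (1 : SL(2, k₁)))
  have hs : Continuous (Prod.swap : SL(2, k₁) × SL(2, k₂) → SL(2, k₂) × SL(2, k₁)) :=
    continuous_swap
  have h' := nhds_one_SL (k := k₁) (G₂ := SL(2, k₂)) hϑ (univ_mem : univ ∈ 𝓝 (1 : SL(2, k₂)))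
  filter_upwards [h', hs.continuousAt.preimage_mem_nhds h] with g hg hg'
  exact ⟨hg.1, hg'.1⟩

instance discreteTopology_lattice : DiscreteTopology P.lattice := by
  apply discreteTopology_of_isOpen_singleton_one
  rw [isOpen_iff_mem_nhds]
  rintro _ rfl
  have h := nhds_one_SL_prod (k₁ := k₁) (k₂ := k₂) (ϑ := 1 / 2) (by norm_num)
  have hc : ContinuousAt (Subtype.val : P.lattice → _) 1 := continuous_subtype_val.continuousAt
  filter_upwards [hc.preimage_mem_nhds h] with g hg
  obtain ⟨_, γ, rfl⟩ := g
  have : γ = 1 := by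
    ext i j
    have h1 := hg.1 i j
    have h2 := hg.2 i j
    rw [← sub_eq_zero]
    apply P.eq_zero_of_norm_lt
    · rw [map_sub]
      convert h1 using 3
      · rfl
      · rw [Matrix.SpecialLinearGroup.coe_one, Matrix.one_apply, Matrix.one_apply]
        split_ifs <;> simp
    · rw [map_sub]
      convert h2 using 3
      · rfl
      · rw [Matrix.SpecialLinearGroup.coe_one, Matrix.one_apply, Matrix.one_apply]
        split_ifs <;> simp
  subst this
  simp

/-- The homogeneous space attached to an arithmetic pair. -/
abbrev Quot : Type := (SL(2, k₁) × SL(2, k₂)) ⧸ P.lattice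

instance t2Space_quot : T2Space P.Quot := by
  have : IsClosed (P.lattice : Set (SL(2, k₁) × SL(2, k₂))) := Subgroup.isClosed_of_discrete
  infer_instance

lemma secondCountable_SL {k : Type} [NormedField k] [SecondCountableTopology k] :
    SecondCountableTopology SL(2, k) := by
  have : SecondCountableTopology (Matrix (Fin 2) (Fin 2) k) :=
    inferInstanceAs (SecondCountableTopology (Fin 2 → Fin 2 → k))
  exact Matrix.SpecialLinearGroup.isClosedEmbedding_val.isInducing.secondCountableTopology

instance secondCountable_quot [SecondCountableTopology k₁] [SecondCountableTopology k₂] :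
    SecondCountableTopology P.Quot := by
  have := secondCountable_SL (k := k₁)
  have := secondCountable_SL (k := k₂)
  infer_instance

lemma locallyCompact_SL {k : Type} [NormedField k] [ProperSpace k] :
    LocallyCompactSpace SL(2, k) := by
  have : LocallyCompactSpace (Matrix (Fin 2) (Fin 2) k) :=
    inferInstanceAs (LocallyCompactSpace (Fin 2 → Fin 2 → k))
  exact Matrix.SpecialLinearGroup.isClosedEmbedding_val.locallyCompactSpace

/-- Every orbit map is open at the identity. -/
lemma image_smul_mem_nhds (x : P.Quot) {N : Set (SL(2, k₁) × SL(2, k₂))}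
    (hN : N ∈ 𝓝 (1 : SL(2, k₁) × SL(2, k₂))) :
    (fun g : SL(2, k₁) × SL(2, k₂) => g • x) '' N ∈ 𝓝 x := by
  obtain ⟨h, rfl⟩ := QuotientGroup.mk_surjective x
  have hopen : IsOpenMap (fun g : SL(2, k₁) × SL(2, k₂) =>
      g • (QuotientGroup.mk h : P.Quot)) := by
    have h1 : (fun g : SL(2, k₁) × SL(2, k₂) => g • (QuotientGroup.mk h : P.Quot)) =
        (QuotientGroup.mk : _ → P.Quot) ∘ fun g => g * h := rfl
    rw [h1]
    exact QuotientGroup.isOpenMap_coe.comp (isOpenMap_mul_right h)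
  simpa using hopen.image_mem_nhds hN

/-- Matrices with bounded entries. -/
def box (k₁ k₂ : Type) [NormedField k₁] [NormedField k₂] (C : ℝ) :
    Set (SL(2, k₁) × SL(2, k₂)) :=
  {g | ∀ i j, ‖g.1 i j‖ ≤ C ∧ ‖g.2 i j‖ ≤ C}

lemma isCompact_boundedEntries {k : Type} [NormedField k] [ProperSpace k] (C : ℝ) :
    IsCompact {g : SL(2, k) | ∀ i j, ‖g i j‖ ≤ C} := by
  have h1 : IsCompact (univ.pi fun _ : Fin 2 => univ.pi fun _ : Fin 2 =>
      Metric.closedBall (0 : k) C) :=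
    isCompact_univ_pi fun _ => isCompact_univ_pi fun _ => isCompact_closedBall _ _
  have h2 : {g : SL(2, k) | ∀ i j, ‖g i j‖ ≤ C} = (fun g : SL(2, k) => g.val) ⁻¹'
      (univ.pi fun _ : Fin 2 => univ.pi fun _ : Fin 2 => Metric.closedBall (0 : k) C) := by
    ext g
    change (∀ i j, ‖g i j‖ ≤ C) ↔ ∀ i ∈ univ, ∀ j ∈ univ, g.val i j ∈ Metric.closedBall (0 : k) C
    simp
  rw [h2]
  exact Matrix.SpecialLinearGroup.isClosedEmbedding_val.isCompact_preimage h1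

lemma isCompact_box [ProperSpace k₁] [ProperSpace k₂] (C : ℝ) : IsCompact (box k₁ k₂ C) := by
  convert (isCompact_boundedEntries (k := k₁) C).prod (isCompact_boundedEntries (k := k₂) C)
    using 1
  ext g
  simp only [box, mem_ofPred_eq, mem_prod]
  exact ⟨fun h => ⟨fun i j => (h i j).1, fun i j => (h i j).2⟩,
    fun h i j => ⟨h.1 i j, h.2 i j⟩⟩

/-- The points represented by a matrix with bounded entries. -/
def thick (C : ℝ) : Set P.Quot := QuotientGroup.mk '' box k₁ k₂ C

lemma isCompact_thick [ProperSpace k₁] [ProperSpace k₂] (C : ℝ) : IsCompact (P.thick C) :=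
  (isCompact_box C).image QuotientGroup.continuous_mk

/-- An element of the diagonal subgroup. -/
def diag (n m : ℤ) : SL(2, k₁) × SL(2, k₂) := (dia P.l₁ ^ n, dia P.l₂ ^ m)

lemma diag_add (n m n' m' : ℤ) : P.diag (n + n') (m + m') = P.diag n m * P.diag n' m' := by
  simp [diag, zpow_add]

lemma diag_zero : P.diag 0 0 = 1 := by simp [diag]

/-- The points whose whole diagonal orbit is bounded. -/
def bdd (C : ℝ) : Set P.Quot := {x | ∀ n m : ℤ, P.diag n m • x ∈ P.thick C}

lemma isCompact_bdd [ProperSpace k₁] [ProperSpace k₂] (C : ℝ) : IsCompact (P.bdd C) := by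
  have h : P.bdd C = ⋂ n : ℤ, ⋂ m : ℤ, (fun x => P.diag n m • x) ⁻¹' P.thick C := by
    ext x; simp [bdd]
  refine (P.isCompact_thick C).of_isClosed_subset ?_ fun x hx => ?_
  · rw [h]
    exact isClosed_iInter fun n => isClosed_iInter fun m =>
      (P.isCompact_thick C).isClosed.preimage (continuous_const_smul _)
  · simpa [diag_zero] using hx 0 0

lemma diag_smul_mem_bdd {C : ℝ} (n m : ℤ) (x : P.Quot) :
    P.diag n m • x ∈ P.bdd C ↔ x ∈ P.bdd C := by
  constructor
  · intro h n' m'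
    have := h (n' - n) (m' - m)
    rwa [← mul_smul, ← diag_add, sub_add_cancel, sub_add_cancel] at this
  · intro h n' m'
    rw [← mul_smul, ← diag_add]
    exact h _ _

end ArithPair

/-- A digit expansion in base `l ^ 2`, with its separation properties. -/
structure DigitExpansion (k : Type) [NormedField k] (l : kˣ) where
  D : Type
  fintype : Fintype D
  dig : D → k
  cell : Set k
  isCompact_cell : IsCompact cell
  norm_le_one : ∀ s ∈ cell, ‖s‖ ≤ 1
  exists_digit : ∀ s ∈ cell, ∃ d, (l : k) ^ 2 * s - dig d ∈ cell
  prog : ∀ L ρ : ℝ, 0 < ρ → ∃ r₀ : ℝ, 0 < r₀ ∧ ∃ N₀ : ℕ, ∀ r : k, r₀ ≤ ‖r‖ →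
    ‖r‖ ≤ 2 * ‖(l : k) ^ 2‖ * r₀ → ∀ σ : k, ‖σ‖ ≤ L → ∃ j : ℤ, |j| ≤ N₀ ∧ ‖j * r - σ‖ < ρ
  sep : ∀ R : ℝ, ∃ C : ℕ, ∀ n : ℕ, ∀ T : Finset (List D), (∀ w ∈ T, w.length = n) →
    (∀ w ∈ T, ∀ w' ∈ T, ‖digitSum ((l : k) ^ 2) dig w - digitSum ((l : k) ^ 2) dig w'‖ ≤
      R / ‖(l : k) ^ 2‖ ^ n) → T.card ≤ C

namespace ArithPair

variable {k₁ k₂ R : Type} [NormedField k₁] [NormedField k₂] [CommRing R]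

lemma coe_dia_pow {k : Type} [NormedField k] (l : kˣ) (n : ℕ) :
    ((dia l ^ n : SL(2, k)) : Matrix (Fin 2) (Fin 2) k) =
      !![(l : k) ^ n, 0; 0, ((l : k) ^ n)⁻¹] := by
  rw [← dia_pow, coe_dia]
  simp

lemma mul_apply_SL {K : Type} [CommRing K] (g h : SL(2, K)) (i j : Fin 2) :
    (g * h) i j = g i 0 * h 0 j + g i 1 * h 1 j := by
  rw [Matrix.SpecialLinearGroup.coe_mul, Matrix.mul_apply, Fin.sum_univ_two]

lemma inv_entry_norm_le {k : Type} [NormedField k] {C : ℝ} (f : SL(2, k)) (hf : ∀ i j, ‖f i j‖ ≤ C)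
    (i j : Fin 2) : ‖f⁻¹ i j‖ ≤ C := by
  have := Matrix.SpecialLinearGroup.SL2_inv_expl f
  rw [this]
  fin_cases i <;> fin_cases j <;> simp <;> exact hf _ _

variable (P : ArithPair k₁ k₂ R)

lemma exists_of_mk_mem_thick {C : ℝ} {g : SL(2, k₁) × SL(2, k₂)}
    (hg : (QuotientGroup.mk g : P.Quot) ∈ P.thick C) :
    ∃ f ∈ box k₁ k₂ C, ∃ γ : SL(2, R), f⁻¹ * g = P.emb γ := by
  obtain ⟨f, hf, hfg⟩ := hg
  rw [QuotientGroup.eq] at hfg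
  obtain ⟨γ, hγ⟩ := hfg
  exact ⟨f, hf, γ, hγ.symm⟩

/-- The columns of a representative of a point of the thick part are not too short. -/
lemma one_le_of_mk_mem_thick {C M₁ M₂ : ℝ} {g : SL(2, k₁) × SL(2, k₂)}
    (hg : (QuotientGroup.mk g : P.Quot) ∈ P.thick C) (i : Fin 2) (h₁ : ∀ j, ‖g.1 j i‖ ≤ M₁)
    (h₂ : ∀ j, ‖g.2 j i‖ ≤ M₂) : 1 ≤ (2 * C * M₁) * (2 * C * M₂) := by
  obtain ⟨f, hf, γ, hγ⟩ := P.exists_of_mk_mem_thick hg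
  have hne : ∃ a, γ a i ≠ 0 := by
    by_contra! h0
    have hdet : γ 0 0 * γ 1 1 - γ 0 1 * γ 1 0 = 1 := by
      rw [← Matrix.det_fin_two]; exact γ.det_coe
    have : (1 : R) ≠ 0 := by
      intro h10
      have := P.φ₁.map_one
      rw [h10, map_zero] at this
      exact zero_ne_one this
    have h00 := h0 0
    have h01 := h0 1
    fin_cases i <;> simp_all
  obtain ⟨a, ha⟩ := hne
  have hC : 0 ≤ C := (norm_nonneg _).trans (hf 0 0).1
  have e₁ : P.φ₁ (γ a i) = (f.1⁻¹ * g.1) a i := by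
    rw [← P.emb_fst_apply, ← hγ]; rfl
  have e₂ : P.φ₂ (γ a i) = (f.2⁻¹ * g.2) a i := by
    rw [← P.emb_snd_apply, ← hγ]; rfl
  have b₁ : ‖P.φ₁ (γ a i)‖ ≤ 2 * C * M₁ := by
    rw [e₁, mul_apply_SL]
    have := norm_add_le (f.1⁻¹ a 0 * g.1 0 i) (f.1⁻¹ a 1 * g.1 1 i)
    rw [norm_mul, norm_mul] at this
    have c0 := mul_le_mul (inv_entry_norm_le f.1 (fun i j => (hf i j).1) a 0) (h₁ 0)
      (norm_nonneg _) hC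
    have c1 := mul_le_mul (inv_entry_norm_le f.1 (fun i j => (hf i j).1) a 1) (h₁ 1)
      (norm_nonneg _) hC
    linarith
  have b₂ : ‖P.φ₂ (γ a i)‖ ≤ 2 * C * M₂ := by
    rw [e₂, mul_apply_SL]
    have := norm_add_le (f.2⁻¹ a 0 * g.2 0 i) (f.2⁻¹ a 1 * g.2 1 i)
    rw [norm_mul, norm_mul] at this
    have c0 := mul_le_mul (inv_entry_norm_le f.2 (fun i j => (hf i j).2) a 0) (h₂ 0)
      (norm_nonneg _) hC
    have c1 := mul_le_mul (inv_entry_norm_le f.2 (fun i j => (hf i j).2) a 1) (h₂ 1)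
      (norm_nonneg _) hC
    linarith
  exact (P.one_le _ ha).trans (mul_le_mul b₁ b₂ (norm_nonneg _) ((norm_nonneg _).trans b₁))

lemma exists_avoid {C : ℝ} (hC : 1 ≤ C) : ∃ L ρ : ℝ, 0 < ρ ∧ ∀ x ∈ P.bdd C, ∃ σ : k₁, ‖σ‖ ≤ L ∧
    ∀ s : k₁, ‖s - σ‖ < ρ → ((unip s, 1) : SL(2, k₁) × SL(2, k₂)) • x ∉ P.bdd C := by
  have hl := P.two_le₁
  obtain ⟨n, hn⟩ := pow_unbounded_of_one_lt (8 * C ^ 4) (show (1 : ℝ) < ‖(P.l₁ : k₁)‖ by linarith)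
  set q : ℝ := ‖(P.l₁ : k₁)‖ ^ n with hq
  have hq0 : 0 < q := by positivity
  refine ⟨2 * C ^ 2, 1 / (8 * C ^ 4 * q), by positivity, fun x hx => ?_⟩
  obtain ⟨h, hh, rfl⟩ := (by simpa [diag_zero] using hx 0 0 : x ∈ P.thick C)
  have hi : ∃ i : Fin 2, 1 / (2 * C) ≤ ‖h.1 1 i‖ := by
    by_contra! hlt
    have hdet : h.1 0 0 * h.1 1 1 - h.1 0 1 * h.1 1 0 = 1 := by
      rw [← Matrix.det_fin_two]; exact h.1.det_coe
    have h1 := norm_sub_le (h.1 0 0 * h.1 1 1) (h.1 0 1 * h.1 1 0)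
    rw [hdet, norm_one, norm_mul, norm_mul] at h1
    have c0 : ‖h.1 0 0‖ * ‖h.1 1 1‖ < C * (1 / (2 * C)) :=
      mul_lt_mul' (hh 0 0).1 (hlt 1) (norm_nonneg _) (by linarith)
    have c1 : ‖h.1 0 1‖ * ‖h.1 1 0‖ < C * (1 / (2 * C)) :=
      mul_lt_mul' (hh 0 1).1 (hlt 0) (norm_nonneg _) (by linarith)
    have : C * (1 / (2 * C)) = 1 / 2 := by field_simp
    linarith
  obtain ⟨i, hi⟩ := hi
  have hpos : 0 < ‖h.1 1 i‖ := lt_of_lt_of_le (by positivity) hi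
  have hne : h.1 1 i ≠ 0 := norm_pos_iff.1 hpos
  refine ⟨-(h.1 0 i / h.1 1 i), ?_, fun s hs hmem => ?_⟩
  · rw [norm_neg, norm_div, div_le_iff₀ hpos]
    have : 2 * C ^ 2 * (1 / (2 * C)) ≤ 2 * C ^ 2 * ‖h.1 1 i‖ :=
      mul_le_mul_of_nonneg_left hi (by positivity)
    have e : 2 * C ^ 2 * (1 / (2 * C)) = C := by field_simp
    linarith [(hh 0 i).1]
  · have hm := hmem n 0
    rw [← mul_smul] at hm
    set g : SL(2, k₁) × SL(2, k₂) := P.diag n 0 * (unip s, 1) * h with hg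
    have hgm : (QuotientGroup.mk g : P.Quot) ∈ P.thick C := hm
    have g1 : g.1 = dia P.l₁ ^ n * (unip s * h.1) := by
      simp [hg, diag, mul_assoc]
    have g2 : g.2 = h.2 := by
      simp [hg, diag]
    have f1 : ∀ j, ‖g.1 j i‖ ≤ 1 / (8 * C ^ 3) := by
      intro j
      rw [g1, mul_apply_SL, mul_apply_SL, mul_apply_SL, coe_dia_pow, coe_unip]
      fin_cases j
      · have e : h.1 0 i + s * h.1 1 i = (s - -(h.1 0 i / h.1 1 i)) * h.1 1 i := by
          field_simp; ring
        simp only [Fin.zero_eta, Matrix.of_apply, Matrix.cons_val', Matrix.cons_val_zero,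
          Matrix.cons_val_one, Matrix.cons_val_fin_one, one_mul, zero_mul, add_zero, zero_add]
        rw [e, norm_mul, norm_mul, norm_pow]
        have : ‖s - -(h.1 0 i / h.1 1 i)‖ * ‖h.1 1 i‖ ≤ 1 / (8 * C ^ 4 * q) * C :=
          mul_le_mul hs.le (hh 1 i).1 (norm_nonneg _) (by positivity)
        calc q * (‖s - -(h.1 0 i / h.1 1 i)‖ * ‖h.1 1 i‖)
            ≤ q * (1 / (8 * C ^ 4 * q) * C) := mul_le_mul_of_nonneg_left this hq0.le
          _ = 1 / (8 * C ^ 3) := by field_simp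
      · simp only [Fin.mk_one, Matrix.of_apply, Matrix.cons_val', Matrix.cons_val_zero,
          Matrix.cons_val_one, Matrix.cons_val_fin_one, one_mul, zero_mul, zero_add]
        rw [norm_mul, norm_inv, norm_pow, ← hq, inv_mul_le_iff₀ hq0]
        have e : 8 * C ^ 4 * (1 / (8 * C ^ 3)) = C := by field_simp
        have := mul_le_mul_of_nonneg_right hn.le (show 0 ≤ 1 / (8 * C ^ 3) by positivity)
        linarith [(hh 1 i).1]
    have f2 : ∀ j, ‖g.2 j i‖ ≤ C := fun j => by rw [g2]; exact (hh j i).2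
    have := P.one_le_of_mk_mem_thick hgm i f1 f2
    have e : (2 * C * (1 / (8 * C ^ 3))) * (2 * C * C) = 1 / 2 := by field_simp; norm_num
    linarith

lemma trace_conj {K : Type} [CommRing K] (h g : SL(2, K)) :
    (h⁻¹ * g * h) 0 0 + (h⁻¹ * g * h) 1 1 = g 0 0 + g 1 1 := by
  have h1 : ∀ g : SL(2, K), g 0 0 + g 1 1 = Matrix.trace (g : Matrix (Fin 2) (Fin 2) K) := fun g =>
    (Matrix.trace_fin_two _).symm
  rw [h1, h1, Matrix.SpecialLinearGroup.coe_mul, Matrix.trace_mul_comm,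
    ← Matrix.SpecialLinearGroup.coe_mul, ← mul_assoc, mul_inv_cancel, one_mul]

lemma nonunip : ∃ N₀ ∈ 𝓝 (1 : SL(2, k₁) × SL(2, k₂)), ∀ m : ℕ, 1 ≤ m → ∀ x : P.Quot, ∀ g ∈ N₀,
    ((1, (dia P.l₂ ^ 3) ^ m) : SL(2, k₁) × SL(2, k₂)) • x = g • x →
      ¬ (g.1 1 0 = 0 ∧ g.1 0 0 = g.1 1 1) := by
  refine ⟨_, nhds_one_SL_prod (ϑ := 1 / 2) (by norm_num), fun m hm x g hg hx hu => ?_⟩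
  obtain ⟨h, rfl⟩ := QuotientGroup.mk_surjective x
  have hx' : (QuotientGroup.mk (g * h) : P.Quot) =
      QuotientGroup.mk (((1, (dia P.l₂ ^ 3) ^ m) : SL(2, k₁) × SL(2, k₂)) * h) := hx.symm
  rw [QuotientGroup.eq] at hx'
  obtain ⟨γ, hγ⟩ := hx'
  have hγ₁ : (P.emb γ).1 = h.1⁻¹ * g.1⁻¹ * h.1 := by
    rw [hγ]; simp [mul_assoc]
  have hγ₂ : (P.emb γ).2 = h.2⁻¹ * (g.2⁻¹ * (dia P.l₂ ^ 3) ^ m) * h.2 := by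
    rw [hγ]; simp [mul_assoc]
  have t₁ : P.φ₁ (γ 0 0 + γ 1 1) = g.1⁻¹ 0 0 + g.1⁻¹ 1 1 := by
    rw [map_add, ← P.emb_fst_apply, ← P.emb_fst_apply, hγ₁, trace_conj]
  have t₂ : P.φ₂ (γ 0 0 + γ 1 1) = (g.2⁻¹ * (dia P.l₂ ^ 3) ^ m) 0 0 +
      (g.2⁻¹ * (dia P.l₂ ^ 3) ^ m) 1 1 := by
    rw [map_add, ← P.emb_snd_apply, ← P.emb_snd_apply, hγ₂, trace_conj]
  have hdet : g.1 0 0 * g.1 1 1 - g.1 0 1 * g.1 1 0 = 1 := by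
    rw [← Matrix.det_fin_two]; exact g.1.det_coe
  have hsq : (γ 0 0 + γ 1 1) ^ 2 = 4 := by
    apply P.φ₁_injective
    rw [map_pow, t₁, Matrix.SpecialLinearGroup.SL2_inv_expl]
    simp
    rw [hu.1, hu.2] at hdet
    rw [hu.2]
    rw [map_ofNat]
    linear_combination 4 * hdet
  have hsq₂ := congrArg P.φ₂ hsq
  rw [map_pow, t₂, ← pow_mul, mul_apply_SL, mul_apply_SL, coe_dia_pow,
    Matrix.SpecialLinearGroup.SL2_inv_expl] at hsq₂
  simp at hsq₂
  set μ : k₂ := (P.l₂ : k₂) ^ (3 * m) with hμ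
  have hμ8 : 8 ≤ ‖μ‖ := by
    rw [hμ, norm_pow]
    calc (8 : ℝ) = 2 ^ 3 := by norm_num
      _ ≤ ‖(P.l₂ : k₂)‖ ^ 3 := pow_le_pow_left₀ (by norm_num) P.two_le₂ 3
      _ ≤ ‖(P.l₂ : k₂)‖ ^ (3 * m) :=
        pow_le_pow_right₀ (by linarith [P.two_le₂]) (by omega)
  have n4 : ‖(4 : k₂)‖ ≤ 4 := by
    have : (4 : k₂) = 1 + 1 + 1 + 1 := by norm_num
    rw [this]
    calc ‖(1 + 1 + 1 + 1 : k₂)‖ ≤ ‖(1 : k₂)‖ + ‖(1 : k₂)‖ + ‖(1 : k₂)‖ + ‖(1 : k₂)‖ :=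
          norm_add₄_le
      _ = 4 := by simp; norm_num
  have hn := congrArg norm hsq₂
  rw [norm_pow, map_ofNat] at hn
  have hlt : ‖g.2 1 1 * μ + g.2 0 0 * μ⁻¹‖ ≤ 2 := by
    nlinarith [norm_nonneg (g.2 1 1 * μ + g.2 0 0 * μ⁻¹)]
  have h11 : 1 / 2 ≤ ‖g.2 1 1‖ := by
    have h1 := hg.2 1 1
    rw [Matrix.one_apply_eq, norm_sub_rev] at h1
    have := norm_sub_norm_le (1 : k₂) (1 - g.2 1 1)
    rw [sub_sub_cancel, norm_one] at this
    linarith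
  have h00 : ‖g.2 0 0‖ ≤ 3 / 2 := by
    have h1 := hg.2 0 0
    rw [Matrix.one_apply_eq] at h1
    have := norm_sub_norm_le (g.2 0 0) (1 : k₂)
    rw [norm_one] at this
    linarith
  have h3 := norm_sub_le (g.2 1 1 * μ + g.2 0 0 * μ⁻¹) (g.2 0 0 * μ⁻¹)
  rw [add_sub_cancel_right, norm_mul, norm_mul, norm_inv] at h3
  have h4 : ‖μ‖⁻¹ ≤ 1 := inv_le_one_of_one_le₀ (by linarith)
  nlinarith [norm_nonneg (g.2 0 0), inv_nonneg.2 (norm_nonneg μ)]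

/-- The shear system of an arithmetic pair. -/
def shear [ProperSpace k₁] [ProperSpace k₂] {C : ℝ} (hC : 1 ≤ C) (E : DigitExpansion k₁ P.l₁) :
    ShearSystem k₁ SL(2, k₂) P.Quot E.D where
  l := P.l₁
  b := dia P.l₂ ^ 3
  Y := P.bdd C
  dig := E.dig
  two_le := by
    rw [norm_pow]
    nlinarith [P.two_le₁]
  compact := P.isCompact_bdd C
  a_mem y := by
    have h : ((dia P.l₁, 1) : SL(2, k₁) × SL(2, k₂)) = P.diag 1 0 := by simp [diag]
    rw [h, diag_smul_mem_bdd]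
  b_mem y := by
    have h : ((1, dia P.l₂ ^ 3) : SL(2, k₁) × SL(2, k₂)) = P.diag 0 3 := by
      simp only [diag, zpow_zero]
      rfl
    rw [h, diag_smul_mem_bdd]
  avoid := P.exists_avoid hC
  orb x _ hN := P.image_smul_mem_nhds x hN
  nonunip := P.nonunip
  prog := E.prog
  sep := E.sep

/-- The orbit point `(n, m)` of `(s, t)` is bounded by `C`. -/
def Orb (C : ℝ) (s : k₁) (t : k₂) (n m : ℤ) : Prop :=
  ∃ γ : SL(2, R), (∀ i j, ‖(dia P.l₁ ^ n * unip s * (P.emb γ).1) i j‖ ≤ C) ∧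
    ∀ i j, ‖(dia P.l₂ ^ m * unip t * (P.emb γ).2) i j‖ ≤ C

lemma orb_swap {C : ℝ} {s : k₁} {t : k₂} {n m : ℤ} (h : P.Orb C s t n m) : P.swap.Orb C t s m n := by
  obtain ⟨γ, h₁, h₂⟩ := h
  exact ⟨γ, h₂, h₁⟩

lemma Orb.mem {P : ArithPair k₁ k₂ R} {C : ℝ} {s : k₁} {t : k₂} {n m : ℤ} (h : P.Orb C s t n m) :
    (P.diag n m * (unip s, unip t)) • (QuotientGroup.mk 1 : P.Quot) ∈ P.thick C := by
  obtain ⟨γ, h₁, h₂⟩ := h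
  refine ⟨P.diag n m * (unip s, unip t) * P.emb γ, fun i j => ⟨h₁ i j, h₂ i j⟩, ?_⟩
  change _ = (QuotientGroup.mk (P.diag n m * (unip s, unip t) * 1) : P.Quot)
  rw [QuotientGroup.eq]
  refine ⟨γ⁻¹, ?_⟩
  rw [map_inv]
  group

end ArithPair

namespace ArithPair

variable {k₁ k₂ R : Type} [NormedField k₁] [NormedField k₂] [CommRing R] (P : ArithPair k₁ k₂ R)

lemma dia_zpow_mul_unip {k : Type} [NormedField k] (l : kˣ) (n : ℤ) (s : k) :
    dia l ^ n * unip s = unip (((l : k) ^ 2) ^ n * s) * dia l ^ n := by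
  have key : ∀ (l : kˣ) (n : ℕ), dia l ^ (n : ℤ) * unip s =
      unip (((l : k) ^ 2) ^ (n : ℤ) * s) * dia l ^ (n : ℤ) := by
    intro l n
    simp only [zpow_natCast]
    exact dia_pow_mul_unip l n s
  rcases Int.eq_nat_or_neg n with ⟨m, rfl | rfl⟩
  · exact key l m
  · have := key l⁻¹ m
    rw [dia_inv, inv_zpow', Units.val_inv_eq_inv_val, inv_pow, inv_zpow'] at this
    exact this

/-- Finitely many points of a rich family persist in the limit, so clusters are small. -/
theorem eventually_card_lt [ProperSpace k₁] [ProperSpace k₂] {C : ℝ} (hC : 1 ≤ C)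
    (E : DigitExpansion k₁ P.l₁) {δ : ℝ} (hδ : 0 < δ) :
    ∃ N : ℕ, ∀ n ≥ N, ∀ r : ℝ, 2 / ‖(P.l₁ : k₁) ^ 2‖ ^ n < r →
      ∀ (A : Set (k₁ × k₂)) (a b : ℕ → ℤ) (ε : ℕ → ℝ), Tendsto ε atTop (𝓝 0) →
      (∀ n m : ℤ, ∀ᶠ j in atTop, ∀ w ∈ A, P.Orb C w.1 w.2 (n + a j) (m + b j)) →
      ∀ᶠ j in atTop, ∀ (s : k₁) (t : k₂) (G : Finset (k₁ × k₂)), ↑G ⊆ A →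
        (∀ g ∈ G, ((P.l₁ : k₁) ^ 2) ^ a j * (g.1 - s) ∈ E.cell) →
        (∀ g ∈ G, ‖((P.l₂ : k₂) ^ 2) ^ b j * (g.2 - t)‖ ≤ ε j) →
        (∀ g ∈ G, ∀ g' ∈ G, g ≠ g' → r ≤ ‖((P.l₁ : k₁) ^ 2) ^ a j * (g.1 - g'.1)‖) →
        (G.card : ℝ) < Real.exp (δ * n) := by
  have := E.fintype
  have hsc : SecondCountableTopology k₁ := inferInstance
  have hsc₂ : SecondCountableTopology k₂ := inferInstance
  have i1 := secondCountable_SL (k := k₂)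
  have i2 := locallyCompact_SL (k := k₁)
  have i3 := locallyCompact_SL (k := k₂)
  have hnr := (P.shear hC E).not_rich (cell := E.cell) E.norm_le_one E.exists_digit hδ
  push Not at hnr
  obtain ⟨N, hN⟩ := hnr
  refine ⟨N, fun n hn r hr A a b ε hε horb => ?_⟩
  by_contra hcon
  rw [not_eventually] at hcon
  push Not at hcon
  set bad : Set ℕ := {j | _} with hbad
  have hne : (atTop ⊓ 𝓟 bad).NeBot := frequently_mem_iff_neBot.1 hcon
  set U : Ultrafilter ℕ := @Ultrafilter.of _ _ hne with hU
  have hUle : (U : Filter ℕ) ≤ atTop ⊓ 𝓟 bad := @Ultrafilter.of_le _ _ hne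
  have hUtop : (U : Filter ℕ) ≤ atTop := hUle.trans inf_le_left
  have hUbad : ∀ᶠ j in (U : Filter ℕ), j ∈ bad := hUle.trans inf_le_right (mem_principal_self _)
  set T : ℕ := ⌈Real.exp (δ * n)⌉₊ with hT
  have hTpos : 0 < T := Nat.ceil_pos.2 (Real.exp_pos _)
  have hch : ∀ j, ∃ s : k₁, ∃ t : k₂, ∃ f : Fin T → k₁ × k₂, j ∈ bad →
      (∀ i, f i ∈ A) ∧ (∀ i, ((P.l₁ : k₁) ^ 2) ^ a j * ((f i).1 - s) ∈ E.cell) ∧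
      (∀ i, ‖((P.l₂ : k₂) ^ 2) ^ b j * ((f i).2 - t)‖ ≤ ε j) ∧
      ∀ i i', i ≠ i' → r ≤ ‖((P.l₁ : k₁) ^ 2) ^ a j * ((f i).1 - (f i').1)‖ := by
    intro j
    by_cases hj : j ∈ bad
    · obtain ⟨s, t, G, hGA, h1, h2, h3, h4⟩ := hj
      have hcard : T ≤ G.card := Nat.ceil_le.2 h4
      obtain ⟨G', hG', hG'c⟩ := Finset.exists_subset_card_eq hcard
      let e := (Finset.equivFinOfCardEq hG'c).symm
      refine ⟨s, t, fun i => (e i : k₁ × k₂), fun _ => ⟨fun i => hGA (hG' (e i).2),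
        fun i => h1 _ (hG' (e i).2), fun i => h2 _ (hG' (e i).2), fun i i' hii => ?_⟩⟩
      refine h3 _ (hG' (e i).2) _ (hG' (e i').2) fun h => hii ?_
      exact e.injective (Subtype.ext h)
    · exact ⟨0, 0, fun _ => 0, fun h => absurd h hj⟩
  choose s t f hf using hch
  set σ : Fin T → ℕ → k₁ := fun i j => ((P.l₁ : k₁) ^ 2) ^ a j * ((f j i).1 - s j) with hσ
  set τ : Fin T → ℕ → k₂ := fun i j => ((P.l₂ : k₂) ^ 2) ^ b j * ((f j i).2 - t j) with hτ
  set x : ℕ → P.Quot := fun j => (P.diag (a j) (b j) * (unip (s j), unip (t j))) •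
    (QuotientGroup.mk 1 : P.Quot) with hx
  have hshift : ∀ i j, (P.diag (a j) (b j) * (unip (f j i).1, unip (f j i).2)) •
      (QuotientGroup.mk 1 : P.Quot) = (unip (σ i j), unip (τ i j)) • x j := by
    intro i j
    rw [hx, ← mul_smul]
    congr 1
    have e₁ := dia_zpow_mul_unip P.l₁ (a j) ((f j i).1 - s j)
    have e₂ := dia_zpow_mul_unip P.l₂ (b j) ((f j i).2 - t j)
    have d₁ : unip (f j i).1 = unip ((f j i).1 - s j) * unip (s j) := by
      rw [← unip_add, sub_add_cancel]
    have d₂ : unip (f j i).2 = unip ((f j i).2 - t j) * unip (t j) := by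
      rw [← unip_add, sub_add_cancel]
    apply Prod.ext
    · change dia P.l₁ ^ a j * unip (f j i).1 = unip (σ i j) * (dia P.l₁ ^ a j * unip (s j))
      rw [d₁, ← mul_assoc, e₁, mul_assoc]
    · change dia P.l₂ ^ b j * unip (f j i).2 = unip (τ i j) * (dia P.l₂ ^ b j * unip (t j))
      rw [d₂, ← mul_assoc, e₂, mul_assoc]
  have hmem : ∀ (i : Fin T) (n m : ℤ), ∀ᶠ j in (U : Filter ℕ),
      P.diag n m • ((unip (σ i j), unip (τ i j)) : SL(2, k₁) × SL(2, k₂)) • x j ∈ P.thick C := by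
    intro i n m
    filter_upwards [hUbad, hUtop (horb n m)] with j hj hj'
    have := (hj' _ ((hf j hj).1 i)).mem
    rwa [← hshift, ← mul_smul, ← mul_assoc, ← diag_add]
  have hσlim : ∀ i, ∃ z ∈ E.cell, Tendsto (σ i) U (𝓝 z) := by
    intro i
    have := E.isCompact_cell.ultrafilter_le_nhds (U.map (σ i)) (by
      rw [le_principal_iff]
      exact hUbad.mono fun j hj => (hf j hj).2.1 i)
    exact this
  choose ς hς hςlim using hσlim
  have hτlim : ∀ i, Tendsto (τ i) U (𝓝 0) := by
    intro i
    refine squeeze_zero_norm' (a := ε) ?_ (hε.mono_left hUtop)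
    exact hUbad.mono fun j hj => (hf j hj).2.2.1 i
  let i₀ : Fin T := ⟨0, hTpos⟩
  obtain ⟨z, -, hz⟩ := (P.isCompact_thick C).ultrafilter_le_nhds
    (U.map fun j => ((unip (σ i₀ j), unip (τ i₀ j)) : SL(2, k₁) × SL(2, k₂)) • x j) (by
      rw [le_principal_iff]
      refine (hmem i₀ 0 0).mono fun j hj => ?_
      rwa [diag_zero, one_smul] at hj)
  have hz' : Tendsto (fun j => ((unip (σ i₀ j), unip (τ i₀ j)) : SL(2, k₁) × SL(2, k₂)) • x j) U
      (𝓝 z) := hz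
  have hglim : ∀ i, Tendsto (fun j => ((unip (σ i j), unip (τ i j)) : SL(2, k₁) × SL(2, k₂))) U
      (𝓝 (unip (ς i), 1)) := by
    intro i
    have h1 := (continuous_unip.tendsto (ς i)).comp (hςlim i)
    have h2 := (continuous_unip.tendsto (0 : k₂)).comp (hτlim i)
    rw [unip_zero] at h2
    exact h1.prodMk_nhds h2
  set y : P.Quot := ((unip (ς i₀), 1) : SL(2, k₁) × SL(2, k₂))⁻¹ • z with hy
  have hxlim : Tendsto x U (𝓝 y) := by
    have := ((hglim i₀).inv).smul hz'
    refine this.congr fun j => ?_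
    rw [inv_smul_smul]
  have hbdd : ∀ i, ((unip (ς i), 1) : SL(2, k₁) × SL(2, k₂)) • y ∈ P.bdd C := by
    intro i n m
    refine (P.isCompact_thick C).isClosed.mem_of_tendsto (b := (U : Filter ℕ)) ?_ (hmem i n m)
    exact ((hglim i).smul hxlim).const_smul _
  have hsep : ∀ i i', i ≠ i' → r ≤ ‖ς i - ς i'‖ := by
    intro i i' hii
    refine ge_of_tendsto ((hςlim i).sub (hςlim i')).norm (hUbad.mono fun j hj => ?_)
    have := (hf j hj).2.2.2 i i' hii
    have e : σ i j - σ i' j = ((P.l₁ : k₁) ^ 2) ^ a j * ((f j i).1 - (f j i').1) := by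
      simp only [hσ]
      ring
    rwa [e]
  have hr0 : 0 < r := lt_of_le_of_lt (by positivity) hr
  have hinj : Function.Injective ς := by
    intro i i' h
    by_contra hii
    have := hsep i i' hii
    rw [h, sub_self, norm_zero] at this
    linarith
  obtain ⟨u, hu, u', hu', huu, hle⟩ := hN n hn y (Finset.univ.map ⟨ς, hinj⟩)
    (by
      rw [Finset.card_map, Finset.card_univ, Fintype.card_fin]
      exact Nat.le_ceil _)
    (by
      intro u hu
      obtain ⟨i, -, rfl⟩ := Finset.mem_map.1 hu
      exact ⟨hς i, hbdd i⟩)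
  obtain ⟨i, -, rfl⟩ := Finset.mem_map.1 hu
  obtain ⟨i', -, rfl⟩ := Finset.mem_map.1 hu'
  have := hsep i i' fun h => huu (by rw [h])
  exact absurd (this.trans hle) (not_le.2 hr)

end ArithPair

/-- Separated subsets of a ball in a proper space are uniformly finite. -/
lemma exists_card_le_of_separated {Z : Type*} [PseudoMetricSpace Z] [ProperSpace Z] (z : Z) (R : ℝ) :
    ∃ C : ℕ, ∀ {ι : Type} (T : Finset ι) (f : ι → Z), (∀ i ∈ T, dist (f i) z ≤ R) →
      (∀ i ∈ T, ∀ j ∈ T, i ≠ j → 1 ≤ dist (f i) (f j)) → T.card ≤ C := by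
  obtain ⟨t, -, ht, hcov⟩ := (isCompact_closedBall z R).finite_cover_balls
    (show (0 : ℝ) < 1 / 2 by norm_num)
  refine ⟨ht.toFinset.card, fun {ι} T f hR hsep => ?_⟩
  have h1 : ∀ i : ι, ∃ y : Z, i ∈ T → y ∈ t ∧ dist (f i) y < 1 / 2 := by
    intro i
    by_cases hi : i ∈ T
    · obtain ⟨y, hy, h⟩ := mem_iUnion₂.1 (hcov (Metric.mem_closedBall.2 (hR i hi)))
      exact ⟨y, fun _ => ⟨hy, h⟩⟩
    · exact ⟨z, fun h => absurd h hi⟩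
  choose g hg using h1
  refine Finset.card_le_card_of_injOn g (fun i hi => ?_) fun i hi j hj hij => ?_
  · simpa using (hg i hi).1
  · by_contra hne
    have h2 := (hg i hi).2
    have h3 := (hg j hj).2
    rw [← hij] at h3
    linarith [hsep i hi j hj hne, dist_triangle_right (f i) (f j) (g i)]

/-- Digit sums which separate words satisfy the multiplicity bound. -/
lemma exists_card_le_of_digitSum {k D : Type} [NormedField k] [ProperSpace k] {α : k}
    (hα : 0 < ‖α‖) (dig : D → k)
    (h : ∀ n : ℕ, ∀ w w' : List D, w.length = n → w'.length = n → w ≠ w' →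
      1 / ‖α‖ ^ n ≤ ‖digitSum α dig w - digitSum α dig w'‖) (R : ℝ) :
    ∃ C : ℕ, ∀ n : ℕ, ∀ T : Finset (List D), (∀ w ∈ T, w.length = n) →
      (∀ w ∈ T, ∀ w' ∈ T, ‖digitSum α dig w - digitSum α dig w'‖ ≤ R / ‖α‖ ^ n) → T.card ≤ C := by
  obtain ⟨C, hC⟩ := exists_card_le_of_separated (0 : k) R
  refine ⟨C, fun n T hT hR => ?_⟩
  rcases T.eq_empty_or_nonempty with rfl | ⟨w₀, hw₀⟩
  · simp
  have hpow : 0 < ‖α‖ ^ n := by positivity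
  refine hC T (fun w => α ^ n * (digitSum α dig w - digitSum α dig w₀)) (fun w hw => ?_)
    fun w hw w' hw' hne => ?_
  · rw [dist_zero_right, norm_mul, norm_pow]
    have := hR w hw w₀ hw₀
    rwa [le_div_iff₀ hpow, mul_comm] at this
  · rw [dist_eq_norm, ← mul_sub, sub_sub_sub_cancel_right, norm_mul, norm_pow]
    have := h n w w' (hT w hw) (hT w' hw') hne
    rwa [div_le_iff₀ hpow, mul_comm] at this

section RealDigits

lemma digitSum_real_mem {q : ℕ} (hq : 2 ≤ q) (w : List (Fin q)) :
    0 ≤ digitSum (q : ℝ) (fun d : Fin q => (d : ℝ)) w ∧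
      digitSum (q : ℝ) (fun d : Fin q => (d : ℝ)) w ≤ 1 - 1 / (q : ℝ) ^ w.length := by
  have hq0 : (0 : ℝ) < q := by positivity
  induction w with
  | nil => simp [digitSum]
  | cons d w ih =>
    have hd : (d : ℝ) ≤ q - 1 := by
      have : ((d : ℕ) : ℝ) + 1 ≤ q := by exact_mod_cast d.2
      linarith
    simp only [digitSum, List.length_cons]
    refine ⟨div_nonneg (add_nonneg (by positivity) ih.1) hq0.le, ?_⟩
    rw [div_le_iff₀ hq0, sub_mul, one_mul, pow_succ]
    have : 1 / ((q : ℝ) ^ w.length * q) * q = 1 / (q : ℝ) ^ w.length := by field_simp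
    linarith [ih.2]

lemma digitSum_real_sep {q : ℕ} (hq : 2 ≤ q) (n : ℕ) : ∀ w w' : List (Fin q), w.length = n →
    w'.length = n → w ≠ w' → 1 / (q : ℝ) ^ n ≤
      |digitSum (q : ℝ) (fun d : Fin q => (d : ℝ)) w -
        digitSum (q : ℝ) (fun d : Fin q => (d : ℝ)) w'| := by
  have hq0 : (0 : ℝ) < q := by positivity
  induction n with
  | zero =>
    intro w w' hw hw' hne
    rw [List.length_eq_zero_iff] at hw hw'
    exact absurd (hw.trans hw'.symm) hne
  | succ n ih =>
    intro w w' hw hw' hne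
    obtain ⟨d, w, rfl⟩ := List.exists_cons_of_length_eq_add_one hw
    obtain ⟨d', w', rfl⟩ := List.exists_cons_of_length_eq_add_one hw'
    simp only [List.length_cons, add_left_inj] at hw hw'
    simp only [digitSum]
    rw [← sub_div, abs_div, abs_of_pos hq0, le_div_iff₀ hq0, pow_succ]
    have e : 1 / ((q : ℝ) ^ n * q) * q = 1 / (q : ℝ) ^ n := by field_simp
    rw [e]
    by_cases hd : d = d'
    · subst hd
      rw [add_sub_add_left_eq_sub]
      exact ih w w' hw hw' fun h => hne (by rw [h])
    · have h1 := digitSum_real_mem hq w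
      have h2 := digitSum_real_mem hq w'
      rw [hw] at h1
      rw [hw'] at h2
      rcases lt_or_gt_of_ne (fun h => hd (Fin.ext h) : (d : ℕ) ≠ d') with hlt | hlt
      · have : ((d : ℕ) : ℝ) + 1 ≤ (d' : ℕ) := by exact_mod_cast hlt
        rw [abs_sub_comm]
        exact le_trans (by linarith) (le_abs_self _)
      · have : ((d' : ℕ) : ℝ) + 1 ≤ (d : ℕ) := by exact_mod_cast hlt
        exact le_trans (by linarith) (le_abs_self _)

/-- The base `p ^ 2` expansion of real numbers in the unit interval. -/
noncomputable def realDigits (p : ℕ) (hp : 2 ≤ p) (l : ℝˣ) (hl : (l : ℝ) = p) :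
    DigitExpansion ℝ l where
  D := Fin (p ^ 2)
  fintype := inferInstance
  dig d := (d : ℕ)
  cell := Icc 0 1
  isCompact_cell := isCompact_Icc
  norm_le_one s hs := by rw [Real.norm_eq_abs, abs_le]; constructor <;> linarith [hs.1, hs.2]
  exists_digit s hs := by
    rw [hl]
    have hp2 : (0 : ℝ) < (p : ℝ) ^ 2 := by positivity
    have hs0 : 0 ≤ (p : ℝ) ^ 2 * s := mul_nonneg hp2.le hs.1
    have hp2' : 0 < p ^ 2 := by positivity
    by_cases hfl : ⌊(p : ℝ) ^ 2 * s⌋₊ < p ^ 2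
    · refine ⟨⟨⌊(p : ℝ) ^ 2 * s⌋₊, hfl⟩, ?_, ?_⟩
      · simpa using Nat.floor_le hs0
      · have := Nat.lt_floor_add_one ((p : ℝ) ^ 2 * s)
        simp only
        linarith
    · refine ⟨⟨p ^ 2 - 1, by omega⟩, ?_, ?_⟩ <;>
        simp only [Nat.cast_sub (show 1 ≤ p ^ 2 by omega), Nat.cast_pow, Nat.cast_one]
      · have : ((p ^ 2 : ℕ) : ℝ) ≤ (p : ℝ) ^ 2 * s :=
          (Nat.cast_le.2 (not_lt.1 hfl)).trans (Nat.floor_le hs0)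
        push_cast at this
        linarith
      · nlinarith [hs.2]
  prog L ρ hρ := by
    rw [hl]
    have hp2 : (1 : ℝ) ≤ ‖(p : ℝ) ^ 2‖ := by
      rw [Real.norm_of_nonneg (by positivity)]
      exact one_le_pow₀ (by exact_mod_cast (by omega : 1 ≤ p))
    set q := ‖(p : ℝ) ^ 2‖ with hq
    have hr : 0 < ρ / (4 * q) := by positivity
    refine ⟨ρ / (4 * q), hr, ⌈L / (ρ / (4 * q))⌉₊ + 1, fun r h1 h2 σ hσ => ?_⟩
    have hr0 : 0 < |r| := lt_of_lt_of_le hr h1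
    have hrne : r ≠ 0 := abs_pos.1 hr0
    have h3 := abs_sub_round (σ / r)
    refine ⟨round (σ / r), ?_, ?_⟩
    · have h4 : |σ / r| ≤ L / (ρ / (4 * q)) := by
        rw [abs_div]
        exact div_le_div₀ ((abs_nonneg _).trans hσ) hσ hr h1
      have h5 : |(round (σ / r) : ℝ)| ≤ ⌈L / (ρ / (4 * q))⌉₊ + 1 := by
        have := Nat.le_ceil (L / (ρ / (4 * q)))
        have h6 := abs_sub_abs_le_abs_sub (round (σ / r) : ℝ) (σ / r)
        rw [abs_sub_comm] at h6
        linarith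
      exact_mod_cast h5
    · have e : (round (σ / r) : ℝ) * r - σ = -((σ / r - round (σ / r)) * r) := by
        field_simp; ring
      rw [e, norm_neg, norm_mul, Real.norm_eq_abs]
      have h5 : ‖r‖ ≤ ρ / 2 := by
        refine h2.trans (le_of_eq ?_)
        field_simp; ring
      nlinarith [norm_nonneg r, abs_nonneg (σ / r - round (σ / r))]
  sep R := by
    have hq : 2 ≤ p ^ 2 := by nlinarith
    have e : (l : ℝ) ^ 2 = ((p ^ 2 : ℕ) : ℝ) := by rw [hl]; push_cast; rfl
    rw [e]
    refine exists_card_le_of_digitSum (norm_pos_iff.2 (by positivity)) _ (fun n w w' h1 h2 h3 => ?_) R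
    have := digitSum_real_sep hq n w w' h1 h2 h3
    rw [Real.norm_of_nonneg (by positivity), Real.norm_eq_abs]
    exact this

end RealDigits

section PadicDigits

variable {p : ℕ} [hp : Fact p.Prime]

lemma exists_nat_padic_approx (x : ℚ_[p]) (hx : ‖x‖ ≤ 1) (n : ℕ) :
    ∃ m : ℕ, m < p ^ n ∧ ‖x - m‖ ≤ (p : ℝ) ^ (-n : ℤ) := by
  let y : ℤ_[p] := ⟨x, hx⟩
  refine ⟨y.appr n, y.appr_lt n, ?_⟩
  have := (PadicInt.norm_le_pow_iff_mem_span_pow _ _).2 (PadicInt.appr_spec n y)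
  rw [PadicInt.norm_def, PadicInt.coe_sub, PadicInt.coe_natCast] at this
  exact this

lemma digitSum_padic_norm_le (w : List (Fin (p ^ 2))) :
    ‖digitSum ((p : ℚ_[p])⁻¹ ^ 2) (fun d : Fin (p ^ 2) => ((d : ℕ) : ℚ_[p]) / (p : ℚ_[p]) ^ 2) w‖
      ≤ 1 := by
  have hp0 : (p : ℚ_[p]) ≠ 0 := by exact_mod_cast hp.out.ne_zero
  induction w with
  | nil => simp [digitSum]
  | cons d w ih =>
    simp only [digitSum]
    set z := digitSum ((p : ℚ_[p])⁻¹ ^ 2)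
      (fun d : Fin (p ^ 2) => ((d : ℕ) : ℚ_[p]) / (p : ℚ_[p]) ^ 2) w
    have e : (((d : ℕ) : ℚ_[p]) / (p : ℚ_[p]) ^ 2 + z) / (p : ℚ_[p])⁻¹ ^ 2 =
        ((d : ℕ) : ℤ) + (p : ℚ_[p]) ^ 2 * z := by
      push_cast
      field_simp
    rw [e]
    refine (Padic.nonarchimedean _ _).trans (max_le (Padic.norm_int_le_one _) ?_)
    rw [norm_mul, norm_pow]
    have h1 : ‖(p : ℚ_[p])‖ ≤ 1 := Padic.norm_p_lt_one.le
    exact mul_le_one₀ (pow_le_one₀ (norm_nonneg _) h1) (norm_nonneg _) ih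

lemma norm_inv_p_sq : ‖(p : ℚ_[p])⁻¹ ^ 2‖ = (p : ℝ) ^ 2 := by
  rw [norm_pow, norm_inv, Padic.norm_p, inv_inv]

lemma digitSum_padic_sep (n : ℕ) : ∀ w w' : List (Fin (p ^ 2)), w.length = n →
    w'.length = n → w ≠ w' → 1 / ‖(p : ℚ_[p])⁻¹ ^ 2‖ ^ n ≤
      ‖digitSum ((p : ℚ_[p])⁻¹ ^ 2)
          (fun d : Fin (p ^ 2) => ((d : ℕ) : ℚ_[p]) / (p : ℚ_[p]) ^ 2) w -
        digitSum ((p : ℚ_[p])⁻¹ ^ 2)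
          (fun d : Fin (p ^ 2) => ((d : ℕ) : ℚ_[p]) / (p : ℚ_[p]) ^ 2) w'‖ := by
  have hp0 : (p : ℚ_[p]) ≠ 0 := by exact_mod_cast hp.out.ne_zero
  have hpr : (1 : ℝ) < p := by exact_mod_cast hp.out.one_lt
  rw [norm_inv_p_sq]
  induction n with
  | zero =>
    intro w w' hw hw' hne
    rw [List.length_eq_zero_iff] at hw hw'
    exact absurd (hw.trans hw'.symm) hne
  | succ n ih =>
    intro w w' hw hw' hne
    obtain ⟨d, w, rfl⟩ := List.exists_cons_of_length_eq_add_one hw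
    obtain ⟨d', w', rfl⟩ := List.exists_cons_of_length_eq_add_one hw'
    simp only [List.length_cons, add_left_inj] at hw hw'
    simp only [digitSum]
    have hz := digitSum_padic_norm_le w
    have hz' := digitSum_padic_norm_le w'
    have ih' := ih w w' hw hw'
    set z := digitSum ((p : ℚ_[p])⁻¹ ^ 2)
      (fun d : Fin (p ^ 2) => ((d : ℕ) : ℚ_[p]) / (p : ℚ_[p]) ^ 2) w
    set z' := digitSum ((p : ℚ_[p])⁻¹ ^ 2)
      (fun d : Fin (p ^ 2) => ((d : ℕ) : ℚ_[p]) / (p : ℚ_[p]) ^ 2) w'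
    by_cases hd : d = d'
    · subst hd
      rw [← sub_div, add_sub_add_left_eq_sub, norm_div, norm_inv_p_sq, pow_succ,
        ← div_div]
      gcongr
      exact ih' fun h => hne (by rw [h])
    · have hdn : (p : ℝ) ^ (-2 : ℤ) < ‖(((d : ℕ) - (d' : ℕ) : ℤ) : ℚ_[p])‖ := by
        by_contra! hle
        have hdv : ((p ^ 2 : ℕ) : ℤ) ∣ ((d : ℕ) : ℤ) - (d' : ℕ) :=
          (Padic.norm_int_le_pow_iff_dvd _ 2).1 (by exact_mod_cast hle)
        have h1 := d.2
        have h2 := d'.2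
        refine hd (Fin.ext ?_)
        have h3 : ((d' : ℕ) : ℤ) ≡ (d : ℕ) [ZMOD ((p ^ 2 : ℕ) : ℤ)] :=
          Int.modEq_iff_dvd.2 hdv
        exact (Nat.ModEq.eq_of_lt_of_lt (Int.natCast_modEq_iff.1 h3) h2 h1).symm
      have e : (((d : ℕ) : ℚ_[p]) / (p : ℚ_[p]) ^ 2 + z) / (p : ℚ_[p])⁻¹ ^ 2 -
          (((d' : ℕ) : ℚ_[p]) / (p : ℚ_[p]) ^ 2 + z') / (p : ℚ_[p])⁻¹ ^ 2 =
          (((d : ℕ) - (d' : ℕ) : ℤ) : ℚ_[p]) + (p : ℚ_[p]) ^ 2 * (z - z') := by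
        push_cast
        field_simp
        ring
      have h4 : ‖(p : ℚ_[p]) ^ 2 * (z - z')‖ ≤ (p : ℝ) ^ (-2 : ℤ) := by
        rw [norm_mul, Padic.norm_p_pow]
        have : ‖z - z'‖ ≤ 1 := by
          rw [sub_eq_add_neg]
          refine (Padic.nonarchimedean _ _).trans (max_le hz ?_)
          rwa [norm_neg]
        calc (p : ℝ) ^ (-(2 : ℕ) : ℤ) * ‖z - z'‖ ≤ (p : ℝ) ^ (-(2 : ℕ) : ℤ) * 1 := by gcongr
          _ = _ := by simp
      rw [e, Padic.add_eq_max_of_ne (h4.trans_lt hdn).ne',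
        max_eq_left (h4.trans_lt hdn).le]
      refine le_trans ?_ hdn.le
      rw [zpow_neg, one_div, pow_succ]
      gcongr
      have : (1 : ℝ) ≤ ((p : ℝ) ^ 2) ^ n := one_le_pow₀ (one_le_pow₀ hpr.le)
      have h5 : (0 : ℝ) < (p : ℝ) ^ 2 := by positivity
      norm_cast at this h5 ⊢
      nlinarith

/-- The base `p ^ 2` expansion of `p`-adic integers. -/
noncomputable def padicDigits (l : ℚ_[p]ˣ) (hl : (l : ℚ_[p]) = (p : ℚ_[p])⁻¹) :
    DigitExpansion ℚ_[p] l where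
  D := Fin (p ^ 2)
  fintype := inferInstance
  dig d := ((d : ℕ) : ℚ_[p]) / (p : ℚ_[p]) ^ 2
  cell := Metric.closedBall 0 1
  isCompact_cell := isCompact_closedBall _ _
  norm_le_one s hs := by simpa using hs
  exists_digit s hs := by
    have hp0 : (p : ℚ_[p]) ≠ 0 := by exact_mod_cast hp.out.ne_zero
    obtain ⟨m, hm, h⟩ := exists_nat_padic_approx s (by simpa using hs) 2
    refine ⟨⟨m, hm⟩, ?_⟩
    have e : (l : ℚ_[p]) ^ 2 * s - (m : ℚ_[p]) / (p : ℚ_[p]) ^ 2 = (p : ℚ_[p])⁻¹ ^ 2 * (s - m) := by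
      rw [hl]
      field_simp
    have hpr : (p : ℝ) ≠ 0 := by exact_mod_cast hp.out.ne_zero
    simp only [e]
    rw [mem_closedBall_zero_iff, norm_mul, norm_inv_p_sq]
    calc (p : ℝ) ^ 2 * ‖s - m‖ ≤ (p : ℝ) ^ 2 * (p : ℝ) ^ (-(2 : ℕ) : ℤ) := by gcongr
      _ = 1 := by rw [zpow_neg, zpow_natCast, mul_inv_cancel₀ (pow_ne_zero 2 hpr)]
  prog L ρ hρ := by
    rw [hl, norm_inv_p_sq]
    have hpr : (1 : ℝ) < p := by exact_mod_cast hp.out.one_lt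
    have hr : 0 < max L 1 := lt_of_lt_of_le one_pos (le_max_right _ _)
    obtain ⟨M, hM⟩ := pow_unbounded_of_one_lt (2 * (p : ℝ) ^ 2 * max L 1 / ρ) hpr
    refine ⟨max L 1, hr, p ^ M, fun r h1 h2 σ hσ => ?_⟩
    have hr0 : 0 < ‖r‖ := lt_of_lt_of_le hr h1
    have hrne : r ≠ 0 := norm_pos_iff.1 hr0
    obtain ⟨m, hm, h⟩ := exists_nat_padic_approx (σ / r) (by
      rw [norm_div, div_le_one hr0]
      exact hσ.trans ((le_max_left _ _).trans h1)) M
    refine ⟨m, ?_, ?_⟩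
    · rw [Nat.abs_cast]
      exact_mod_cast hm.le
    · have e : ((m : ℤ) : ℚ_[p]) * r - σ = -((σ / r - m) * r) := by
        push_cast
        field_simp
        ring
      rw [e, norm_neg, norm_mul]
      have hpM : (0 : ℝ) < (p : ℝ) ^ M := by positivity
      rw [zpow_neg, zpow_natCast] at h
      calc ‖σ / r - m‖ * ‖r‖ ≤ ((p : ℝ) ^ M)⁻¹ * (2 * (p : ℝ) ^ 2 * max L 1) :=
            mul_le_mul h h2 hr0.le (by positivity)
        _ < ρ := by
          rw [inv_mul_lt_iff₀ hpM]
          rwa [div_lt_iff₀ hρ] at hM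
  sep R := by
    rw [hl]
    refine exists_card_le_of_digitSum ?_ _ digitSum_padic_sep R
    rw [norm_inv_p_sq]
    have : 0 < p := hp.out.pos
    positivity

end PadicDigits

section Localization

variable (p : ℕ) [hp : Fact p.Prime]

/-- The ring `ℤ[1/p]`. -/
def zInvP : Subring ℚ where
  carrier := {r | ∃ n : ℕ, ∃ z : ℤ, r * (p : ℚ) ^ n = z}
  mul_mem' := by
    rintro a b ⟨n, z, h⟩ ⟨n', z', h'⟩
    refine ⟨n + n', z * z', ?_⟩
    push_cast
    rw [← h, ← h']
    ring
  one_mem' := ⟨0, 1, by simp⟩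
  add_mem' := by
    rintro a b ⟨n, z, h⟩ ⟨n', z', h'⟩
    refine ⟨n + n', z * p ^ n' + z' * p ^ n, ?_⟩
    push_cast
    rw [← h, ← h']
    ring
  zero_mem' := ⟨0, 0, by simp⟩
  neg_mem' := by
    rintro a ⟨n, z, h⟩
    refine ⟨n, -z, ?_⟩
    push_cast
    rw [← h]
    ring

variable {p}

lemma one_le_abs_mul_padicNorm {z : ℤ} (hz : z ≠ 0) : 1 ≤ |(z : ℝ)| * ‖(z : ℚ_[p])‖ := by
  have hpr : (0 : ℝ) < p := by exact_mod_cast hp.out.pos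
  have hz' : (z : ℚ_[p]) ≠ 0 := by exact_mod_cast hz
  have h1 := Padic.norm_eq_zpow_neg_valuation hz'
  have h2 : 0 ≤ (z : ℚ_[p]).valuation := by
    rw [Padic.valuation_intCast]
    positivity
  obtain ⟨v, hv⟩ := Int.eq_ofNat_of_zero_le h2
  rw [hv] at h1
  have h3 : ((p ^ v : ℕ) : ℤ) ∣ z := (Padic.norm_int_le_pow_iff_dvd z v).1 h1.le
  have h4 : ((p ^ v : ℕ) : ℤ) ≤ |z| := Int.le_of_dvd (abs_pos.2 hz) ((dvd_abs _ _).2 h3)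
  have h5 : (p : ℝ) ^ v ≤ |(z : ℝ)| := by exact_mod_cast h4
  rw [h1]
  have h6 : (0 : ℝ) < (p : ℝ) ^ v := by positivity
  change 1 ≤ |(z : ℝ)| * (p : ℝ) ^ (-(v : ℤ))
  rw [zpow_neg, zpow_natCast, ← div_eq_mul_inv, le_div_iff₀ h6]
  linarith

lemma one_le_of_mem_zInvP {r : ℚ} (hr : r ∈ zInvP p) (h0 : r ≠ 0) :
    1 ≤ |(r : ℝ)| * ‖(r : ℚ_[p])‖ := by
  obtain ⟨n, z, h⟩ := hr
  have hpr : (0 : ℝ) < p := by exact_mod_cast hp.out.pos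
  have hpq : (p : ℚ) ≠ 0 := by exact_mod_cast hp.out.ne_zero
  have hz : z ≠ 0 := by
    rintro rfl
    simp [hpq, h0] at h
  have h1 := one_le_abs_mul_padicNorm (p := p) hz
  have e1 : (z : ℝ) = (r : ℝ) * (p : ℝ) ^ n := by exact_mod_cast congrArg (Rat.cast (K := ℝ)) h.symm
  have e2 : (z : ℚ_[p]) = (r : ℚ_[p]) * (p : ℚ_[p]) ^ n := by
    exact_mod_cast congrArg (Rat.cast (K := ℚ_[p])) h.symm
  rw [e1, e2, abs_mul, norm_mul, Padic.norm_p_pow, abs_of_pos (by positivity : (0:ℝ) < (p:ℝ) ^ n),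
    zpow_neg, zpow_natCast] at h1
  have h6 : (0 : ℝ) < (p : ℝ) ^ n := by positivity
  calc 1 ≤ _ := h1
    _ = |(r : ℝ)| * ‖(r : ℚ_[p])‖ := by field_simp

variable (p)

/-- The arithmetic pair of the real and `p`-adic embeddings of `ℤ[1/p]`. -/
noncomputable def realPadic : ArithPair ℝ ℚ_[p] (zInvP p) where
  φ₁ := (Rat.castHom ℝ).comp (zInvP p).subtype
  φ₂ := (Rat.castHom ℚ_[p]).comp (zInvP p).subtype
  one_le r hr := one_le_of_mem_zInvP r.2 (by simpa using hr)
  l₁ := Units.mk0 (p : ℝ) (by exact_mod_cast hp.out.ne_zero)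
  l₂ := Units.mk0 (p : ℚ_[p])⁻¹ (inv_ne_zero (by exact_mod_cast hp.out.ne_zero))
  two_le₁ := by
    simp only [Units.val_mk0, Real.norm_natCast]
    exact_mod_cast hp.out.two_le
  two_le₂ := by
    simp only [Units.val_mk0, norm_inv, Padic.norm_p, inv_inv]
    exact_mod_cast hp.out.two_le

end Localization

section Reduction

lemma le_of_reduced {κ S T D : ℝ} (hκ : 0 < κ) (hS : 0 < S) (h1 : S ≤ T) (hST : S * T = D ^ 2 + 1)
    (h2 : |D| ≤ S / 2) (h3 : κ ^ 2 ≤ S) : S ≤ 2 + 1 / κ ^ 2 ∧ T ≤ 2 + 1 / κ ^ 2 := by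
  have h4 : D ^ 2 ≤ (S / 2) ^ 2 := sq_le_sq' (by linarith [neg_abs_le D]) (by linarith [le_abs_self D])
  have hmul : S * S ≤ S * T := mul_le_mul_of_nonneg_left h1 hS.le
  have h5 : S ≤ 2 := by nlinarith
  have hk : 0 < κ ^ 2 := by positivity
  have h6 : T ≤ S / 4 + 1 / S := by
    rw [← mul_le_mul_iff_right₀ hS]
    have : S * (S / 4 + 1 / S) = S ^ 2 / 4 + 1 := by field_simp
    linarith [show (S / 2) ^ 2 = S ^ 2 / 4 by ring]
  have h7 : 1 / S ≤ 1 / κ ^ 2 := one_div_le_one_div_of_le hk h3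
  constructor
  · linarith [show 0 < 1 / κ ^ 2 by positivity]
  · linarith

/-- Reduction theory for unimodular lattices in the plane without short vectors. -/
lemma exists_reduced_basis {κ : ℝ} (hκ : 0 < κ) (x₁ y₁ x₂ y₂ : ℝ) (hdet : x₁ * y₂ - x₂ * y₁ = 1)
    (hshort : ∀ a b : ℤ, (a ≠ 0 ∨ b ≠ 0) →
      κ ^ 2 ≤ (a * x₁ + b * x₂) ^ 2 + (a * y₁ + b * y₂) ^ 2) :
    ∃ a b c d : ℤ, a * d - b * c = 1 ∧
      (a * x₁ + c * x₂) ^ 2 + (a * y₁ + c * y₂) ^ 2 ≤ 2 + 1 / κ ^ 2 ∧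
      (b * x₁ + d * x₂) ^ 2 + (b * y₁ + d * y₂) ^ 2 ≤ 2 + 1 / κ ^ 2 := by
  set w₁ : ℂ := ⟨x₁, y₁⟩ with hw₁
  set w₂ : ℂ := ⟨x₂, y₂⟩ with hw₂
  have hne : w₁ ≠ 0 := by
    intro h
    have h1 := congrArg Complex.re h
    have h2 := congrArg Complex.im h
    simp [hw₁] at h1 h2
    rw [h1, h2] at hdet
    norm_num at hdet
  have hpos : 0 < (w₂ / w₁).im := by
    rw [Complex.div_im]
    have h0 : 0 < Complex.normSq w₁ := Complex.normSq_pos.2 hne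
    simp only [hw₁, hw₂] at h0 ⊢
    rw [← sub_div]
    apply div_pos _ h0
    linarith
  obtain ⟨g, hg⟩ := ModularGroup.exists_smul_mem_fd ⟨w₂ / w₁, hpos⟩
  set a := g 1 1 with ha
  set b := g 0 1 with hb
  set c := g 1 0 with hc
  set d := g 0 0 with hd
  have hgdet : d * a - b * c = 1 := by
    rw [ha, hb, hc, hd, ← Matrix.det_fin_two]; exact g.det_coe
  have hcoe : ((g • (⟨w₂ / w₁, hpos⟩ : UpperHalfPlane) : UpperHalfPlane) : ℂ) =
      (b * w₁ + d * w₂) / (a * w₁ + c * w₂) := by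
    rw [UpperHalfPlane.coe_specialLinearGroup_apply]
    simp only [← ha, ← hb, ← hc, ← hd, eq_intCast]
    push_cast
    rw [mul_div_assoc', mul_div_assoc', div_add' _ _ _ hne, div_add' _ _ _ hne,
      div_div_div_cancel_right₀ hne]
    ring_nf
  set X₁ := a * x₁ + c * x₂ with hX₁
  set Y₁ := a * y₁ + c * y₂ with hY₁
  set X₂ := b * x₁ + d * x₂ with hX₂
  set Y₂ := b * y₁ + d * y₂ with hY₂
  have hW₁ : (a * w₁ + c * w₂ : ℂ) = ⟨X₁, Y₁⟩ := by
    apply Complex.ext <;> simp [hw₁, hw₂, hX₁, hY₁]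
  have hW₂ : (b * w₁ + d * w₂ : ℂ) = ⟨X₂, Y₂⟩ := by
    apply Complex.ext <;> simp [hw₁, hw₂, hX₂, hY₂]
  rw [hW₁, hW₂] at hcoe
  have hD : X₁ * Y₂ - X₂ * Y₁ = 1 := by
    have : ((d * a - b * c : ℤ) : ℝ) = 1 := by rw [hgdet]; norm_num
    push_cast at this
    rw [hX₁, hX₂, hY₁, hY₂]
    linear_combination (x₁ * y₂ - x₂ * y₁) * this + hdet
  have hS : 0 < X₁ ^ 2 + Y₁ ^ 2 := by
    by_contra! h
    have e1 : X₁ = 0 := by nlinarith [sq_nonneg X₁, sq_nonneg Y₁]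
    have e2 : Y₁ = 0 := by nlinarith [sq_nonneg X₁, sq_nonneg Y₁]
    rw [e1, e2] at hD
    norm_num at hD
  have h1 : X₁ ^ 2 + Y₁ ^ 2 ≤ X₂ ^ 2 + Y₂ ^ 2 := by
    have := hg.1
    rw [hcoe, Complex.normSq_div, one_le_div₀ (by
      rw [Complex.normSq_mk]; nlinarith), Complex.normSq_mk, Complex.normSq_mk] at this
    nlinarith
  have h2 : |X₁ * X₂ + Y₁ * Y₂| ≤ (X₁ ^ 2 + Y₁ ^ 2) / 2 := by
    have := hg.2
    rw [← UpperHalfPlane.coe_re, hcoe, Complex.div_re, Complex.normSq_mk, ← add_div, abs_div,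
      abs_of_pos (by nlinarith : 0 < X₁ * X₁ + Y₁ * Y₁), div_le_iff₀ (by nlinarith)] at this
    have e : X₁ * X₂ + Y₁ * Y₂ = X₂ * X₁ + Y₂ * Y₁ := by ring
    rw [e]
    linarith
  have h3 : κ ^ 2 ≤ X₁ ^ 2 + Y₁ ^ 2 := by
    refine hshort a c ?_
    by_contra! h
    rw [h.1, h.2] at hgdet
    norm_num at hgdet
  refine ⟨a, b, c, d, by linarith, ?_⟩
  set S := X₁ ^ 2 + Y₁ ^ 2 with hSd
  set T := X₂ ^ 2 + Y₂ ^ 2 with hTd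
  have hST : S * T = (X₁ * X₂ + Y₁ * Y₂) ^ 2 + 1 := by
    have e : S * T = (X₁ * X₂ + Y₁ * Y₂) ^ 2 + (X₁ * Y₂ - X₂ * Y₁) ^ 2 := by rw [hSd, hTd]; ring
    rw [e, hD]; norm_num
  exact le_of_reduced hκ hS h1 hST h2 h3

end Reduction

section Height

variable {p : ℕ} [hp : Fact p.Prime]

/-- The product of the norms of the images of a rational vector. -/
noncomputable def heightProd (u : ℝ) (v : ℚ_[p]) (n k : ℤ) (x y : ℚ) : ℝ :=
  max ((p : ℝ) ^ n * |(x : ℝ) - u * y|) ((p : ℝ) ^ (-n) * |(y : ℝ)|) *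
    max ((p : ℝ) ^ k * ‖(x : ℚ_[p]) - v * y‖) ((p : ℝ) ^ (-k) * ‖(y : ℚ_[p])‖)

lemma heightProd_smul (u : ℝ) (v : ℚ_[p]) (n k : ℤ) (x y : ℚ) :
    heightProd u v n k (p * x) (p * y) = heightProd u v n k x y := by
  have hpr : (0 : ℝ) < p := by exact_mod_cast hp.out.pos
  have e1 : |((p * x : ℚ) : ℝ) - u * (p * y : ℚ)| = p * |(x : ℝ) - u * y| := by
    have : ((p * x : ℚ) : ℝ) - u * (p * y : ℚ) = p * ((x : ℝ) - u * y) := by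
      push_cast
      ring
    rw [this, abs_mul, abs_of_pos hpr]
  have e2 : |((p * y : ℚ) : ℝ)| = p * |(y : ℝ)| := by
    push_cast
    rw [abs_mul, abs_of_pos hpr]
  have e3 : ‖((p * x : ℚ) : ℚ_[p]) - v * (p * y : ℚ)‖ = (p : ℝ)⁻¹ * ‖(x : ℚ_[p]) - v * y‖ := by
    rw [← Padic.norm_p, ← norm_mul]
    push_cast
    ring_nf
  have e4 : ‖((p * y : ℚ) : ℚ_[p])‖ = (p : ℝ)⁻¹ * ‖(y : ℚ_[p])‖ := by
    push_cast
    rw [norm_mul, Padic.norm_p]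
  unfold heightProd
  rw [e1, e2, e3, e4]
  simp only [mul_left_comm _ (p : ℝ), mul_left_comm _ (p : ℝ)⁻¹]
  rw [← mul_max_of_nonneg _ _ hpr.le, ← mul_max_of_nonneg _ _ (inv_pos.2 hpr).le]
  field_simp

lemma mul_le_sq_max {a b t : ℝ} (ha : 0 ≤ a) (hb : 0 ≤ b) (ht : 0 < t) (n : ℤ) :
    a * b ≤ max (t ^ n * a) (t ^ (-n) * b) ^ 2 := by
  have h1 : 0 < t ^ n := zpow_pos ht n
  calc a * b = (t ^ n * a) * (t ^ (-n) * b) := by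
        rw [zpow_neg]; field_simp
    _ ≤ max (t ^ n * a) (t ^ (-n) * b) * max (t ^ n * a) (t ^ (-n) * b) :=
        mul_le_mul (le_max_left _ _) (le_max_right _ _) (by positivity)
          ((by positivity : 0 ≤ t ^ n * a).trans (le_max_left _ _))
    _ = _ := (sq _).symm

/-- Lower bound for badly approximable pairs: the condition. -/
def BadPair (c : ℝ) (u : ℝ) (v : ℚ_[p]) : Prop := ∀ q q₀ : ℤ, q ≠ 0 → q₀ ≠ 0 →
  c ≤ |(q : ℝ)| * |(q : ℝ) * u - q₀| * ‖(q : ℚ_[p]) * v - q₀‖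

lemma le_heightProd_of_primitive {c lam μ κ : ℝ} {u : ℝ} {v : ℚ_[p]} (hbad : BadPair c u v)
    (hlam : 0 < lam) (hlam1 : lam ≤ 1) (hv : ‖v‖ ≤ 1 / lam) (hκ : κ ^ 2 ≤ c * lam)
    (hκ1 : κ ≤ 1) (hκμ : κ ≤ μ) {n k : ℤ} (hk : 0 ≤ k) (hnk : 0 ≤ n + k)
    (h : k ≤ n ∧ μ ≤ |u| ∨ n ≤ k ∧ μ ≤ ‖v‖) {x y : ℤ} (hxy : ¬ ((p : ℤ) ∣ x ∧ (p : ℤ) ∣ y)) :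
    κ ≤ heightProd u v n k x y := by
  have hpr : (0 : ℝ) < p := by exact_mod_cast hp.out.pos
  have hp1 : (1 : ℝ) ≤ p := by exact_mod_cast hp.out.one_lt.le
  have unit_norm : ∀ z : ℤ, ¬ (p : ℤ) ∣ z → ‖(z : ℚ_[p])‖ = 1 := by
    intro z hz
    refine le_antisymm (Padic.norm_int_le_one z) (not_lt.1 fun h => hz ?_)
    exact Padic.norm_intCast_lt_one_iff.1 h
  have one_le : ∀ z : ℤ, z ≠ 0 → (1 : ℝ) ≤ |(z : ℝ)| := by
    intro z hz
    exact_mod_cast Int.one_le_abs hz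
  unfold heightProd
  simp only [Rat.cast_intCast]
  set A := (p : ℝ) ^ n * |(x : ℝ) - u * y| with hA
  set B := (p : ℝ) ^ (-n) * |(y : ℝ)| with hB
  set A' := (p : ℝ) ^ k * ‖(x : ℚ_[p]) - v * y‖ with hA'
  set B' := (p : ℝ) ^ (-k) * ‖(y : ℚ_[p])‖ with hB'
  have hA0 : 0 ≤ A := by positivity
  have hA'0 : 0 ≤ A' := by positivity
  have hB0 : 0 ≤ B := by positivity
  have hB'0 : 0 ≤ B' := by positivity
  have hM0 : 0 ≤ max A B := hA0.trans (le_max_left _ _)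
  have hM'0 : 0 ≤ max A' B' := hA'0.trans (le_max_left _ _)
  rcases eq_or_ne y 0 with rfl | hy
  · have hx : ¬ (p : ℤ) ∣ x := fun h => hxy ⟨h, dvd_zero _⟩
    have hx0 : x ≠ 0 := by rintro rfl; exact hx (dvd_zero _)
    calc κ ≤ 1 := hκ1
      _ ≤ (p : ℝ) ^ (n + k) := one_le_zpow₀ hp1 hnk
      _ = (p : ℝ) ^ n * 1 * ((p : ℝ) ^ k * 1) := by rw [zpow_add₀ hpr.ne']; ring
      _ ≤ A * A' := by
        rw [hA, hA']
        simp only [Int.cast_zero, mul_zero, sub_zero, unit_norm x hx]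
        gcongr
        exact one_le x hx0
      _ ≤ _ := mul_le_mul (le_max_left _ _) (le_max_left _ _) hA'0 hM0
  rcases eq_or_ne x 0 with rfl | hx
  · have hyd : ¬ (p : ℤ) ∣ y := fun h => hxy ⟨dvd_zero _, h⟩
    have h1 := one_le y hy
    have h2 := unit_norm y hyd
    rcases h with ⟨hkn, hu⟩ | ⟨hkn, hvμ⟩
    · calc κ ≤ |u| := hκμ.trans hu
        _ ≤ (p : ℝ) ^ (n - k) * |u| :=
          le_mul_of_one_le_left (abs_nonneg _) (one_le_zpow₀ hp1 (by linarith))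
        _ = ((p : ℝ) ^ n * (|u| * 1)) * ((p : ℝ) ^ (-k) * 1) := by
          rw [zpow_sub₀ hpr.ne', zpow_neg]; ring
        _ ≤ A * B' := by
          rw [hA, hB', h2]
          simp only [Int.cast_zero, zero_sub, abs_neg, abs_mul]
          gcongr
        _ ≤ _ := mul_le_mul (le_max_left _ _) (le_max_right _ _) hB'0 hM0
    · calc κ ≤ ‖v‖ := hκμ.trans hvμ
        _ ≤ (p : ℝ) ^ (k - n) * ‖v‖ :=
          le_mul_of_one_le_left (norm_nonneg _) (one_le_zpow₀ hp1 (by linarith))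
        _ = ((p : ℝ) ^ (-n) * 1) * ((p : ℝ) ^ k * (‖v‖ * 1)) := by
          rw [zpow_sub₀ hpr.ne', zpow_neg]; ring
        _ ≤ B * A' := by
          rw [hB, hA']
          simp only [Int.cast_zero, zero_sub, norm_neg, norm_mul, h2]
          gcongr
        _ ≤ _ := mul_le_mul (le_max_right _ _) (le_max_left _ _) hA'0 hM0
  · have h1 := hbad y x hy hx
    have h2 : |(x : ℝ) - u * y| * |(y : ℝ)| ≤ max A B ^ 2 :=
      mul_le_sq_max (abs_nonneg _) (abs_nonneg _) hpr n
    have h3 : lam * ‖(x : ℚ_[p]) - v * y‖ ≤ max A' B' ^ 2 := by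
      by_cases hyl : lam ≤ ‖(y : ℚ_[p])‖
      · refine le_trans ?_ (mul_le_sq_max (norm_nonneg _) (norm_nonneg _) hpr k)
        rw [mul_comm]
        gcongr
      · push Not at hyl
        have hyd : (p : ℤ) ∣ y := Padic.norm_intCast_lt_one_iff.1 (hyl.trans_le hlam1)
        have hx1 := unit_norm x fun h => hxy ⟨h, hyd⟩
        have hvy : ‖v * y‖ < 1 := by
          rw [norm_mul]
          calc ‖v‖ * ‖(y : ℚ_[p])‖ ≤ 1 / lam * ‖(y : ℚ_[p])‖ := by gcongr
            _ < 1 / lam * lam := by gcongr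
            _ = 1 := by field_simp
        have e : ‖(x : ℚ_[p]) - v * y‖ = 1 := by
          rw [sub_eq_add_neg, Padic.add_eq_max_of_ne (by rw [norm_neg, hx1]; exact hvy.ne'),
            norm_neg, hx1, max_eq_left hvy.le]
        rw [e, mul_one]
        have h4 : 1 ≤ max A' B' := by
          refine le_trans ?_ (le_max_left _ _)
          rw [hA', e, mul_one]
          exact one_le_zpow₀ hp1 hk
        nlinarith
    have e1 : |(y : ℝ) * u - x| = |(x : ℝ) - u * y| := by rw [abs_sub_comm, mul_comm]
    have e2 : ‖(y : ℚ_[p]) * v - x‖ = ‖(x : ℚ_[p]) - v * y‖ := by rw [norm_sub_rev, mul_comm]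
    rw [e1, e2] at h1
    refine le_of_sq_le_sq ?_ (mul_nonneg hM0 hM'0)
    calc κ ^ 2 ≤ c * lam := hκ
      _ ≤ |(y : ℝ)| * |(x : ℝ) - u * y| * ‖(x : ℚ_[p]) - v * y‖ * lam := by gcongr
      _ = (|(x : ℝ) - u * y| * |(y : ℝ)|) * (lam * ‖(x : ℚ_[p]) - v * y‖) := by ring
      _ ≤ max A B ^ 2 * max A' B' ^ 2 := by gcongr
      _ = _ := by ring

lemma le_heightProd_of_int {κ : ℝ} {u : ℝ} {v : ℚ_[p]} {n k : ℤ}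
    (h : ∀ x y : ℤ, ¬ ((p : ℤ) ∣ x ∧ (p : ℤ) ∣ y) → κ ≤ heightProd u v n k x y)
    {x y : ℤ} (hxy : x ≠ 0 ∨ y ≠ 0) : κ ≤ heightProd u v n k x y := by
  induction hm : x.natAbs + y.natAbs using Nat.strong_induction_on generalizing x y with
  | _ m ih =>
    by_cases hd : (p : ℤ) ∣ x ∧ (p : ℤ) ∣ y
    · obtain ⟨⟨x', rfl⟩, ⟨y', rfl⟩⟩ := hd
      have hxy' : x' ≠ 0 ∨ y' ≠ 0 := by
        refine hxy.imp ?_ ?_ <;> exact right_ne_zero_of_mul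
      have hlt : x'.natAbs + y'.natAbs < m := by
        rw [← hm, Int.natAbs_mul, Int.natAbs_mul, Int.natAbs_natCast, ← mul_add]
        have : 0 < x'.natAbs + y'.natAbs := by omega
        exact lt_mul_of_one_lt_left this hp.out.one_lt
      have := ih _ hlt hxy' rfl
      push_cast
      rwa [heightProd_smul]
    · exact h x y hd

lemma le_heightProd_of_mem {κ : ℝ} {u : ℝ} {v : ℚ_[p]} {n k : ℤ}
    (h : ∀ x y : ℤ, ¬ ((p : ℤ) ∣ x ∧ (p : ℤ) ∣ y) → κ ≤ heightProd u v n k x y)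
    {x y : ℚ} (hx : x ∈ zInvP p) (hy : y ∈ zInvP p) (hxy : x ≠ 0 ∨ y ≠ 0) :
    κ ≤ heightProd u v n k x y := by
  have hpq : (p : ℚ) ≠ 0 := by exact_mod_cast hp.out.ne_zero
  obtain ⟨N, z, hz⟩ := hx
  obtain ⟨M, w, hw⟩ := hy
  have hpow : ∀ (m : ℕ) (x y : ℚ), heightProd u v n k ((p : ℚ) ^ m * x) ((p : ℚ) ^ m * y) =
      heightProd u v n k x y := by
    intro m
    induction m with
    | zero => simp
    | succ m ih =>
      intro x y
      rw [pow_succ', mul_assoc, mul_assoc, heightProd_smul, ih]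
  rw [← hpow (N + M)]
  have e1 : (p : ℚ) ^ (N + M) * x = ((z * p ^ M : ℤ) : ℚ) := by
    push_cast; rw [← hz]; ring
  have e2 : (p : ℚ) ^ (N + M) * y = ((w * p ^ N : ℤ) : ℚ) := by
    push_cast; rw [← hw]; ring
  rw [e1, e2]
  apply le_heightProd_of_int h
  have hpz : (p : ℤ) ≠ 0 := by exact_mod_cast hp.out.ne_zero
  refine hxy.imp (fun hx => ?_) fun hy => ?_
  · have : (z : ℚ) ≠ 0 := by rw [← hz]; positivity
    exact mul_ne_zero (by exact_mod_cast this) (pow_ne_zero _ hpz)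
  · have : (w : ℚ) ≠ 0 := by rw [← hw]; positivity
    exact mul_ne_zero (by exact_mod_cast this) (pow_ne_zero _ hpz)

end Height

section OrbitBound

lemma pow_mem_zInvP (p k : ℕ) : (p : ℚ) ^ k ∈ zInvP p := ⟨0, p ^ k, by simp⟩

variable {p : ℕ} [hp : Fact p.Prime]

lemma exists_mem_zInvP_near (v : ℚ_[p]) (k : ℕ) :
    ∃ V ∈ zInvP p, ‖(V : ℚ_[p]) - v‖ ≤ (p : ℝ) ^ (-(k : ℤ)) := by
  have hpr : (1 : ℝ) < p := by exact_mod_cast hp.out.one_lt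
  have hpr0 : (0 : ℝ) < p := by linarith
  have hpp : (p : ℚ_[p]) ≠ 0 := by exact_mod_cast hp.out.ne_zero
  have hpq : (p : ℚ) ≠ 0 := by exact_mod_cast hp.out.ne_zero
  obtain ⟨l, hl⟩ := pow_unbounded_of_one_lt ‖v‖ hpr
  have hv : ‖(p : ℚ_[p]) ^ l * v‖ ≤ 1 := by
    rw [norm_mul, Padic.norm_p_pow, zpow_neg, zpow_natCast, inv_mul_le_iff₀ (by positivity), mul_one]
    exact hl.le
  obtain ⟨m, -, hm⟩ := exists_nat_padic_approx _ hv (k + l)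
  refine ⟨m / (p : ℚ) ^ l, ⟨l, m, by field_simp; simp⟩, ?_⟩
  have e : (((m : ℚ) / (p : ℚ) ^ l : ℚ) : ℚ_[p]) - v =
      -(((p : ℚ_[p]) ^ l)⁻¹ * ((p : ℚ_[p]) ^ l * v - m)) := by
    push_cast
    field_simp
    ring
  rw [e, norm_neg, norm_mul, norm_inv, Padic.norm_p_pow, zpow_neg, inv_inv]
  calc (p : ℝ) ^ (l : ℤ) * _ ≤ (p : ℝ) ^ (l : ℤ) * (p : ℝ) ^ (-((k + l : ℕ) : ℤ)) := by gcongr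
    _ = _ := by rw [← zpow_add₀ hpr0.ne']; congr 1; push_cast; ring

lemma coe_dia_zpow {k : Type} [NormedField k] (l : kˣ) (n : ℤ) :
    ((dia l ^ n : SL(2, k)) : Matrix (Fin 2) (Fin 2) k) =
      !![(l : k) ^ n, 0; 0, (l : k) ^ (-n)] := by
  rcases Int.eq_nat_or_neg n with ⟨m, rfl | rfl⟩
  · rw [zpow_natCast, ArithPair.coe_dia_pow]
    simp
  · rw [zpow_neg, ← inv_zpow, ← dia_inv, zpow_natCast, ArithPair.coe_dia_pow]
    simp

lemma dia_zpow_unip_mul_apply {k : Type} [NormedField k] (l : kˣ) (n : ℤ) (s : k) (g : SL(2, k))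
    (j : Fin 2) :
    (dia l ^ n * unip s * g) 0 j = (l : k) ^ n * (g 0 j + s * g 1 j) ∧
      (dia l ^ n * unip s * g) 1 j = (l : k) ^ (-n) * g 1 j := by
  constructor <;>
    rw [Matrix.SpecialLinearGroup.coe_mul, Matrix.SpecialLinearGroup.coe_mul, coe_dia_zpow,
      coe_unip] <;>
    simp [Matrix.mul_apply, Fin.sum_univ_two]
  ring

lemma ArithPair.orb_of_entries {k₁ k₂ R : Type} [NormedField k₁] [NormedField k₂] [CommRing R]
    (P : ArithPair k₁ k₂ R) {C : ℝ} {s : k₁} {t : k₂} {n m : ℤ} {x x' y y' : R}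
    (hdet : x * y' - x' * y = 1)
    (h₁ : ‖(P.l₁ : k₁) ^ n * (P.φ₁ x + s * P.φ₁ y)‖ ≤ C)
    (h₂ : ‖(P.l₁ : k₁) ^ n * (P.φ₁ x' + s * P.φ₁ y')‖ ≤ C)
    (h₃ : ‖(P.l₁ : k₁) ^ (-n) * P.φ₁ y‖ ≤ C) (h₄ : ‖(P.l₁ : k₁) ^ (-n) * P.φ₁ y'‖ ≤ C)
    (h₅ : ‖(P.l₂ : k₂) ^ m * (P.φ₂ x + t * P.φ₂ y)‖ ≤ C)
    (h₆ : ‖(P.l₂ : k₂) ^ m * (P.φ₂ x' + t * P.φ₂ y')‖ ≤ C)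
    (h₇ : ‖(P.l₂ : k₂) ^ (-m) * P.φ₂ y‖ ≤ C) (h₈ : ‖(P.l₂ : k₂) ^ (-m) * P.φ₂ y'‖ ≤ C) :
    P.Orb C s t n m := by
  refine ⟨⟨!![x, x'; y, y'], by rw [Matrix.det_fin_two_of, hdet]⟩, fun i j => ?_, fun i j => ?_⟩
  · have e := dia_zpow_unip_mul_apply P.l₁ n s
    fin_cases i <;> fin_cases j
    · exact (congrArg norm (e _ 0).1).trans_le h₁
    · exact (congrArg norm (e _ 1).1).trans_le h₂
    · exact (congrArg norm (e _ 0).2).trans_le h₃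
    · exact (congrArg norm (e _ 1).2).trans_le h₄
  · have e := dia_zpow_unip_mul_apply P.l₂ m t
    fin_cases i <;> fin_cases j
    · exact (congrArg norm (e _ 0).1).trans_le h₅
    · exact (congrArg norm (e _ 1).1).trans_le h₆
    · exact (congrArg norm (e _ 0).2).trans_le h₇
    · exact (congrArg norm (e _ 1).2).trans_le h₈

lemma inv_pow_mem_zInvP (k : ℕ) : ((p : ℚ) ^ k)⁻¹ ∈ zInvP p := by
  have hpq : (p : ℚ) ≠ 0 := by exact_mod_cast hp.out.ne_zero
  exact ⟨k, 1, by field_simp; simp⟩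

lemma norm_add_mul_int_le_one {w : ℚ_[p]} (hw : ‖w‖ ≤ 1) (a c : ℤ) :
    ‖(a : ℚ_[p]) + w * c‖ ≤ 1 := by
  refine (Padic.nonarchimedean _ _).trans (max_le (Padic.norm_int_le_one a) ?_)
  rw [norm_mul]
  exact mul_le_one₀ hw (norm_nonneg _) (Padic.norm_int_le_one c)

theorem orb_of_le_heightProd {κ : ℝ} (hκ : 0 < κ) {u : ℝ} {v : ℚ_[p]} {n : ℤ} {k : ℕ}
    (h : ∀ x y : ℤ, ¬ ((p : ℤ) ∣ x ∧ (p : ℤ) ∣ y) → κ ≤ heightProd u v n k x y) :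
    (realPadic p).Orb (2 + 1 / κ) (-u) (-v) n k := by
  have hpr : (0 : ℝ) < p := by exact_mod_cast hp.out.pos
  have hpp : (p : ℚ_[p]) ≠ 0 := by exact_mod_cast hp.out.ne_zero
  have hpq : (p : ℚ) ≠ 0 := by exact_mod_cast hp.out.ne_zero
  obtain ⟨V, hV, hVv⟩ := exists_mem_zInvP_near v (2 * k)
  set X : ℤ → ℤ → ℚ := fun a c => (p : ℚ) ^ k * a + ((p : ℚ) ^ k)⁻¹ * V * c with hX
  set Y : ℤ → ℚ := fun c => ((p : ℚ) ^ k)⁻¹ * c with hY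
  have hXm : ∀ a c, X a c ∈ zInvP p := fun a c =>
    add_mem (mul_mem (pow_mem_zInvP p k) (intCast_mem _ a))
      (mul_mem (mul_mem (inv_pow_mem_zInvP k) hV) (intCast_mem _ c))
  have hYm : ∀ c, Y c ∈ zInvP p := fun c => mul_mem (inv_pow_mem_zInvP k) (intCast_mem _ c)
  set w : ℚ_[p] := ((p : ℚ_[p]) ^ (2 * k))⁻¹ * (V - v) with hw
  have hw1 : ‖w‖ ≤ 1 := by
    rw [hw, norm_mul, norm_inv, Padic.norm_p_pow, inv_mul_le_iff₀ (zpow_pos hpr _), mul_one]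
    exact hVv
  have hXp : ∀ a c : ℤ, (X a c : ℚ_[p]) - v * (Y c : ℚ_[p]) = (p : ℚ_[p]) ^ k * (a + w * c) := by
    intro a c
    rw [hX, hY, hw]
    push_cast
    field_simp
    ring
  have hYp : ∀ c : ℤ, (Y c : ℚ_[p]) = ((p : ℚ_[p]) ^ k)⁻¹ * c := by
    intro c
    rw [hY]
    push_cast
    rfl
  obtain ⟨a, b, c, d, hdet, h1, h2⟩ := exists_reduced_basis hκ ((p : ℝ) ^ n * (p : ℝ) ^ k) 0
    ((p : ℝ) ^ n * (((p : ℝ) ^ k)⁻¹ * V - u * ((p : ℝ) ^ k)⁻¹)) ((p : ℝ) ^ (-n) * ((p : ℝ) ^ k)⁻¹)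
    (by rw [zpow_neg]; field_simp; ring) (by
      intro a c hac
      have hne : X a c ≠ 0 ∨ Y c ≠ 0 := by
        by_cases hc : c = 0
        · left
          have ha : a ≠ 0 := hac.resolve_right (by simp [hc])
          simp [hX, hc, ha, hpq]
        · right
          simp [hY, hc, hpq]
      have h3 := le_heightProd_of_mem h (hXm a c) (hYm c) hne
      unfold heightProd at h3
      rw [hXp, hYp, norm_mul, norm_mul, norm_inv, Padic.norm_p_pow] at h3
      have e1 : (p : ℝ) ^ (k : ℤ) * ((p : ℝ) ^ (-(k : ℤ)) * ‖(a : ℚ_[p]) + w * c‖) ≤ 1 := by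
        rw [zpow_neg, mul_inv_cancel_left₀ (zpow_pos hpr _).ne']
        exact norm_add_mul_int_le_one hw1 a c
      have e2 : (p : ℝ) ^ (-(k : ℤ)) * (((p : ℝ) ^ (-(k : ℤ)))⁻¹ * ‖(c : ℚ_[p])‖) ≤ 1 := by
        rw [mul_inv_cancel_left₀ (zpow_pos hpr _).ne']
        exact Padic.norm_int_le_one c
      have h4 := h3.trans (mul_le_of_le_one_right
        ((by positivity : (0:ℝ) ≤ _).trans (le_max_right _ _)) (max_le e1 e2))
      have g1 : (a : ℝ) * ((p : ℝ) ^ n * (p : ℝ) ^ k) +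
          c * ((p : ℝ) ^ n * (((p : ℝ) ^ k)⁻¹ * V - u * ((p : ℝ) ^ k)⁻¹)) =
          (p : ℝ) ^ n * ((X a c : ℝ) - u * Y c) := by
        rw [hX, hY]; push_cast; ring
      have g2 : (a : ℝ) * 0 + c * ((p : ℝ) ^ (-n) * ((p : ℝ) ^ k)⁻¹) = (p : ℝ) ^ (-n) * (Y c : ℝ) := by
        rw [hY]; push_cast; ring
      rw [g1, g2]
      rcases le_max_iff.1 h4 with h5 | h5
      · have : κ ^ 2 ≤ ((p : ℝ) ^ n * |(X a c : ℝ) - u * Y c|) ^ 2 := by gcongr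
        rw [mul_pow, sq_abs, ← mul_pow] at this
        exact this.trans (le_add_of_nonneg_right (sq_nonneg _))
      · have : κ ^ 2 ≤ ((p : ℝ) ^ (-n) * |(Y c : ℝ)|) ^ 2 := by gcongr
        rw [mul_pow, sq_abs, ← mul_pow] at this
        exact this.trans (le_add_of_nonneg_left (sq_nonneg _)))
  have key : ∀ (a c : ℤ), ((a : ℝ) * ((p : ℝ) ^ n * (p : ℝ) ^ k) +
          c * ((p : ℝ) ^ n * (((p : ℝ) ^ k)⁻¹ * V - u * ((p : ℝ) ^ k)⁻¹))) ^ 2 +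
          ((a : ℝ) * 0 + c * ((p : ℝ) ^ (-n) * ((p : ℝ) ^ k)⁻¹)) ^ 2 ≤ 2 + 1 / κ ^ 2 →
      (‖(p : ℝ) ^ n * ((X a c : ℝ) + -u * Y c)‖ ≤ 2 + 1 / κ ∧
        ‖(p : ℝ) ^ (-n) * (Y c : ℝ)‖ ≤ 2 + 1 / κ) ∧
      ‖((p : ℚ_[p])⁻¹) ^ (k : ℤ) * ((X a c : ℚ_[p]) + -v * Y c)‖ ≤ 2 + 1 / κ ∧
        ‖((p : ℚ_[p])⁻¹) ^ (-(k : ℤ)) * (Y c : ℚ_[p])‖ ≤ 2 + 1 / κ := by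
    intro a c h
    have g1 : (a : ℝ) * ((p : ℝ) ^ n * (p : ℝ) ^ k) +
        c * ((p : ℝ) ^ n * (((p : ℝ) ^ k)⁻¹ * V - u * ((p : ℝ) ^ k)⁻¹)) =
        (p : ℝ) ^ n * ((X a c : ℝ) + -u * Y c) := by
      rw [hX, hY]; push_cast; ring
    have g2 : (a : ℝ) * 0 + c * ((p : ℝ) ^ (-n) * ((p : ℝ) ^ k)⁻¹) = (p : ℝ) ^ (-n) * (Y c : ℝ) := by
      rw [hY]; push_cast; ring
    rw [g1, g2] at h
    have hC : 0 < 1 / κ := by positivity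
    have hC2 : 1 / κ ^ 2 = (1 / κ) ^ 2 := by simp
    rw [hC2] at h
    have hone : (1 : ℝ) ≤ 2 + 1 / κ := by linarith
    refine ⟨⟨?_, ?_⟩, ?_, ?_⟩
    · exact abs_le_of_sq_le_sq (by nlinarith [sq_nonneg ((p : ℝ) ^ (-n) * (Y c : ℝ))])
        (by linarith)
    · exact abs_le_of_sq_le_sq
        (by nlinarith [sq_nonneg ((p : ℝ) ^ n * ((X a c : ℝ) + -u * Y c))]) (by linarith)
    · rw [neg_mul, ← sub_eq_add_neg, hXp, zpow_natCast, inv_pow,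
        inv_mul_cancel_left₀ (pow_ne_zero _ hpp)]
      exact (norm_add_mul_int_le_one hw1 a c).trans hone
    · rw [hYp, zpow_neg, zpow_natCast, inv_pow, inv_inv, mul_inv_cancel_left₀ (pow_ne_zero _ hpp)]
      exact (Padic.norm_int_le_one c).trans hone
  have k1 := key a c h1
  have k2 := key b d h2
  refine ArithPair.orb_of_entries (realPadic p) (x := ⟨X a c, hXm a c⟩) (x' := ⟨X b d, hXm b d⟩)
    (y := ⟨Y c, hYm c⟩) (y' := ⟨Y d, hYm d⟩) ?_ k1.1.1 k2.1.1 k1.1.2 k2.1.2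
    k1.2.1 k2.2.1 k1.2.2 k2.2.2
  apply Subtype.ext
  have : (a * d - b * c : ℚ) = 1 := by exact_mod_cast hdet
  change X a c * Y d - X b d * Y c = 1
  rw [← this]
  simp only [hX, hY]
  field_simp
  ring

/-- Bad pairs have bounded orbits in a cone. -/
theorem BadPair.orb {c lam μ : ℝ} (hc : 0 < c) (hlam : 0 < lam) (hlam1 : lam ≤ 1) (hμ : 0 < μ) :
    ∃ C : ℝ, 1 ≤ C ∧ ∀ (u : ℝ) (v : ℚ_[p]), BadPair c u v → ‖v‖ ≤ 1 / lam → ∀ n k : ℤ, 0 ≤ k →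
      0 ≤ n + k → (k ≤ n ∧ μ ≤ |u| ∨ n ≤ k ∧ μ ≤ ‖v‖) → (realPadic p).Orb C (-u) (-v) n k := by
  set κ := min (min 1 μ) (c * lam) with hκ
  have hκ0 : 0 < κ := lt_min (lt_min one_pos hμ) (mul_pos hc hlam)
  have h1 : κ ≤ 1 := (min_le_left _ _).trans (min_le_left _ _)
  have h2 : κ ≤ μ := (min_le_left _ _).trans (min_le_right _ _)
  have h3 : κ ≤ c * lam := min_le_right _ _
  refine ⟨2 + 1 / κ, by linarith [(by positivity : 0 < 1 / κ)], ?_⟩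
  intro u v hbad hv n k hk hnk h
  lift k to ℕ using hk
  refine orb_of_le_heightProd hκ0 fun x y hxy => ?_
  exact le_heightProd_of_primitive hbad hlam hlam1 hv (by nlinarith) h1 h2 (by positivity) hnk h hxy

end OrbitBound

lemma exists_maximal_separated {Z k : Type*} [PseudoMetricSpace k] (f : Z → k) (S : Set Z)
    {r M : ℝ} (hM : ∀ G : Finset Z, ↑G ⊆ S →
      (∀ g ∈ G, ∀ g' ∈ G, g ≠ g' → r ≤ dist (f g) (f g')) → (G.card : ℝ) < M) (hr : 0 < r) :
    ∃ G : Finset Z, ↑G ⊆ S ∧ (G.card : ℝ) < M ∧ ∀ z ∈ S, ∃ g ∈ G, dist (f z) (f g) < r := by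
  classical
  set T : Set ℕ := {n | ∃ G : Finset Z, ↑G ⊆ S ∧
    (∀ g ∈ G, ∀ g' ∈ G, g ≠ g' → r ≤ dist (f g) (f g')) ∧ G.card = n} with hT
  have hne : T.Nonempty := ⟨0, ∅, by simp, by simp, by simp⟩
  have hbd : BddAbove T := by
    refine ⟨⌈M⌉₊, ?_⟩
    rintro n ⟨G, h1, h2, rfl⟩
    exact_mod_cast (hM G h1 h2).le.trans (Nat.le_ceil M)
  obtain ⟨G, h1, h2, h3⟩ := Nat.sSup_mem hne hbd
  refine ⟨G, h1, hM G h1 h2, fun z hz => ?_⟩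
  by_contra! hcon
  have hzG : z ∉ G := fun h => by
    have := hcon z h
    rw [dist_self] at this
    linarith
  have : (insert z G).card ∈ T := by
    refine ⟨insert z G, ?_, ?_, rfl⟩
    · rw [Finset.coe_insert]
      exact insert_subset hz h1
    · intro g hg g' hg' hne'
      rcases Finset.mem_insert.1 hg with rfl | hgG <;> rcases Finset.mem_insert.1 hg' with rfl | hgG'
      · exact absurd rfl hne'
      · exact hcon g' hgG'
      · rw [dist_comm]; exact hcon g hgG
      · exact h2 g hgG g' hgG' hne'
  have h4 := le_csSup hbd this
  rw [Finset.card_insert_of_notMem hzG, ← h3] at h4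
  omega

section Boxes

variable (p : ℕ) [hp : Fact p.Prime]

/-- The box of level `i` with corner `f`. -/
def levelBox (i : ℕ) (f : ℝ × ℚ_[p]) : Set (ℝ × ℚ_[p]) :=
  {z | z.1 ∈ Icc f.1 (f.1 + ((p : ℝ) ^ (4 * i))⁻¹) ∧ ‖z.2 - f.2‖ ≤ ((p : ℝ) ^ (2 * i))⁻¹}

/-- The set `A` is covered by at most `K` boxes of level `i`. -/
def BoxCover (A : Set (ℝ × ℚ_[p])) (i : ℕ) (K : ℝ) : Prop :=
  ∃ F : Finset (ℝ × ℚ_[p]), (F.card : ℝ) ≤ K ∧ A ⊆ ⋃ f ∈ F, levelBox p i f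

/-- Boxes meet `A` in sets whose real projections are covered by few short intervals. -/
def RealRefine (A : Set (ℝ × ℚ_[p])) : Prop := ∀ δ : ℝ, 0 < δ → ∃ N : ℕ, ∀ L ≥ N,
  ∀ᶠ i : ℕ in atTop, ∀ f : ℝ × ℚ_[p], ∃ G : Finset (ℝ × ℚ_[p]), (G.card : ℝ) ≤ Real.exp (δ * L) ∧
    ∀ z ∈ A ∩ levelBox p i f, ∃ g ∈ G, |z.1 - g.1| ≤ 3 * ((p : ℝ) ^ (4 * (i + L)))⁻¹

/-- Boxes meet `A` in sets whose `p`-adic projections are covered by few small balls. -/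
def PadicRefine (A : Set (ℝ × ℚ_[p])) : Prop := ∀ δ : ℝ, 0 < δ → ∃ N : ℕ, ∀ L ≥ N,
  ∀ᶠ i : ℕ in atTop, ∀ f : ℝ × ℚ_[p], ∃ G : Finset (ℝ × ℚ_[p]), (G.card : ℝ) ≤ Real.exp (δ * L) ∧
    ∀ z ∈ A ∩ levelBox p i f, ∃ g ∈ G, ‖z.2 - g.2‖ ≤ ((p : ℝ) ^ (2 * (i + L)))⁻¹

/-- The set `A` is covered by subexponentially many balls of radius `p ^ (-2 i)`. -/
def SubexpCover {Z : Type*} [PseudoMetricSpace Z] (q : ℝ) (A : Set Z) : Prop :=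
  ∀ ε : ℝ, 0 < ε → ∀ᶠ i : ℕ in atTop, ∃ F : Finset Z, (F.card : ℝ) ≤ Real.exp (ε * i) ∧
    A ⊆ ⋃ f ∈ F, Metric.closedBall f (q ^ i)⁻¹

variable {p}

lemma exists_boxCover {A : Set (ℝ × ℚ_[p])} (hA : Bornology.IsBounded A) (i : ℕ) :
    ∃ K : ℝ, 0 ≤ K ∧ BoxCover p A i K := by
  have hpr : (0 : ℝ) < p := by exact_mod_cast hp.out.pos
  have hq : (0 : ℝ) < ((p : ℝ) ^ (4 * i))⁻¹ := by positivity
  have hq2 : (0 : ℝ) < ((p : ℝ) ^ (2 * i))⁻¹ := by positivity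
  obtain ⟨R, hR⟩ := hA.subset_closedBall 0
  classical
  set cor : ℝ × ℚ_[p] → ℝ × ℚ_[p] := fun z => (z.1 - ((p : ℝ) ^ (4 * i))⁻¹ / 2, z.2) with hcor
  obtain ⟨t, -, ht⟩ := (isCompact_closedBall (0 : ℝ × ℚ_[p]) R).elim_nhds_subcover
    (fun z => levelBox p i (cor z)) (by
      rintro ⟨a, b⟩ -
      have h1 : Icc (a - ((p : ℝ) ^ (4 * i))⁻¹ / 2)
          (a - ((p : ℝ) ^ (4 * i))⁻¹ / 2 + ((p : ℝ) ^ (4 * i))⁻¹) ∈ 𝓝 a :=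
        Icc_mem_nhds (by linarith) (by linarith)
      have h2 := Metric.closedBall_mem_nhds b hq2
      filter_upwards [prod_mem_nhds h1 h2] with z hz
      exact ⟨hz.1, by simpa [hcor, dist_eq_norm] using hz.2⟩)
  refine ⟨t.card, by positivity, t.image cor, by exact_mod_cast Finset.card_image_le, ?_⟩
  refine (hR.trans ht).trans ?_
  intro z hz
  simp only [mem_iUnion, Finset.mem_image] at hz ⊢
  obtain ⟨f, hf, hzf⟩ := hz
  exact ⟨cor f, ⟨f, hf, rfl⟩, hzf⟩

lemma exists_mem_Icc_of_abs_le {a b h : ℝ} (hh : 0 < h) (hab : |a - b| ≤ 3 * h) :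
    ∃ j ∈ Finset.range 7, a ∈ Icc (b - 3 * h + j * h) (b - 3 * h + j * h + h) := by
  obtain ⟨h1, h2⟩ := abs_le.1 hab
  have h0 : 0 ≤ (a - b + 3 * h) / h := div_nonneg (by linarith) hh.le
  have h3 := Nat.floor_le h0
  have h4 := Nat.lt_floor_add_one ((a - b + 3 * h) / h)
  rw [le_div_iff₀ hh] at h3
  rw [div_lt_iff₀ hh] at h4
  refine ⟨⌊(a - b + 3 * h) / h⌋₊, ?_, ?_, ?_⟩
  · rw [Finset.mem_range, Nat.floor_lt h0, div_lt_iff₀ hh]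
    push_cast
    linarith
  · linarith
  · linarith

lemma BoxCover.refine {A : Set (ℝ × ℚ_[p])} {δ : ℝ} {i L : ℕ} {K : ℝ} (hK : BoxCover p A i K)
    (h₁ : ∀ f : ℝ × ℚ_[p], ∃ G : Finset (ℝ × ℚ_[p]), (G.card : ℝ) ≤ Real.exp (δ * L) ∧
      ∀ z ∈ A ∩ levelBox p i f, ∃ g ∈ G, |z.1 - g.1| ≤ 3 * ((p : ℝ) ^ (4 * (i + L)))⁻¹)
    (h₂ : ∀ f : ℝ × ℚ_[p], ∃ G : Finset (ℝ × ℚ_[p]), (G.card : ℝ) ≤ Real.exp (δ * L) ∧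
      ∀ z ∈ A ∩ levelBox p i f, ∃ g ∈ G, ‖z.2 - g.2‖ ≤ ((p : ℝ) ^ (2 * (i + L)))⁻¹) :
    BoxCover p A (i + L) (K * (7 * Real.exp (2 * δ * L))) := by
  classical
  have hpr : (0 : ℝ) < p := by exact_mod_cast hp.out.pos
  set h := ((p : ℝ) ^ (4 * (i + L)))⁻¹ with hh
  have hh0 : 0 < h := by positivity
  obtain ⟨F, hF, hAF⟩ := hK
  choose G hG hGz using h₁
  choose G' hG' hGz' using h₂
  set new : ((ℝ × ℚ_[p]) × (ℝ × ℚ_[p])) × ℕ → ℝ × ℚ_[p] :=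
    fun w => (w.1.1.1 - 3 * h + w.2 * h, w.1.2.2) with hnew
  refine ⟨F.biUnion fun f => ((G f ×ˢ G' f) ×ˢ Finset.range 7).image new, ?_, ?_⟩
  · have hcard : ∀ f, ((((G f ×ˢ G' f) ×ˢ Finset.range 7).image new).card : ℝ) ≤
        7 * Real.exp (2 * δ * L) := by
      intro f
      calc ((((G f ×ˢ G' f) ×ˢ Finset.range 7).image new).card : ℝ)
          ≤ (((G f ×ˢ G' f) ×ˢ Finset.range 7).card : ℝ) := by
            exact_mod_cast Finset.card_image_le
        _ = (G f).card * (G' f).card * 7 := by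
            rw [Finset.card_product, Finset.card_product, Finset.card_range]; push_cast; ring
        _ ≤ Real.exp (δ * L) * Real.exp (δ * L) * 7 := by gcongr <;> [exact hG f; exact hG' f]
        _ = _ := by rw [← Real.exp_add]; ring_nf
    calc _ ≤ ((∑ f ∈ F, (((G f ×ˢ G' f) ×ˢ Finset.range 7).image new).card : ℕ) : ℝ) := by
          exact_mod_cast Finset.card_biUnion_le
      _ ≤ ∑ f ∈ F, 7 * Real.exp (2 * δ * L) := by
          push_cast
          exact Finset.sum_le_sum fun f _ => hcard f
      _ = F.card * (7 * Real.exp (2 * δ * L)) := by rw [Finset.sum_const, nsmul_eq_mul]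
      _ ≤ _ := by gcongr
  · intro z hz
    have := hAF hz
    simp only [mem_iUnion] at this
    obtain ⟨f, hf, hzf⟩ := this
    obtain ⟨g, hg, hzg⟩ := hGz f z ⟨hz, hzf⟩
    obtain ⟨g', hg', hzg'⟩ := hGz' f z ⟨hz, hzf⟩
    obtain ⟨j, hj, hzj⟩ := exists_mem_Icc_of_abs_le hh0 hzg
    simp only [mem_iUnion]
    refine ⟨new ((g, g'), j), ?_, hzj, hzg'⟩
    rw [Finset.mem_biUnion]
    exact ⟨f, hf, Finset.mem_image_of_mem _
      (Finset.mem_product.2 ⟨Finset.mem_product.2 ⟨hg, hg'⟩, hj⟩)⟩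

lemma levelBox_subset_closedBall (i : ℕ) (f : ℝ × ℚ_[p]) :
    levelBox p i f ⊆ Metric.closedBall f (((p : ℝ) ^ 2) ^ i)⁻¹ := by
  have hp1 : (1 : ℝ) ≤ p := by exact_mod_cast hp.out.one_lt.le
  rintro z ⟨hz1, hz2⟩
  rw [Metric.mem_closedBall, Prod.dist_eq, ← pow_mul]
  refine max_le ?_ (by rwa [dist_eq_norm])
  rw [Real.dist_eq, abs_of_nonneg (by linarith [hz1.1])]
  have : ((p : ℝ) ^ (4 * i))⁻¹ ≤ ((p : ℝ) ^ (2 * i))⁻¹ := by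
    gcongr
    norm_num
  linarith [hz1.2]

theorem subexpCover_of_refine {A : Set (ℝ × ℚ_[p])} (hA : Bornology.IsBounded A)
    (h₁ : RealRefine p A) (h₂ : PadicRefine p A) : SubexpCover ((p : ℝ) ^ 2) A := by
  intro ε hε
  set δ := ε / 4 with hδ
  have hδ0 : 0 < δ := by positivity
  obtain ⟨N₁, hN₁⟩ := h₁ δ hδ0
  obtain ⟨N₂, hN₂⟩ := h₂ δ hδ0
  obtain ⟨N₃, hN₃⟩ := exists_nat_gt (7 / δ)
  set L := max (max N₁ N₂) (N₃ + 1) with hL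
  have hLpos : 0 < L := lt_of_lt_of_le (Nat.succ_pos _) (le_max_right _ _)
  have h7 : 7 * Real.exp (2 * δ * L) ≤ Real.exp (3 * δ * L) := by
    have e : 3 * δ * L = δ * L + 2 * δ * L := by ring
    rw [e, Real.exp_add]
    gcongr
    have h1 : (N₃ : ℝ) ≤ L := by exact_mod_cast (Nat.le_succ N₃).trans (le_max_right _ _)
    have h2 : 7 < δ * L := by
      rw [div_lt_iff₀ hδ0] at hN₃
      nlinarith
    linarith [Real.add_one_le_exp (δ * L)]
  obtain ⟨i₀, hi₀⟩ := eventually_atTop.1 ((hN₁ L ((le_max_left _ _).trans (le_max_left _ _))).and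
    (hN₂ L ((le_max_right _ _).trans (le_max_left _ _))))
  choose K hK0 hK using fun i => exists_boxCover hA i
  set K₁ := ∑ i ∈ Finset.range (i₀ + L), K i with hK₁
  have hK₁0 : 0 ≤ K₁ := Finset.sum_nonneg fun i _ => hK0 i
  have key : ∀ i, BoxCover p A i (K₁ * Real.exp (3 * δ * i)) := by
    intro i
    induction i using Nat.strong_induction_on with
    | _ i ih =>
      by_cases hi : i < i₀ + L
      · obtain ⟨F, hF, hAF⟩ := hK i
        refine ⟨F, hF.trans ?_, hAF⟩
        have h1 : K i ≤ K₁ := Finset.single_le_sum (f := K) (fun i _ => hK0 i)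
          (Finset.mem_range.2 hi)
        exact h1.trans (le_mul_of_one_le_right hK₁0 (Real.one_le_exp (by positivity)))
      · obtain ⟨m, rfl⟩ : ∃ m, i = m + L := ⟨i - L, by omega⟩
        have hm : i₀ ≤ m := by omega
        obtain ⟨g1, g2⟩ := hi₀ m hm
        obtain ⟨F, hF, hAF⟩ := (ih m (by omega)).refine g1 g2
        refine ⟨F, hF.trans ?_, hAF⟩
        calc K₁ * Real.exp (3 * δ * m) * (7 * Real.exp (2 * δ * L))
            ≤ K₁ * Real.exp (3 * δ * m) * Real.exp (3 * δ * L) := by gcongr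
          _ = _ := by rw [mul_assoc, ← Real.exp_add]; push_cast; ring_nf
  have hev : ∀ᶠ i : ℕ in atTop, K₁ ≤ Real.exp (δ * i) := by
    have : Tendsto (fun i : ℕ => Real.exp (δ * i)) atTop atTop :=
      Real.tendsto_exp_atTop.comp (tendsto_natCast_atTop_atTop.const_mul_atTop hδ0)
    exact this.eventually_ge_atTop K₁
  filter_upwards [hev] with i hi
  obtain ⟨F, hF, hAF⟩ := key i
  refine ⟨F, hF.trans ?_, hAF.trans ?_⟩
  · calc K₁ * Real.exp (3 * δ * i) ≤ Real.exp (δ * i) * Real.exp (3 * δ * i) := by gcongr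
      _ = _ := by rw [← Real.exp_add, hδ]; ring_nf
  · exact iUnion₂_mono fun f _ => levelBox_subset_closedBall i f

end Boxes

section Refine

variable {p : ℕ} [hp : Fact p.Prime]

lemma tendsto_inv_prime_pow : Tendsto (fun i : ℕ => ((p : ℝ) ^ i)⁻¹) atTop (𝓝 0) :=
  tendsto_inv_atTop_zero.comp
    (tendsto_pow_atTop_atTop_of_one_lt (by exact_mod_cast hp.out.one_lt))

theorem realRefine_of_orb {C : ℝ} (hC : 1 ≤ C) {A : Set (ℝ × ℚ_[p])}
    (h : ∀ w ∈ A, ∀ n k : ℤ, 0 ≤ k → k ≤ n → (realPadic p).Orb C w.1 w.2 n k) :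
    RealRefine p A := by
  intro δ hδ
  have hpr : (0 : ℝ) < p := by exact_mod_cast hp.out.pos
  have hp1 : (1 : ℝ) ≤ p := by exact_mod_cast hp.out.one_lt.le
  obtain ⟨N, hN⟩ := (realPadic p).eventually_card_lt hC
    (realDigits p hp.out.two_le (realPadic p).l₁ rfl) (half_pos hδ)
  refine ⟨N, fun L hL => ?_⟩
  have hl : ((realPadic p).l₁ : ℝ) = p := rfl
  have hl₂ : ((realPadic p).l₂ : ℚ_[p]) = (p : ℚ_[p])⁻¹ := rfl
  have hr : 2 / ‖((realPadic p).l₁ : ℝ) ^ 2‖ ^ (2 * L) < 3 * ((p : ℝ) ^ (4 * L))⁻¹ := by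
    rw [hl, norm_pow, Real.norm_natCast, ← pow_mul, div_eq_mul_inv]
    have : 2 * (2 * L) = 4 * L := by ring
    rw [this]
    have : 0 < ((p : ℝ) ^ (4 * L))⁻¹ := by positivity
    linarith
  have key := hN (2 * L) (by omega) _ hr A (fun j => 2 * j) (fun j => (j / 2 : ℕ))
    (fun j => ((p : ℝ) ^ j)⁻¹) tendsto_inv_prime_pow (by
      intro n m
      filter_upwards [eventually_ge_atTop (2 * (n.natAbs + m.natAbs) + 2)] with j hj w hw
      exact h w hw _ _ (by push_cast; omega) (by push_cast; omega))
  filter_upwards [key] with i hi f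
  have hsc : (((p : ℝ) ^ 2) ^ (2 * (i : ℤ))) = (p : ℝ) ^ (4 * i) := by
    rw [← zpow_natCast, ← zpow_natCast, ← zpow_mul]
    congr 1
    push_cast
    ring
  have hpos : 0 < (p : ℝ) ^ (4 * i) := by positivity
  obtain ⟨G, hGS, hG, hcov⟩ := exists_maximal_separated (Prod.fst : ℝ × ℚ_[p] → ℝ)
    (A ∩ levelBox p i f) (r := 3 * ((p : ℝ) ^ (4 * (i + L)))⁻¹) (M := Real.exp (δ * L)) (by
      intro G hGS hsep
      have := hi f.1 f.2 G (hGS.trans inter_subset_left) ?_ ?_ ?_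
      · convert this using 2
        push_cast
        ring
      · intro g hg
        obtain ⟨h1, h2⟩ := (hGS hg).2.1
        change _ ∈ Icc (0 : ℝ) 1
        rw [hl, hsc]
        refine ⟨mul_nonneg hpos.le (by linarith), ?_⟩
        calc (p : ℝ) ^ (4 * i) * (g.1 - f.1) ≤ (p : ℝ) ^ (4 * i) * ((p : ℝ) ^ (4 * i))⁻¹ := by
              gcongr; linarith
          _ = 1 := mul_inv_cancel₀ hpos.ne'
      · intro g hg
        have h2 := (hGS hg).2.2
        rw [hl₂, norm_mul, norm_zpow, norm_pow, norm_inv, Padic.norm_p, inv_inv, zpow_natCast,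
          ← pow_mul]
        calc (p : ℝ) ^ (2 * (i / 2)) * ‖g.2 - f.2‖ ≤ (p : ℝ) ^ i * ((p : ℝ) ^ (2 * i))⁻¹ := by
              gcongr
              omega
          _ = _ := by rw [two_mul, pow_add, mul_inv, mul_inv_cancel_left₀ (by positivity)]
      · intro g hg g' hg' hne
        have := hsep g hg g' hg' hne
        rw [hl, hsc, norm_mul, Real.norm_of_nonneg hpos.le, ← dist_eq_norm]
        calc 3 * ((p : ℝ) ^ (4 * L))⁻¹ = (p : ℝ) ^ (4 * i) * (3 * ((p : ℝ) ^ (4 * (i + L)))⁻¹) := by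
              rw [mul_add, pow_add, mul_inv]; field_simp
          _ ≤ _ := by gcongr) (by positivity)
  refine ⟨G, hG.le, fun z hz => ?_⟩
  obtain ⟨g, hg, hgz⟩ := hcov z hz
  exact ⟨g, hg, by rw [← Real.dist_eq]; exact hgz.le⟩

theorem padicRefine_of_orb {C : ℝ} (hC : 1 ≤ C) {A : Set (ℝ × ℚ_[p])} {b : ℕ → ℤ}
    (hb : ∀ i, 2 * b i ≤ 3 * i)
    (h : ∀ n m : ℤ, ∀ᶠ j : ℕ in atTop, ∀ w ∈ A, (realPadic p).Orb C w.1 w.2 (m + b j) (n + j)) :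
    PadicRefine p A := by
  intro δ hδ
  have hpr : (0 : ℝ) < p := by exact_mod_cast hp.out.pos
  have hp1 : (1 : ℝ) ≤ p := by exact_mod_cast hp.out.one_lt.le
  have hp2 : (2 : ℝ) ≤ p := by exact_mod_cast hp.out.two_le
  obtain ⟨N, hN⟩ := (realPadic p).swap.eventually_card_lt hC
    (padicDigits (realPadic p).swap.l₁ rfl) (half_pos hδ)
  refine ⟨N + 1, fun L hL => ?_⟩
  have hl : ((realPadic p).swap.l₁ : ℚ_[p]) = (p : ℚ_[p])⁻¹ := rfl
  have hl₂ : ((realPadic p).swap.l₂ : ℝ) = p := rfl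
  have hr : 2 / ‖((realPadic p).swap.l₁ : ℚ_[p]) ^ 2‖ ^ (L + 1) < ((p : ℝ) ^ (2 * L))⁻¹ := by
    rw [hl, norm_pow, norm_inv, Padic.norm_p, inv_inv, ← pow_mul, div_lt_iff₀ (by positivity),
      mul_add, pow_add, inv_mul_cancel_left₀ (by positivity), mul_one]
    nlinarith
  have key := hN (L + 1) (by omega) _ hr (Prod.swap ⁻¹' A) (fun j => j) b
    (fun j => ((p : ℝ) ^ j)⁻¹) tendsto_inv_prime_pow (by
      intro n m
      filter_upwards [h n m] with j hj w hw
      exact ArithPair.orb_swap _ (hj w.swap hw))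
  filter_upwards [key] with i hi f
  have hpos : 0 < (p : ℝ) ^ (2 * i) := by positivity
  have hsc : ∀ t : ℚ_[p], ‖(((p : ℚ_[p])⁻¹) ^ 2) ^ (i : ℤ) * t‖ = (p : ℝ) ^ (2 * i) * ‖t‖ := by
    intro t
    rw [norm_mul, norm_zpow, norm_pow, norm_inv, Padic.norm_p, inv_inv, zpow_natCast, ← pow_mul]
  obtain ⟨G, hGS, hG, hcov⟩ := exists_maximal_separated (Prod.fst : ℚ_[p] × ℝ → ℚ_[p])
    (Prod.swap ⁻¹' (A ∩ levelBox p i f)) (r := ((p : ℝ) ^ (2 * (i + L)))⁻¹)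
    (M := Real.exp (δ * L)) (by
      intro G hGS hsep
      have := hi f.2 f.1 G (hGS.trans (preimage_mono inter_subset_left)) ?_ ?_ ?_
      · refine this.trans_le (Real.exp_le_exp.2 ?_)
        have : (1 : ℝ) ≤ L := by exact_mod_cast (by omega : 1 ≤ L)
        push_cast
        nlinarith
      · intro g hg
        have h2 := (hGS hg).2.2
        change _ ∈ Metric.closedBall (0 : ℚ_[p]) 1
        rw [mem_closedBall_zero_iff, hl, hsc]
        calc (p : ℝ) ^ (2 * i) * ‖g.1 - f.2‖ ≤ (p : ℝ) ^ (2 * i) * ((p : ℝ) ^ (2 * i))⁻¹ := by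
              gcongr; exact h2
          _ = 1 := mul_inv_cancel₀ hpos.ne'
      · intro g hg
        obtain ⟨h1, h2⟩ := (hGS hg).2.1
        have h3 : |g.2 - f.1| ≤ ((p : ℝ) ^ (4 * i))⁻¹ := by
          simp only [Prod.fst_swap] at h1 h2
          rw [abs_of_nonneg (by linarith)]
          linarith
        rw [hl₂, norm_mul, norm_zpow, norm_pow, Real.norm_natCast, Real.norm_eq_abs]
        calc ((p : ℝ) ^ 2) ^ b i * |g.2 - f.1| ≤ (p : ℝ) ^ (3 * i) * ((p : ℝ) ^ (4 * i))⁻¹ := by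
              gcongr
              rw [← zpow_natCast, ← zpow_mul, ← zpow_natCast]
              refine zpow_le_zpow_right₀ hp1 ?_
              push_cast
              exact hb i
          _ = _ := by
              have : 4 * i = 3 * i + i := by ring
              rw [this, pow_add, mul_inv, mul_inv_cancel_left₀ (by positivity)]
      · intro g hg g' hg' hne
        have := hsep g hg g' hg' hne
        rw [hl, hsc, ← dist_eq_norm]
        calc ((p : ℝ) ^ (2 * L))⁻¹ = (p : ℝ) ^ (2 * i) * ((p : ℝ) ^ (2 * (i + L)))⁻¹ := by
              rw [mul_add, pow_add, mul_inv]; field_simp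
          _ ≤ _ := by gcongr) (by positivity)
  classical
  refine ⟨G.image Prod.swap, ?_, fun z hz => ?_⟩
  · refine le_trans ?_ hG.le
    exact_mod_cast Finset.card_image_le
  obtain ⟨g, hg, hgz⟩ := hcov z.swap (by simpa using hz)
  exact ⟨g.swap, Finset.mem_image_of_mem _ hg, by
    simpa [dist_eq_norm] using hgz.le⟩

/-- Subexponential covers for sets whose points have bounded orbits in a cone. -/
theorem subexpCover_of_orb {C : ℝ} (hC : 1 ≤ C) {A : Set (ℝ × ℚ_[p])}
    (hA : Bornology.IsBounded A)
    (h : (∀ w ∈ A, ∀ n k : ℤ, 0 ≤ k → k ≤ n → (realPadic p).Orb C w.1 w.2 n k) ∨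
      (∀ w ∈ A, w.1 = 0) ∧
        ∀ w ∈ A, ∀ n k : ℤ, 0 ≤ n + k → n ≤ k → (realPadic p).Orb C w.1 w.2 n k) :
    SubexpCover ((p : ℝ) ^ 2) A := by
  rcases h with h | ⟨h0, h⟩
  · refine subexpCover_of_refine hA (realRefine_of_orb hC h)
      (padicRefine_of_orb hC (b := fun i => i + (i / 2 : ℕ)) (fun i => by push_cast; omega) ?_)
    intro n m
    filter_upwards [eventually_ge_atTop (2 * (n.natAbs + m.natAbs) + 2)] with j hj w hw
    exact h w hw _ _ (by omega) (by omega)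
  · refine subexpCover_of_refine hA ?_
      (padicRefine_of_orb hC (b := fun _ => 0) (fun i => by positivity) ?_)
    · intro δ hδ
      refine ⟨0, fun L _ => Eventually.of_forall fun i f => ⟨{0}, ?_, fun z hz => ?_⟩⟩
      · rw [Finset.card_singleton, Nat.cast_one]
        exact Real.one_le_exp (by positivity)
      · refine ⟨0, by simp, ?_⟩
        simp only [h0 z hz.1, Prod.fst_zero, sub_zero, abs_zero]
        positivity
    · intro n m
      filter_upwards [eventually_ge_atTop (2 * (n.natAbs + m.natAbs) + 2)] with j hj w hw
      exact h w hw _ _ (by omega) (by omega)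

end Refine

section BoxDim

variable {Z : Type*}

lemma SubexpCover.mono [PseudoMetricSpace Z] {q : ℝ} {A B : Set Z} (h : SubexpCover q B)
    (hAB : A ⊆ B) : SubexpCover q A := by
  intro ε hε
  filter_upwards [h ε hε] with i hi
  obtain ⟨F, hF, hBF⟩ := hi
  exact ⟨F, hF, hAB.trans hBF⟩

lemma subexpCover_singleton [PseudoMetricSpace Z] {q : ℝ} (hq : 0 < q) (x : Z) :
    SubexpCover q {x} := by
  intro ε hε
  refine Eventually.of_forall fun i => ⟨{x}, ?_, ?_⟩
  · rw [Finset.card_singleton, Nat.cast_one]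
    exact Real.one_le_exp (by positivity)
  · rintro _ rfl
    simp only [Finset.mem_singleton, iUnion_iUnion_eq_left, Metric.mem_closedBall, dist_self]
    positivity

lemma sepNum_le_card [PseudoMetricSpace Z] {A : Set Z} {F : Finset Z} {r δ : ℝ}
    (hA : A ⊆ ⋃ f ∈ F, Metric.closedBall f r) (hr : 2 * r ≤ δ) : sepNum dist δ A ≤ F.card := by
  refine csSup_le' ?_
  rintro n ⟨G, hGA, hsep, rfl⟩
  have : ∀ g ∈ G, ∃ f ∈ F, g ∈ Metric.closedBall f r := by
    intro g hg
    have := hA (hGA hg)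
    simp only [mem_iUnion] at this
    obtain ⟨f, hf, h⟩ := this
    exact ⟨f, hf, h⟩
  choose! c hcF hc using this
  refine Finset.card_le_card_of_injOn c hcF ?_
  intro x hx y hy hxy
  by_contra hne
  have h1 := hsep x hx y hy hne
  have h2 := hc x hx
  have h3 := hc y hy
  rw [hxy] at h2
  have := dist_triangle_right x y (c y)
  rw [Metric.mem_closedBall] at h2 h3
  linarith

theorem SubexpCover.upperBoxDim_eq_zero [PseudoMetricSpace Z] {q : ℝ} (hq : 1 < q) {A : Set Z}
    (h : SubexpCover q A) : upperBoxDim dist A = 0 := by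
  apply Tendsto.limsup_eq
  have hlq : 0 < Real.log q := Real.log_pos hq
  have hq0 : 0 < q := by linarith
  rw [Metric.tendsto_nhds]
  intro ε hε
  obtain ⟨i₀, hi₀⟩ := eventually_atTop.1 (h (ε * Real.log q / 4) (by positivity))
  have hlog : Tendsto (fun δ : ℝ => -Real.log δ) (𝓝[>] 0) atTop :=
    tendsto_neg_atBot_atTop.comp Real.tendsto_log_nhdsGT_zero
  filter_upwards [hlog.eventually_ge_atTop (Real.log 2 + Real.log q + 1),
    hlog.eventually_ge_atTop (i₀ * Real.log q), self_mem_nhdsWithin] with δ h1 h2 hδ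
  have hδ0 : 0 < δ := hδ
  have hl2 : 0 < Real.log 2 := Real.log_pos (by norm_num)
  set x := -Real.log δ with hx
  have hx0 : 0 < x := by linarith
  set i := ⌈(Real.log 2 + x) / Real.log q⌉₊ with hi
  have hle := Nat.le_ceil ((Real.log 2 + x) / Real.log q)
  have hlt := Nat.ceil_lt_add_one (a := (Real.log 2 + x) / Real.log q) (by positivity)
  rw [← hi] at hle hlt
  have hii : i₀ ≤ i := by
    have h3 : (i₀ : ℝ) ≤ (Real.log 2 + x) / Real.log q := by
      rw [le_div_iff₀ hlq]
      linarith
    exact_mod_cast h3.trans hle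
  obtain ⟨F, hF, hAF⟩ := hi₀ i hii
  have hr : 2 * (q ^ i)⁻¹ ≤ δ := by
    rw [← div_eq_mul_inv, div_le_iff₀ (by positivity), ← Real.log_le_log_iff (by norm_num)
      (by positivity), Real.log_mul hδ0.ne' (by positivity), Real.log_pow]
    rw [div_le_iff₀ hlq] at hle
    linarith
  have hs : Real.log (sepNum dist δ A) ≤ ε * Real.log q / 4 * i := by
    rcases Nat.eq_zero_or_pos (sepNum dist δ A) with h0 | h0
    · rw [h0, Nat.cast_zero, Real.log_zero]
      positivity
    · rw [Real.log_le_iff_le_exp (by exact_mod_cast h0)]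
      refine le_trans ?_ hF
      exact_mod_cast sepNum_le_card hAF hr
  have habs : |Real.log δ| = x := by
    rw [hx, abs_of_neg (by linarith)]
  rw [Real.dist_eq, sub_zero, habs, abs_of_nonneg (div_nonneg (Real.log_natCast_nonneg _) hx0.le),
    div_lt_iff₀ hx0]
  refine hs.trans_lt ?_
  have h5 : Real.log q * i ≤ Real.log 2 + x + Real.log q := by
    calc Real.log q * i ≤ Real.log q * ((Real.log 2 + x) / Real.log q + 1) := by gcongr
      _ = _ := by field_simp
  calc ε * Real.log q / 4 * i = ε / 4 * (Real.log q * i) := by ring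
    _ ≤ ε / 4 * (Real.log 2 + x + Real.log q) := by gcongr
    _ ≤ ε / 4 * (2 * x) := by gcongr; linarith
    _ < ε * x := by nlinarith [mul_pos hε hx0]

theorem SubexpCover.dimH_eq_zero [MetricSpace Z] {q : ℝ} (hq : 1 < q) {A : Set Z}
    (h : SubexpCover q A) : dimH A = 0 := by
  borelize Z
  have hq0 : 0 < q := by linarith
  have hlq : 0 < Real.log q := Real.log_pos hq
  refine le_antisymm (ENNReal.le_of_forall_pos_le_add fun d hd _ => ?_) zero_le
  rw [zero_add]
  apply dimH_le_of_hausdorffMeasure_ne_top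
  have hd' : (0 : ℝ) < d := by exact_mod_cast hd
  have hev := h (d * Real.log q) (by positivity)
  have hF : ∀ i : ℕ, ∃ F : Finset Z, (∃ F : Finset Z, (F.card : ℝ) ≤ Real.exp (d * Real.log q * i) ∧
      A ⊆ ⋃ f ∈ F, Metric.closedBall f (q ^ i)⁻¹) →
      (F.card : ℝ) ≤ Real.exp (d * Real.log q * i) ∧
      A ⊆ ⋃ f ∈ F, Metric.closedBall f (q ^ i)⁻¹ := by
    intro i
    by_cases hi : ∃ F : Finset Z, (F.card : ℝ) ≤ Real.exp (d * Real.log q * i) ∧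
      A ⊆ ⋃ f ∈ F, Metric.closedBall f (q ^ i)⁻¹
    · obtain ⟨F, hF⟩ := hi
      exact ⟨F, fun _ => hF⟩
    · exact ⟨∅, fun h => absurd h hi⟩
  choose F hF using hF
  have hdiam : ∀ (i : ℕ) (f : Z), Metric.ediam (Metric.closedBall f (q ^ i)⁻¹) ≤
      ENNReal.ofReal (2 * (q ^ i)⁻¹) := by
    intro i f
    refine Metric.ediam_le fun x hx y hy => ?_
    rw [edist_dist]
    refine ENNReal.ofReal_le_ofReal ?_
    have := dist_triangle_right x y f
    rw [Metric.mem_closedBall] at hx hy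
    linarith
  have hr : Tendsto (fun i : ℕ => ENNReal.ofReal (2 * (q ^ i)⁻¹)) atTop (𝓝 0) := by
    have h1 : Tendsto (fun i : ℕ => 2 * (q ^ i)⁻¹) atTop (𝓝 0) := by
      have := (tendsto_inv_atTop_zero.comp (tendsto_pow_atTop_atTop_of_one_lt hq)).const_mul 2
      simpa using this
    simpa using ENNReal.tendsto_ofReal h1
  have hle := Measure.hausdorffMeasure_le_liminf_sum (ι := fun i => F i) d A _ hr
    (fun i f => Metric.closedBall (f : Z) (q ^ i)⁻¹) (Eventually.of_forall fun i f => hdiam i f) (by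
      filter_upwards [hev] with i hi
      refine (hF i hi).2.trans ?_
      rw [iUnion_subtype])
  refine ne_top_of_le_ne_top (b := ENNReal.ofReal ((2 : ℝ) ^ (d : ℝ))) ENNReal.ofReal_ne_top
    (hle.trans ?_)
  refine liminf_le_of_frequently_le' (Eventually.frequently ?_)
  filter_upwards [hev] with i hi
  have hqi : 0 < q ^ i := by positivity
  calc ∑ f : F i, Metric.ediam (Metric.closedBall (f : Z) (q ^ i)⁻¹) ^ (d : ℝ)
      ≤ ∑ f : F i, ENNReal.ofReal ((2 * (q ^ i)⁻¹) ^ (d : ℝ)) := by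
        refine Finset.sum_le_sum fun f _ => ?_
        rw [← ENNReal.ofReal_rpow_of_nonneg (by positivity) hd'.le]
        exact ENNReal.rpow_le_rpow (hdiam i f) hd'.le
    _ = ENNReal.ofReal ((F i).card * (2 * (q ^ i)⁻¹) ^ (d : ℝ)) := by
        rw [Finset.sum_const, nsmul_eq_mul, ENNReal.ofReal_mul (by positivity)]
        simp
    _ ≤ ENNReal.ofReal ((2 : ℝ) ^ (d : ℝ)) := by
        refine ENNReal.ofReal_le_ofReal ?_
        calc ((F i).card : ℝ) * (2 * (q ^ i)⁻¹) ^ (d : ℝ)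
            ≤ Real.exp (d * Real.log q * i) * (2 * (q ^ i)⁻¹) ^ (d : ℝ) := by
              gcongr
              exact (hF i hi).1
          _ = (q ^ i) ^ (d : ℝ) * (2 ^ (d : ℝ) * ((q ^ i) ^ (d : ℝ))⁻¹) := by
              rw [Real.mul_rpow (by norm_num) (by positivity), Real.inv_rpow hqi.le,
                Real.rpow_def_of_pos hqi, Real.log_pow]
              ring_nf
          _ = _ := by
              have : 0 < (q ^ i) ^ (d : ℝ) := by positivity
              field_simp

end BoxDim

section Main

variable {p : ℕ} [hp : Fact p.Prime]

lemma exists_badPair_of_not_cond12 {u : ℝ} {v : ℚ_[p]} (h : ¬ Cond12 p u v) :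
    ∃ c : ℝ, 0 < c ∧ BadPair c u v := by
  unfold Cond12 at h
  push Not at h
  obtain ⟨ε, hε, N, h⟩ := h
  have hM : (0 : ℝ) < (N : ℝ) + 1 := by positivity
  refine ⟨ε / ((N : ℝ) + 1) ^ 2, by positivity, fun q q₀ hq hq₀ => ?_⟩
  have habs : ∀ z : ℤ, z ≠ 0 → (N : ℤ) ≤ |((N : ℤ) + 1) * z| := by
    intro z hz
    rw [abs_mul, abs_of_nonneg (by positivity)]
    nlinarith [Int.one_le_abs hz]
  have h1 := h _ _ (habs q hq) (habs q₀ hq₀)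
  rw [div_le_iff₀ (by positivity)]
  refine h1.trans ?_
  have e1 : |(((N + 1) * q : ℤ) : ℝ)| = (N + 1) * |(q : ℝ)| := by
    push_cast
    rw [abs_mul, abs_of_pos hM]
  have e2 : |(((N + 1) * q : ℤ) : ℝ) * u - ((N + 1) * q₀ : ℤ)| = (N + 1) * |(q : ℝ) * u - q₀| := by
    push_cast
    rw [mul_assoc, ← mul_sub, abs_mul, abs_of_pos hM]
  have e3 : ‖(((N + 1) * q : ℤ) : ℚ_[p]) * v - ((N + 1) * q₀ : ℤ)‖ ≤ ‖(q : ℚ_[p]) * v - q₀‖ := by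
    have : (((N + 1) * q : ℤ) : ℚ_[p]) * v - ((N + 1) * q₀ : ℤ) =
        ((N + 1 : ℤ) : ℚ_[p]) * ((q : ℚ_[p]) * v - q₀) := by
      push_cast
      ring
    rw [this, norm_mul]
    exact mul_le_of_le_one_left (norm_nonneg _) (Padic.norm_int_le_one _)
  rw [e1, e2]
  calc _ ≤ ((N : ℝ) + 1) * |(q : ℝ)| * ((N + 1) * |(q : ℝ) * u - q₀|) * ‖(q : ℚ_[p]) * v - q₀‖ := by
        gcongr
    _ = _ := by ring

lemma SubexpCover.of_neg {A : Set (ℝ × ℚ_[p])} {q : ℝ} (h : SubexpCover q (Neg.neg ⁻¹' A)) :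
    SubexpCover q A := by
  classical
  intro ε hε
  filter_upwards [h ε hε] with i hi
  obtain ⟨F, hF, hAF⟩ := hi
  refine ⟨F.image Neg.neg, le_trans (by exact_mod_cast Finset.card_image_le) hF, fun z hz => ?_⟩
  have := hAF (show -z ∈ Neg.neg ⁻¹' A by simpa using hz)
  simp only [mem_iUnion, Finset.mem_image] at this ⊢
  obtain ⟨f, hf, hzf⟩ := this
  refine ⟨-f, ⟨f, hf, rfl⟩, ?_⟩
  rw [Metric.mem_closedBall] at hzf ⊢
  rwa [← dist_neg_neg, neg_neg]

variable (p) in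
/-- Pairs which are bad with constant `1 / (l + 1)` and bounded by `l + 1`. -/
def badSet (l : ℕ) : Set (ℝ × ℚ_[p]) :=
  {w | BadPair (1 / ((l : ℝ) + 1)) w.1 w.2 ∧ |w.1| ≤ l + 1 ∧ ‖w.2‖ ≤ l + 1}

lemma isBounded_badSet (l : ℕ) : Bornology.IsBounded (badSet p l) := by
  refine (Metric.isBounded_closedBall (x := (0 : ℝ × ℚ_[p])) (r := l + 1)).subset ?_
  intro w hw
  rw [mem_closedBall_zero_iff, Prod.norm_def]
  exact max_le hw.2.1 hw.2.2

lemma subexpCover_badSet_real (l : ℕ) :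
    SubexpCover ((p : ℝ) ^ 2) (badSet p l ∩ {w | 1 / ((l : ℝ) + 1) ≤ |w.1|}) := by
  have hl : (0 : ℝ) < 1 / ((l : ℝ) + 1) := by positivity
  have hl1 : 1 / ((l : ℝ) + 1) ≤ 1 := by
    rw [div_le_one (by positivity)]
    linarith [(by positivity : (0 : ℝ) ≤ l)]
  obtain ⟨C, hC, h⟩ := BadPair.orb (p := p) hl hl hl1 hl
  refine SubexpCover.of_neg (subexpCover_of_orb hC ?_ (Or.inl ?_))
  · exact ((isBounded_badSet l).subset inter_subset_left).neg
  · intro w hw n k hk hkn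
    have := h _ _ hw.1.1 (by rw [one_div_one_div]; exact hw.1.2.2) n k hk (by omega)
      (Or.inl ⟨hkn, hw.2⟩)
    simpa using this

lemma subexpCover_badSet_padic (l : ℕ) :
    SubexpCover ((p : ℝ) ^ 2) (badSet p l ∩ {w | w.1 = 0 ∧ 1 / ((l : ℝ) + 1) ≤ ‖w.2‖}) := by
  have hl : (0 : ℝ) < 1 / ((l : ℝ) + 1) := by positivity
  have hl1 : 1 / ((l : ℝ) + 1) ≤ 1 := by
    rw [div_le_one (by positivity)]
    linarith [(by positivity : (0 : ℝ) ≤ l)]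
  obtain ⟨C, hC, h⟩ := BadPair.orb (p := p) hl hl hl1 hl
  refine SubexpCover.of_neg (subexpCover_of_orb hC ?_ (Or.inr ⟨?_, ?_⟩))
  · exact ((isBounded_badSet l).subset inter_subset_left).neg
  · intro w hw
    simpa using hw.2.1
  · intro w hw n k hk hkn
    have := h _ _ hw.1.1 (by rw [one_div_one_div]; exact hw.1.2.2) n k (by omega) hk
      (Or.inr ⟨hkn, hw.2.2⟩)
    simpa using this

variable (p) in
/-- The pieces of the exceptional set: the real coordinate is away from zero, or it vanishes and
the `p`-adic coordinate is away from zero, or both vanish. -/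
def badPiece (l : ℕ) : ℕ → Set (ℝ × ℚ_[p])
  | 0 => badSet p l ∩ {w | 1 / ((l : ℝ) + 1) ≤ |w.1|}
  | 1 => badSet p l ∩ {w | w.1 = 0 ∧ 1 / ((l : ℝ) + 1) ≤ ‖w.2‖}
  | _ => {0}

lemma subexpCover_badPiece (l t : ℕ) : SubexpCover ((p : ℝ) ^ 2) (badPiece p l t) :=
  match t with
  | 0 => subexpCover_badSet_real l
  | 1 => subexpCover_badSet_padic l
  | _ + 2 => subexpCover_singleton (by have := hp.out.pos; positivity) 0

lemma isBounded_badPiece (l t : ℕ) : Bornology.IsBounded (badPiece p l t) :=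
  match t with
  | 0 => (isBounded_badSet l).subset inter_subset_left
  | 1 => (isBounded_badSet l).subset inter_subset_left
  | _ + 2 => Bornology.isBounded_singleton

lemma exists_mem_badPiece {w : ℝ × ℚ_[p]} (h : ¬ Cond12 p w.1 w.2) :
    ∃ l t, w ∈ badPiece p l t := by
  obtain ⟨c, hc, hbad⟩ := exists_badPair_of_not_cond12 h
  have key : ∀ μ : ℝ, 0 < μ → ∃ l : ℕ, w ∈ badSet p l ∧ 1 / ((l : ℝ) + 1) ≤ μ := by
    intro μ hμ
    obtain ⟨l, hl⟩ := exists_nat_ge (max (max (1 / c) (1 / μ)) (max |w.1| ‖w.2‖))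
    have h1 : 1 / c ≤ l := ((le_max_left _ _).trans (le_max_left _ _)).trans hl
    have h2 : 1 / μ ≤ l := ((le_max_right _ _).trans (le_max_left _ _)).trans hl
    have h3 : |w.1| ≤ l := ((le_max_left _ _).trans (le_max_right _ _)).trans hl
    have h4 : ‖w.2‖ ≤ l := ((le_max_right _ _).trans (le_max_right _ _)).trans hl
    have h5 : ∀ x : ℝ, 0 < x → 1 / x ≤ l → 1 / ((l : ℝ) + 1) ≤ x := fun x hx hxl => by
      rw [one_div_le (by positivity) hx]
      linarith
    refine ⟨l, ⟨fun q q₀ hq hq₀ => (h5 c hc h1).trans (hbad q q₀ hq hq₀), ?_, ?_⟩, h5 μ hμ h2⟩ <;>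
      linarith
  by_cases h1 : w.1 = 0
  · by_cases h2 : w.2 = 0
    · exact ⟨0, 2, Prod.ext h1 h2⟩
    · obtain ⟨l, hl, hl'⟩ := key ‖w.2‖ (norm_pos_iff.2 h2)
      exact ⟨l, 1, hl, h1, hl'⟩
  · obtain ⟨l, hl, hl'⟩ := key |w.1| (abs_pos.2 h1)
    exact ⟨l, 0, hl, hl'⟩

end Main

/-- The set of pairs `(u,v) ∈ ℝ × ℚ_p` not satisfying condition (1.2) is a countable union
of (totally bounded) sets of upper box dimension zero (for the max metric on `ℝ × ℚ_p`,
which is the product metric instance); in particular it has Hausdorff dimension zero. -/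
theorem not_cond12_pairs_countable_union_of_boxDim_zero (p : ℕ) [Fact p.Prime] :
    (∃ s : ℕ → Set (ℝ × ℚ_[p]),
      ({w : ℝ × ℚ_[p] | ¬ Cond12 p w.1 w.2} = ⋃ n, s n) ∧
      ∀ n, TotallyBounded (s n) ∧ upperBoxDim dist (s n) = 0) ∧
    dimH {w : ℝ × ℚ_[p] | ¬ Cond12 p w.1 w.2} = 0 := by
  have hq : (1 : ℝ) < (p : ℝ) ^ 2 :=
    one_lt_pow₀ (by exact_mod_cast (Fact.out : p.Prime).one_lt) two_ne_zero
  set S : Set (ℝ × ℚ_[p]) := {w | ¬ Cond12 p w.1 w.2} with hS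
  set s : ℕ → Set (ℝ × ℚ_[p]) := fun n => S ∩ badPiece p n.unpair.1 n.unpair.2 with hs
  have hcov : ∀ n, SubexpCover ((p : ℝ) ^ 2) (s n) := fun n =>
    (subexpCover_badPiece _ _).mono inter_subset_right
  have hunion : S = ⋃ n, s n := by
    refine subset_antisymm (fun w hw => ?_) (iUnion_subset fun n => inter_subset_left)
    obtain ⟨l, t, h⟩ := exists_mem_badPiece hw
    refine mem_iUnion.2 ⟨Nat.pair l t, hw, ?_⟩
    rwa [Nat.unpair_pair]
  refine ⟨⟨s, hunion, fun n => ⟨?_, (hcov n).upperBoxDim_eq_zero hq⟩⟩, ?_⟩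
  · exact (Metric.isCompact_of_isClosed_isBounded isClosed_closure
      ((isBounded_badPiece _ _).subset inter_subset_right).closure).totallyBounded.subset
      subset_closure
  · rw [hunion, dimH_iUnion]
    simp [fun n => (hcov n).dimH_eq_zero hq]
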